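/- For every real number d ≠ 0, every compact set K contained in the open strip D := {s ∈ ℂ : 1/2 < Re(s) < 1} with connected complement in ℂ, and every ε > 0, one has liminf_{T→∞} (1/T)·μ{τ ∈ [0,T] : sup_{s∈K} |log ζ(s+iτ) − log ζ(s+idτ)| < ε} > 0. -/

import Mathlib

open MeasureTheory Filter Complex
open scoped ENNReal

/-- The open strip `D = {s : 1/2 < Re s < 1}`. -/
def strip : Set ℂ := {s : ℂ | 1/2 < s.re ∧ s.re < 1}

/-- Lower density of a set of real numbers:
`liminf_{T→∞} (1/T)·μ(S ∩ [0,T])`. -/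
noncomputable def lowerDens (S : Set ℝ) : ℝ :=
  liminf (fun T : ℝ => (volume (S ∩ Set.Icc 0 T)).toReal / T) atTop

/-- `sup_{s ∈ K} |f s|`, valued in `ℝ≥0∞`. -/
noncomputable def supNorm (K : Set ℂ) (f : ℂ → ℂ) : ℝ≥0∞ :=
  ⨆ s ∈ K, (‖f s‖₊ : ℝ≥0∞)

lemma rolle_count (f f' : ℝ → ℝ) (hf : ∀ x, HasDerivAt f (f' x) x) (a b : ℝ) (Z : Finset ℝ)
    (hZ : ∀ x ∈ Z, x ∈ Set.Icc a b ∧ f x = 0) (k : ℕ) (hk : k + 1 ≤ Z.card) :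
    ∃ Z' : Finset ℝ, Z'.card = k ∧ ∀ x ∈ Z', x ∈ Set.Icc a b ∧ f' x = 0 := by
  classical
  let e := Finset.orderEmbOfCardLe Z hk
  have he : ∀ i, e i ∈ Z := fun i => Finset.orderEmbOfCardLe_mem Z hk i
  have h1 : ∀ i : Fin k, ∃ c, c ∈ Set.Ioo (e i.castSucc) (e i.succ) ∧ f' c = 0 := by
    intro i
    have hlt : e i.castSucc < e i.succ := e.strictMono Fin.castSucc_lt_succ
    obtain ⟨c, hc, h⟩ := exists_hasDerivAt_eq_zero (f := f) (f' := f') hlt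
      (fun x _ => (hf x).continuousAt.continuousWithinAt)
      (by rw [(hZ _ (he _)).2, (hZ _ (he _)).2]) (fun x _ => hf x)
    exact ⟨c, hc, h⟩
  choose c hc hc' using h1
  have hmono : StrictMono c := by
    intro i j hij
    have : e i.succ ≤ e j.castSucc := e.monotone (by
      rw [Fin.le_def]; simp; exact hij)
    exact (hc i).2.trans_le (this.trans (hc j).1.le)
  refine ⟨Finset.univ.image c, ?_, ?_⟩
  · rw [Finset.card_image_of_injective _ hmono.injective]; simp
  · intro x hx
    simp only [Finset.mem_image, Finset.mem_univ, true_and] at hx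
    obtain ⟨i, rfl⟩ := hx
    refine ⟨⟨?_, ?_⟩, hc' i⟩
    · exact (hZ _ (he _)).1.1.trans (hc i).1.le
    · exact (hc i).2.le.trans (hZ _ (he _)).1.2

lemma rolle_iter (f : ℕ → ℝ → ℝ) (hf : ∀ j x, HasDerivAt (f j) (f (j+1) x) x) (a b : ℝ)
    (N : ℕ) (Z : Finset ℝ) (hcard : N + 1 ≤ Z.card)
    (hZ : ∀ x ∈ Z, x ∈ Set.Icc a b ∧ f 0 x = 0) :
    ∃ ξ ∈ Set.Icc a b, f N ξ = 0 := by
  have key : ∀ j, j ≤ N → ∃ Z' : Finset ℝ, N + 1 - j ≤ Z'.card ∧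
      ∀ x ∈ Z', x ∈ Set.Icc a b ∧ f j x = 0 := by
    intro j
    induction j with
    | zero => intro _; exact ⟨Z, by simpa using hcard, hZ⟩
    | succ j ih =>
      intro hj
      obtain ⟨Z', h1, h2⟩ := ih (by omega)
      obtain ⟨Z'', h3, h4⟩ := rolle_count (f j) (f (j+1)) (hf j) a b Z' h2 (N - j) (by omega)
      exact ⟨Z'', by omega, h4⟩
  obtain ⟨Z', h1, h2⟩ := key N le_rfl
  have : 0 < Z'.card := by omega
  obtain ⟨ξ, hξ⟩ := Finset.card_pos.1 this
  exact ⟨ξ, h2 ξ hξ⟩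

lemma interp_error (f : ℕ → ℝ → ℝ) (hf : ∀ j x, HasDerivAt (f j) (f (j+1) x) x) (a b : ℝ)
    (Z : Finset ℝ) (hZ : ∀ x ∈ Z, x ∈ Set.Icc a b) (C : ℝ)
    (hC : ∀ x ∈ Set.Icc a b, |f Z.card x| ≤ C) (t : ℝ) (ht : t ∈ Set.Icc a b) :
    |f 0 t - ∑ z ∈ Z, f 0 z * ∏ w ∈ Z.erase z, (t - w) / (z - w)| ≤
      C / (Z.card).factorial * ∏ z ∈ Z, |t - z| := by
  classical
  set N := Z.card
  have hC0 : 0 ≤ C := (abs_nonneg _).trans (hC t ht)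
  let P : Polynomial ℝ := Lagrange.interpolate Z id (f 0)
  let Ω : Polynomial ℝ := Lagrange.nodal Z id
  have hPe : ∀ x, P.eval x = ∑ z ∈ Z, f 0 z * ∏ w ∈ Z.erase z, (x - w) / (z - w) := by
    intro x
    simp only [P, Lagrange.interpolate_apply, Polynomial.eval_finsetSum, Polynomial.eval_mul,
      Polynomial.eval_C, Lagrange.basis, Polynomial.eval_prod, Lagrange.basisDivisor, id]
    refine Finset.sum_congr rfl fun z hz => ?_
    congr 1
    refine Finset.prod_congr rfl fun w hw => ?_
    simp [div_eq_inv_mul]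
  rw [← hPe]
  by_cases htZ : t ∈ Z
  · have : P.eval t = f 0 t := Lagrange.eval_interpolate_at_node (f 0) (Set.injOn_id _) htZ
    rw [this, sub_self, abs_zero]
    exact mul_nonneg (by positivity) (Finset.prod_nonneg fun _ _ => abs_nonneg _)
  have hΩe : ∀ x, Ω.eval x = ∏ z ∈ Z, (x - z) := by
    intro x; simp [Ω, Lagrange.eval_nodal]
  have hΩt : Ω.eval t ≠ 0 := by
    rw [hΩe, Finset.prod_ne_zero_iff]
    intro z hz h
    exact htZ (by rw [sub_eq_zero.1 h]; exact hz)
  set l := (f 0 t - P.eval t) / Ω.eval t with hl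
  let g : ℕ → ℝ → ℝ := fun j x => f j x - (Polynomial.derivative^[j] P).eval x
    - l * (Polynomial.derivative^[j] Ω).eval x
  have hg : ∀ j x, HasDerivAt (g j) (g (j+1) x) x := by
    intro j x
    have h1 := (Polynomial.derivative^[j] P).hasDerivAt x
    have h2 := (Polynomial.derivative^[j] Ω).hasDerivAt x
    simp only [g, Function.iterate_succ_apply']
    exact ((hf j x).sub h1).sub (h2.const_mul l)
  obtain ⟨ξ, hξ, h0⟩ := rolle_iter g hg a b N (insert t Z) (by
      rw [Finset.card_insert_of_notMem htZ]) (by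
      intro x hx
      rcases Finset.mem_insert.1 hx with rfl | hx
      · refine ⟨ht, ?_⟩
        simp only [g, Function.iterate_zero, id]
        rw [hl]; field_simp; ring
      · refine ⟨hZ x hx, ?_⟩
        have h1 : P.eval x = f 0 x := Lagrange.eval_interpolate_at_node (f 0) (Set.injOn_id _) hx
        have h2 : Ω.eval x = 0 := by
          rw [hΩe]; exact Finset.prod_eq_zero hx (sub_self x)
        simp [g, h1, h2])
  have hP0 : Polynomial.derivative^[N] P = 0 := by
    apply Polynomial.iterate_derivative_eq_zero_of_degree_lt
    exact Lagrange.degree_interpolate_lt (f 0) (Set.injOn_id _)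
  have hΩN : Polynomial.derivative^[N] Ω = Polynomial.C (N.factorial : ℝ) := by
    have hm : Ω.Monic := Lagrange.nodal_monic
    have hd : Ω.natDegree = N := by simp [Ω, Lagrange.natDegree_nodal, N]
    have hc : ∀ m, (Polynomial.derivative^[N] Ω).coeff m = if m = 0 then (N.factorial : ℝ) else 0 := by
      intro m
      rw [Polynomial.coeff_iterate_derivative]
      split_ifs with h
      · subst h
        have h1 : Ω.coeff (0 + N) = 1 := by rw [zero_add, ← hd]; exact hm
        rw [h1, zero_add, Nat.descFactorial_self]; simp
      · rw [Polynomial.coeff_eq_zero_of_natDegree_lt (by omega)]; simp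
    ext m
    rw [hc, Polynomial.coeff_C]
  simp only [g, hP0, hΩN, Polynomial.eval_zero, Polynomial.eval_C, sub_zero] at h0
  have hfac : (0:ℝ) < N.factorial := by positivity
  have hl2 : l = f N ξ / N.factorial := by field_simp; linarith
  have h3 : f 0 t - P.eval t = l * Ω.eval t := by rw [hl]; field_simp
  rw [h3, hl2, abs_mul, abs_div, abs_of_pos hfac, hΩe, Finset.abs_prod]
  gcongr
  exact hC ξ hξ

lemma expsum_zero (S : Finset ℝ) : ∀ (a : ℝ → ℝ) (Z : Finset ℝ), S.card ≤ Z.card →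
    (∀ x ∈ Z, ∑ w ∈ S, a w * Real.exp (w * x) = 0) → ∀ w ∈ S, a w = 0 := by
  classical
  induction S using Finset.induction_on with
  | empty => intro a Z _ _ w hw; simp at hw
  | insert w0 S hw0 ih =>
    intro a Z hcard hz
    rw [Finset.card_insert_of_notMem hw0] at hcard
    let F : ℝ → ℝ := fun x => a w0 + ∑ w ∈ S, a w * Real.exp ((w - w0) * x)
    let F' : ℝ → ℝ := fun x => ∑ w ∈ S, a w * (Real.exp ((w - w0) * x) * (w - w0))
    have hF : ∀ x, HasDerivAt F (F' x) x := by
      intro x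
      refine HasDerivAt.const_add _ ?_
      refine HasDerivAt.fun_sum fun w _ => ?_
      refine HasDerivAt.const_mul _ ?_
      simpa using ((hasDerivAt_id x).const_mul (w - w0)).exp
    have hFz : ∀ x ∈ Z, F x = 0 := by
      intro x hx
      have h := hz x hx
      rw [Finset.sum_insert hw0] at h
      have : F x = Real.exp (-(w0*x)) * (a w0 * Real.exp (w0 * x) + ∑ w ∈ S, a w * Real.exp (w * x)) := by
        simp only [F, mul_add, Finset.mul_sum]
        congr 1
        · rw [mul_left_comm, ← Real.exp_add]; simp
        · refine Finset.sum_congr rfl fun w _ => ?_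
          rw [mul_left_comm, ← Real.exp_add]; congr 2; ring
      rw [this, h, mul_zero]
    have hne : Z.Nonempty := Finset.card_pos.1 (by omega)
    obtain ⟨Z', h1, h2⟩ := rolle_count F F' hF (Z.min' hne) (Z.max' hne) Z
      (fun x hx => ⟨⟨Finset.min'_le _ _ hx, Finset.le_max' _ _ hx⟩, hFz x hx⟩) S.card hcard
    have h3 := ih (fun w => a w * (w - w0)) Z' h1.ge (by
      intro x hx
      have h := (h2 x hx).2
      have : ∑ w ∈ S, a w * (w - w0) * Real.exp (w * x) = Real.exp (w0 * x) * F' x := by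
        simp only [F', Finset.mul_sum]
        refine Finset.sum_congr rfl fun w _ => ?_
        have : Real.exp (w * x) = Real.exp (w0 * x) * Real.exp ((w - w0) * x) := by
          rw [← Real.exp_add]; congr 1; ring
        rw [this]; ring
      rw [this, h, mul_zero])
    have h4 : ∀ w ∈ S, a w = 0 := by
      intro w hw
      have := h3 w hw
      rcases mul_eq_zero.1 this with h | h
      · exact h
      · exfalso; rw [sub_eq_zero] at h; exact hw0 (h ▸ hw)
    intro w hw
    rcases Finset.mem_insert.1 hw with rfl | hw
    · obtain ⟨x, hx⟩ := hne
      have h := hFz x hx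
      simp only [F] at h
      rw [Finset.sum_eq_zero (fun w hw => by rw [h4 w hw, zero_mul]), add_zero] at h
      exact h
    · exact h4 w hw

lemma exp_entry (d : ℝ) (y : Fin 4 → ℝ) (D : ℕ) (A B : Fin 4 → ℕ)
    (hA : ∀ i, (A i : ℝ) = D * Real.exp (y i)) (hB : ∀ i, (B i : ℝ) = D * Real.exp (d * y i))
    (H : ℕ) (hDH : D ≤ H) (hAH : ∀ i, A i ≤ H) (hBH : ∀ i, B i ≤ H)
    (j k : ℕ) (m : Fin 4 → ℕ) (E : ℕ) (hE : ∑ i, (j * m i + k * m i) ≤ E) :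
    ∃ z : ℕ, (z : ℝ) = (D : ℝ) ^ E * Real.exp ((j + k * d) * ∑ i, m i * y i) ∧ z ≤ H ^ E := by
  refine ⟨D ^ (E - ∑ i, (j * m i + k * m i)) * ∏ i, (A i ^ (j * m i) * B i ^ (k * m i)), ?_, ?_⟩
  · push_cast
    simp only [hA, hB, mul_pow]
    have h1 : ∏ i, ((D:ℝ) ^ (j * m i) * Real.exp (y i) ^ (j * m i) *
        ((D:ℝ) ^ (k * m i) * Real.exp (d * y i) ^ (k * m i))) =
        (D:ℝ) ^ (∑ i, (j * m i + k * m i)) * Real.exp ((j + k * d) * ∑ i, m i * y i) := by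
      rw [Finset.mul_sum, Real.exp_sum, ← Finset.prod_pow_eq_pow_sum, ← Finset.prod_mul_distrib]
      refine Finset.prod_congr rfl fun i _ => ?_
      rw [← Real.exp_nat_mul, ← Real.exp_nat_mul, pow_add]
      have : Real.exp ((↑j + ↑k * d) * (↑(m i) * y i)) =
        Real.exp (((j * m i : ℕ):ℝ) * y i) * Real.exp (((k * m i : ℕ):ℝ) * (d * y i)) := by
        rw [← Real.exp_add]; congr 1; push_cast; ring
      rw [this]; ring
    rw [h1, ← mul_assoc, ← pow_add, Nat.sub_add_cancel hE]
  · calc D ^ (E - ∑ i, (j * m i + k * m i)) * ∏ i, (A i ^ (j * m i) * B i ^ (k * m i))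
        ≤ H ^ (E - ∑ i, (j * m i + k * m i)) * ∏ i, (H ^ (j * m i) * H ^ (k * m i)) := by
          gcongr with i hi i hi
          · exact hAH i
          · exact hBH i
      _ = H ^ E := by
          simp_rw [← pow_add]
          rw [Finset.prod_pow_eq_pow_sum, ← pow_add, Nat.sub_add_cancel hE]

lemma four_exp_num (G κ : ℝ) (hG : 1 ≤ G) (hκ : 0 ≤ κ) : ∃ M : ℕ, 1 ≤ M ∧
    16 * (M:ℝ)^8 * G ^ (M^3) * (κ / M) ^ (M^4) < 1 := by
  obtain ⟨M1, hM1⟩ := exists_nat_ge (2 * κ)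
  obtain ⟨M2, hM2⟩ := pow_unbounded_of_one_lt (16 * Real.exp 8 * G) (one_lt_two : (1:ℝ) < 2)
  set M := M1 + M2 + 1 with hM
  have hM0 : (1:ℝ) ≤ M := by rw [hM]; push_cast; linarith [(Nat.cast_nonneg M1 : (0:ℝ) ≤ M1), (Nat.cast_nonneg M2 : (0:ℝ) ≤ M2)]
  refine ⟨M, by omega, ?_⟩
  have h2M : 16 * Real.exp 8 * G < 2 ^ M := hM2.trans_le (pow_le_pow_right₀ one_le_two (by omega))
  have hk : κ / M ≤ 1 / 2 := by
    rw [div_le_div_iff₀ (by linarith) (by norm_num)]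
    have : (M1:ℝ) ≤ M := by rw [hM]; exact_mod_cast (by omega)
    linarith
  have hM3 : 1 ≤ M ^ 3 := Nat.one_le_pow _ _ (by omega)
  have e1 : (16:ℝ) ≤ 16 ^ (M^3) := le_self_pow₀ (by norm_num) (by omega)
  have e2 : (M:ℝ)^8 ≤ Real.exp 8 ^ (M^3) := by
    calc (M:ℝ)^8 ≤ (Real.exp M)^8 := by
            gcongr; linarith [Real.add_one_le_exp (M:ℝ)]
      _ = Real.exp 8 ^ M := by rw [← Real.exp_nat_mul, ← Real.exp_nat_mul]; congr 1; push_cast; ring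
      _ ≤ Real.exp 8 ^ (M^3) := pow_le_pow_right₀ (Real.one_le_exp (by norm_num)) (Nat.le_self_pow (by norm_num) M)
  calc 16 * (M:ℝ)^8 * G ^ (M^3) * (κ / M) ^ (M^4)
      ≤ 16 ^ (M^3) * Real.exp 8 ^ (M^3) * G ^ (M^3) * (1/2) ^ (M^4) := by gcongr
    _ = (16 * Real.exp 8 * G) ^ (M^3) * (1/2) ^ (M^4) := by rw [mul_pow, mul_pow]
    _ < (2 ^ M) ^ (M^3) * (1/2) ^ (M^4) := by
        gcongr
    _ = 1 := by rw [← pow_mul, ← pow_succ', ← mul_pow]; norm_num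

attribute [local instance] Matrix.seminormedAddCommGroup in
lemma siegel_simple {α β : Type*} [Fintype α] [Fintype β] (A : Matrix α β ℤ)
    (hm : 0 < Fintype.card α) (h2 : 2 * Fintype.card α ≤ Fintype.card β)
    (X : ℝ) (hX : 1 ≤ X) (hA : ∀ i j, |(A i j : ℝ)| ≤ X) :
    ∃ t : β → ℤ, t ≠ 0 ∧ (∀ i, ∑ j, A i j * t j = 0) ∧ ∀ j, |(t j : ℝ)| ≤ Fintype.card β * X := by
  obtain ⟨t, h0, h1, h3⟩ := Int.Matrix.exists_ne_zero_int_vec_norm_le A (by omega) hm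
  refine ⟨t, h0, fun i => congrFun h1 i, fun j => ?_⟩
  have hj : ‖t j‖ ≤ ‖t‖ := norm_le_pi_norm t j
  rw [Int.norm_eq_abs] at hj
  refine hj.trans (h3.trans ?_)
  have hcb : (1:ℝ) ≤ Fintype.card β := by exact_mod_cast (by omega)
  have hnA : ‖A‖ ≤ X := by
    rw [Matrix.norm_le_iff (by linarith)]
    intro i j; rw [Int.norm_eq_abs]; exact hA i j
  have hb : 1 ≤ (Fintype.card β : ℝ) * max 1 ‖A‖ := one_le_mul_of_one_le_of_one_le hcb (le_max_left _ _)
  calc ((Fintype.card β : ℝ) * max 1 ‖A‖) ^ ((Fintype.card α : ℝ) / (Fintype.card β - Fintype.card α))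
      ≤ ((Fintype.card β : ℝ) * max 1 ‖A‖) ^ (1:ℝ) := by
        apply Real.rpow_le_rpow_of_exponent_le hb
        have : 2 * (Fintype.card α : ℝ) ≤ Fintype.card β := by exact_mod_cast h2
        have h5 : (0:ℝ) < Fintype.card α := by exact_mod_cast hm
        rw [div_le_one (by linarith)]; linarith
    _ ≤ Fintype.card β * X := by
        rw [Real.rpow_one]; gcongr; exact max_le hX hnA

lemma four_exp (d : ℝ) (hd : Irrational d) (y : Fin 4 → ℝ)
    (hy : ∀ m : Fin 4 → ℤ, ∑ i, (m i : ℝ) * y i = 0 → m = 0) (a b : Fin 4 → ℚ)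
    (ha : ∀ i, Real.exp (y i) = a i) (hb : ∀ i, Real.exp (d * y i) = b i) : False := by
  classical
  -- denominators
  obtain ⟨D, A, B, hD, hA, hB⟩ : ∃ (D : ℕ) (A B : Fin 4 → ℕ), 1 ≤ D ∧
      (∀ i, (A i : ℝ) = D * Real.exp (y i)) ∧ (∀ i, (B i : ℝ) = D * Real.exp (d * y i)) := by
    have key : ∀ (D : ℕ) (q : ℚ), 0 < q → q.den ∣ D → ∃ n : ℕ, (n : ℝ) = D * (q : ℝ) := by
      intro D q hq hdvd
      obtain ⟨c, rfl⟩ := hdvd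
      refine ⟨c * q.num.toNat, ?_⟩
      have h1 : ((q.num.toNat : ℕ) : ℝ) = (q.num : ℝ) := by
        have : ((q.num.toNat : ℕ) : ℤ) = q.num := Int.toNat_of_nonneg (Rat.num_nonneg.2 hq.le)
        exact_mod_cast this
      have h2 : (q.den : ℝ) * (q : ℝ) = q.num := by
        exact_mod_cast Rat.den_mul_eq_num q
      push_cast
      rw [h1, mul_comm (q.den : ℝ) c, mul_assoc, h2]
    have pa : ∀ i, 0 < a i := fun i => by
      have := Real.exp_pos (y i); rw [ha] at this; exact_mod_cast this
    have pb : ∀ i, 0 < b i := fun i => by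
      have := Real.exp_pos (d * y i); rw [hb] at this; exact_mod_cast this
    set D := ∏ i, ((a i).den * (b i).den) with hDdef
    have h1 : ∀ i, (a i).den ∣ D := fun i =>
      (Dvd.intro _ rfl).trans (Finset.dvd_prod_of_mem (fun i => (a i).den * (b i).den) (Finset.mem_univ i))
    have h2 : ∀ i, (b i).den ∣ D := fun i =>
      (Dvd.intro_left _ rfl).trans (Finset.dvd_prod_of_mem (fun i => (a i).den * (b i).den) (Finset.mem_univ i))
    choose A hA using fun i => key D (a i) (pa i) (h1 i)
    choose B hB using fun i => key D (b i) (pb i) (h2 i)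
    refine ⟨D, A, B, ?_, fun i => by rw [ha, hA], fun i => by rw [hb, hB]⟩
    exact Nat.one_le_iff_ne_zero.2 (Finset.prod_ne_zero_iff.2 fun i _ =>
      mul_ne_zero (Rat.den_ne_zero _) (Rat.den_ne_zero _))
  set H : ℕ := D + ∑ i, A i + ∑ i, B i with hH
  have hDH : D ≤ H := by omega
  have hAH : ∀ i, A i ≤ H := fun i => by
    have := Finset.single_le_sum (f := A) (fun _ _ => Nat.zero_le _) (Finset.mem_univ i); omega
  have hBH : ∀ i, B i ≤ H := fun i => by
    have := Finset.single_le_sum (f := B) (fun _ _ => Nat.zero_le _) (Finset.mem_univ i); omega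
  have hH1 : 1 ≤ H := hD.trans hDH
  have hH1' : (1:ℝ) ≤ H := by exact_mod_cast hH1
  have hDH' : (D:ℝ) ≤ H := by exact_mod_cast hDH
  have hD' : (1:ℝ) ≤ D := by exact_mod_cast hD
  set q : ℝ := 1 + |d| with hq
  have hq0 : 1 ≤ q := by rw [hq]; linarith [abs_nonneg d]
  set Y : ℝ := ∑ i, |y i| with hY
  have hY0 : 0 ≤ Y := Finset.sum_nonneg fun _ _ => abs_nonneg _
  obtain ⟨M, hM1, hM⟩ := four_exp_num ((H:ℝ)^48 * Real.exp (4 * q * Y)) (8 * q * Y * Real.exp 1)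
    (one_le_mul_of_one_le_of_one_le (one_le_pow₀ hH1') (Real.one_le_exp (by positivity))) (by positivity)
  have hM1' : (1:ℝ) ≤ M := by exact_mod_cast hM1
  set J : ℕ := 2 * M ^ 2 with hJ
  let pt : (Fin 4 → ℕ) → ℝ := fun m => ∑ i, (m i : ℝ) * y i
  have hpt_inj : Function.Injective pt := by
    intro m m' h
    have := hy (fun i => (m i : ℤ) - m' i) (by
      push_cast
      simp only [sub_mul, Finset.sum_sub_distrib]
      exact sub_eq_zero.2 h)
    funext i
    have h2 := congrFun this i
    simp only [Pi.zero_apply] at h2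
    omega
  have hpt_bd : ∀ m : Fin 4 → ℕ, (∀ i, m i < 2 * M) → |pt m| ≤ 2 * M * Y := by
    intro m hm
    calc |pt m| ≤ ∑ i, |(m i : ℝ) * y i| := Finset.abs_sum_le_sum_abs _ _
      _ ≤ ∑ i, 2 * M * |y i| := by
          refine Finset.sum_le_sum fun i _ => ?_
          rw [abs_mul, Nat.abs_cast]
          gcongr
          have := (hm i).le
          exact_mod_cast this
      _ = 2 * M * Y := by rw [hY, Finset.mul_sum]
  let ex : Fin J × Fin J → ℝ := fun jk => (jk.1 : ℕ) + (jk.2 : ℕ) * d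
  have hex_inj : Function.Injective ex := by
    rintro ⟨j, k⟩ ⟨j', k'⟩ h
    simp only [ex] at h
    by_cases hk : k = k'
    · subst hk
      have : ((j:ℕ):ℝ) = (j':ℕ) := by linarith
      have : (j:ℕ) = j' := by exact_mod_cast this
      rw [Fin.ext this]
    · exfalso
      have hk' : ((k:ℕ):ℝ) - (k':ℕ) ≠ 0 := by
        intro h0
        apply hk
        apply Fin.ext
        have : ((k:ℕ):ℝ) = (k':ℕ) := by linarith
        exact_mod_cast this
      apply hd
      refine ⟨((j':ℕ) - (j:ℕ) : ℚ) / ((k:ℕ) - (k':ℕ) : ℚ), ?_⟩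
      push_cast
      rw [div_eq_iff hk']; linarith
  have hex_bd : ∀ jk, |ex jk| ≤ J * q := by
    rintro ⟨j, k⟩
    have hj : ((j:ℕ):ℝ) ≤ J := by exact_mod_cast j.2.le
    have hk : ((k:ℕ):ℝ) ≤ J := by exact_mod_cast k.2.le
    calc |ex (j,k)| ≤ |((j:ℕ):ℝ)| + |((k:ℕ):ℝ) * d| := abs_add_le _ _
      _ ≤ J + J * |d| := by
          rw [abs_mul, Nat.abs_cast, Nat.abs_cast]; gcongr
      _ = J * q := by rw [hq]; ring
  have hEsum : ∀ (M' : ℕ) (m : Fin 4 → ℕ) (jk : Fin J × Fin J), (∀ i, m i ≤ M') →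
      ∑ i, ((jk.1:ℕ) * m i + (jk.2:ℕ) * m i) ≤ 8 * J * M' := by
    intro M' m jk hm
    calc ∑ i, ((jk.1:ℕ) * m i + (jk.2:ℕ) * m i) ≤ ∑ i : Fin 4, (J * M' + J * M') := by
          refine Finset.sum_le_sum fun i _ => ?_
          have h1 := jk.1.2.le
          have h2 := jk.2.2.le
          have h3 := hm i
          gcongr
      _ = 8 * J * M' := by simp; ring
  -- Siegel
  have hz := fun (m : Fin 4 → Fin M) (jk : Fin J × Fin J) =>
    exp_entry d y D A B hA hB H hDH hAH hBH jk.1 jk.2 (fun i => m i) (8 * J * M)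
      (hEsum M (fun i => m i) jk (fun i => (m i).2.le))
  choose z hz1 hz2 using hz
  obtain ⟨t, ht0, ht1, ht2⟩ := siegel_simple (Matrix.of fun m jk => (z m jk : ℤ))
    (by simp; positivity) (by
      simp only [Fintype.card_fun, Fintype.card_fin, Fintype.card_prod]
      rw [hJ]; nlinarith [Nat.one_le_pow 4 M hM1])
    ((H:ℝ) ^ (8 * J * M)) (one_le_pow₀ hH1') (by
      intro m jk
      simp only [Matrix.of_apply, Int.cast_natCast, Nat.abs_cast]
      exact_mod_cast hz2 m jk)
  have hcard : (Fintype.card (Fin J × Fin J) : ℝ) = 4 * (M:ℝ)^4 := by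
    simp only [Fintype.card_prod, Fintype.card_fin, hJ]; push_cast; ring
  rw [hcard] at ht2
  let f : ℕ → ℝ → ℝ := fun r x => ∑ jk, (t jk : ℝ) * (ex jk ^ r * Real.exp (ex jk * x))
  have hf : ∀ r x, HasDerivAt (f r) (f (r+1) x) x := by
    intro r x
    refine HasDerivAt.fun_sum fun jk _ => ?_
    refine HasDerivAt.const_mul _ ?_
    have h := (((hasDerivAt_id x).const_mul (ex jk)).exp).const_mul (ex jk ^ r)
    simp only [id_eq] at h
    convert h using 1
    ring
  have hf0 : ∀ m : Fin 4 → Fin M, f 0 (pt fun i => m i) = 0 := by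
    intro m
    have h := ht1 m
    have h2 : (D:ℝ) ^ (8 * J * M) * f 0 (pt fun i => m i) = 0 := by
      rw [← Int.cast_inj (α := ℝ)] at h
      push_cast at h
      rw [← h, Finset.mul_sum]
      refine Finset.sum_congr rfl fun jk _ => ?_
      simp only [Matrix.of_apply, Int.cast_natCast]
      rw [hz1]
      simp only [ex, pt, pow_zero, one_mul]
      ring
    rcases mul_eq_zero.1 h2 with h3 | h3
    · exfalso; exact pow_ne_zero _ (by linarith) h3
    · exact h3
  let Z : Finset ℝ := Finset.univ.image fun m : Fin 4 → Fin M => pt fun i => m i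
  have hZcard : Z.card = M ^ 4 := by
    rw [Finset.card_image_of_injective]
    · simp
    · intro m m' h
      have := hpt_inj h
      funext i
      exact Fin.ext (congrFun this i)
  set X : ℝ := 2 * M * Y with hX
  have hZ : ∀ x ∈ Z, x ∈ Set.Icc (-X) X := by
    intro x hx
    simp only [Z, Finset.mem_image, Finset.mem_univ, true_and] at hx
    obtain ⟨m, rfl⟩ := hx
    exact abs_le.1 (hpt_bd _ (fun i => by have := (m i).2; omega))
  set C : ℝ := (4 * (M:ℝ)^4) * ((4 * (M:ℝ)^4 * (H:ℝ) ^ (8 * J * M)) * ((J * q) ^ (M^4) * Real.exp (J * q * X))) with hC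
  have hCb : ∀ x ∈ Set.Icc (-X) X, |f Z.card x| ≤ C := by
    intro x hx
    rw [hZcard]
    calc |f (M^4) x| ≤ ∑ jk, |(t jk : ℝ) * (ex jk ^ (M^4) * Real.exp (ex jk * x))| :=
          Finset.abs_sum_le_sum_abs _ _
      _ ≤ ∑ jk : Fin J × Fin J, (4 * (M:ℝ)^4 * (H:ℝ) ^ (8 * J * M)) * ((J * q) ^ (M^4) * Real.exp (J * q * X)) := by
          refine Finset.sum_le_sum fun jk _ => ?_
          rw [abs_mul, abs_mul, abs_pow, Real.abs_exp]
          have hexp : ex jk * x ≤ J * q * X := by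
            calc ex jk * x ≤ |ex jk| * |x| := by rw [← abs_mul]; exact le_abs_self _
              _ ≤ J * q * X := by
                exact mul_le_mul (hex_bd jk) (abs_le.2 hx) (abs_nonneg _) (by positivity)
          exact mul_le_mul (ht2 jk) (mul_le_mul (pow_le_pow_left₀ (abs_nonneg _) (hex_bd jk) _)
            (Real.exp_le_exp.2 hexp) (Real.exp_pos _).le (by positivity)) (by positivity) (by positivity)
      _ = C := by
          rw [Finset.sum_const, nsmul_eq_mul, Finset.card_univ, hcard]
  have hfz : ∀ m : Fin 4 → Fin (2 * M), f 0 (pt fun i => m i) = 0 := by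
    intro m
    set x := pt fun i => (m i : ℕ) with hx
    have hxI : x ∈ Set.Icc (-X) X := abs_le.1 (hpt_bd _ (fun i => (m i).2))
    have h1 := interp_error f hf (-X) X Z hZ C hCb x hxI
    rw [Finset.sum_eq_zero, sub_zero, hZcard] at h1
    swap
    · intro w hw
      simp only [Z, Finset.mem_image, Finset.mem_univ, true_and] at hw
      obtain ⟨m, rfl⟩ := hw
      rw [hf0, zero_mul]
    have h2 : ∏ w ∈ Z, |x - w| ≤ (4 * M * Y) ^ (M^4) := by
      rw [← hZcard, ← Finset.prod_const]
      refine Finset.prod_le_prod (fun w _ => abs_nonneg _) fun w hw => ?_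
      have := hZ w hw
      rw [abs_le]; constructor <;> [linarith [this.2, hxI.1]; linarith [this.1, hxI.2]]
    -- integrality
    have h3 : ∃ n : ℤ, (n : ℝ) = (D:ℝ) ^ (8 * J * (2 * M)) * f 0 x := by
      have hz' := fun (jk : Fin J × Fin J) =>
        exp_entry d y D A B hA hB H hDH hAH hBH jk.1 jk.2 (fun i => m i) (8 * J * (2 * M))
          (hEsum (2 * M) (fun i => m i) jk (fun i => (m i).2.le))
      choose z' hz1' hz2' using hz'
      refine ⟨∑ jk, (z' jk : ℤ) * t jk, ?_⟩
      push_cast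
      rw [Finset.mul_sum]
      refine Finset.sum_congr rfl fun jk _ => ?_
      rw [hz1']
      simp only [ex, hx, pt, pow_zero, one_mul]
      ring
    obtain ⟨n, hn⟩ := h3
    have hfac : ((M:ℝ)^4) ^ (M^4) / (M^4).factorial ≤ Real.exp 1 ^ (M^4) := by
      have := Real.pow_div_factorial_le_exp (x := ((M^4 : ℕ) : ℝ)) (by positivity) (M^4)
      rw [← Real.exp_nat_mul, mul_one]
      push_cast at this ⊢
      exact this
    have h4 : |(n:ℝ)| < 1 := by
      rw [hn, abs_mul, abs_of_nonneg (by positivity : (0:ℝ) ≤ (D:ℝ) ^ (8 * J * (2 * M)))]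
      calc (D:ℝ) ^ (8 * J * (2 * M)) * |f 0 x|
          ≤ (H:ℝ) ^ (8 * J * (2 * M)) * (C / (M^4).factorial * (4 * M * Y) ^ (M^4)) := by
            gcongr
            exact h1.trans (by gcongr)
        _ = 16 * (M:ℝ)^8 * ((H:ℝ)^48 * Real.exp (4 * q * Y)) ^ (M^3) *
            ((8 * q * Y / M) ^ (M^4) * (((M:ℝ)^4) ^ (M^4) / (M^4).factorial)) := by
            have e1 : 8 * J * (2 * M) = 32 * M^3 := by rw [hJ]; ring
            have e2 : 8 * J * M = 16 * M^3 := by rw [hJ]; ring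
            have e3 : (J:ℝ) * q * X = (M^3 : ℕ) * (4 * q * Y) := by rw [hJ, hX]; push_cast; ring
            have e4 : (8 * q * Y / M) ^ (M^4) * ((M:ℝ)^4) ^ (M^4) = (J * q) ^ (M^4) * (4 * M * Y) ^ (M^4) := by
              rw [← mul_pow, ← mul_pow, hJ]; congr 1; push_cast; field_simp; ring
            have e5 : (H:ℝ) ^ (32 * M^3) * (H:ℝ) ^ (16 * M^3) = ((H:ℝ)^48) ^ (M^3) := by
              rw [← pow_add, ← pow_mul]; congr 1; ring
            rw [hC, e1, e2, e3, Real.exp_nat_mul, mul_pow _ (Real.exp _), ← e5, ← mul_div_assoc, e4]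
            ring
        _ ≤ 16 * (M:ℝ)^8 * ((H:ℝ)^48 * Real.exp (4 * q * Y)) ^ (M^3) *
            ((8 * q * Y / M) ^ (M^4) * Real.exp 1 ^ (M^4)) := by gcongr
        _ = 16 * (M:ℝ)^8 * ((H:ℝ)^48 * Real.exp (4 * q * Y)) ^ (M^3) * ((8 * q * Y * Real.exp 1) / M) ^ (M^4) := by
            rw [← mul_pow]; congr 2; ring
        _ < 1 := hM
    have h5 : n = 0 := by
      have : |n| < 1 := by exact_mod_cast h4
      exact Int.abs_lt_one_iff.1 this
    rw [h5, Int.cast_zero] at hn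
    rcases mul_eq_zero.1 hn.symm with h6 | h6
    · exfalso; exact pow_ne_zero _ (by linarith) h6
    · exact h6
  -- zero estimate
  have hJ0 : 0 < J := by rw [hJ]; positivity
  haveI : Nonempty (Fin J × Fin J) := ⟨⟨⟨0, hJ0⟩, ⟨0, hJ0⟩⟩⟩
  let inv := Function.invFun ex
  have hinv : ∀ jk, inv (ex jk) = jk := Function.leftInverse_invFun hex_inj
  let Z2 : Finset ℝ := Finset.univ.image fun m : Fin 4 → Fin (2 * M) => pt fun i => m i
  have hZ2card : Z2.card = (2 * M) ^ 4 := by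
    rw [Finset.card_image_of_injective]
    · simp
    · intro m m' h
      have := hpt_inj h
      funext i
      exact Fin.ext (congrFun this i)
  have hfin := expsum_zero (Finset.univ.image ex) (fun w => (t (inv w) : ℝ)) Z2 (by
      rw [hZ2card, Finset.card_image_of_injective _ hex_inj, Finset.card_univ]
      simp only [Fintype.card_prod, Fintype.card_fin, hJ]
      nlinarith [Nat.zero_le (M^4)]) (by
      intro x hx
      simp only [Z2, Finset.mem_image, Finset.mem_univ, true_and] at hx
      obtain ⟨m, rfl⟩ := hx
      rw [Finset.sum_image (fun _ _ _ _ h => hex_inj h), ← hfz m]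
      refine Finset.sum_congr rfl fun jk _ => ?_
      rw [hinv]; simp)
  apply ht0
  funext jk
  have := hfin (ex jk) (Finset.mem_image_of_mem _ (Finset.mem_univ _))
  simp only [hinv] at this
  exact_mod_cast this

/-- `∑ f_p log p`. -/
noncomputable def lamP : (Nat.Primes →₀ ℚ) →ₗ[ℚ] ℝ :=
  Finsupp.linearCombination ℚ (fun p : Nat.Primes => Real.log (p : ℕ))

lemma lamP_single (p : Nat.Primes) (c : ℚ) : lamP (Finsupp.single p c) = c * Real.log (p:ℕ) := by
  simp [lamP, Rat.smul_def]

lemma log_primes_indep : LinearIndependent ℚ (fun p : Nat.Primes => Real.log (p : ℕ)) := by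
  rw [← LinearIndependent.iff_fractionRing (R := ℤ), linearIndependent_iff']
  intro s f hf q hq
  have h1 : ∏ p ∈ s, ((p : ℕ) : ℚ) ^ (f p) = 1 := by
    have : ∏ p ∈ s, ((p : ℕ) : ℝ) ^ (f p) = 1 := by
      rw [← Real.exp_zero, ← hf, Real.exp_sum]
      refine Finset.prod_congr rfl fun p _ => ?_
      have hp : (0:ℝ) < (p:ℕ) := by exact_mod_cast p.2.pos
      rw [zsmul_eq_mul, mul_comm, Real.exp_mul, Real.exp_log hp, Real.rpow_intCast]
    have h2 : ((∏ p ∈ s, ((p : ℕ) : ℚ) ^ (f p) : ℚ) : ℝ) = 1 := by push_cast; exact this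
    exact_mod_cast h2
  have : Fact (q:ℕ).Prime := ⟨q.2⟩
  have key : ∀ t : Finset Nat.Primes, padicValRat q (∏ p ∈ t, ((p : ℕ) : ℚ) ^ (f p)) =
      ∑ p ∈ t, if p = q then f p else 0 := by
    intro t
    classical
    induction t using Finset.induction_on with
    | empty => simp
    | insert a t ha ih =>
      rw [Finset.prod_insert ha, Finset.sum_insert ha, padicValRat.mul, ih]
      · congr 1
        rw [padicValRat.zpow]
        split_ifs with h
        · subst h; simp [padicValNat_self]
        · have : padicValNat q a = 0 := by
            apply padicValNat.eq_zero_of_not_dvd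
            intro hd
            exact h (Subtype.ext ((Nat.prime_dvd_prime_iff_eq q.2 a.2).1 hd).symm)
          simp [this]
      · exact zpow_ne_zero _ (by exact_mod_cast a.2.ne_zero)
      · exact Finset.prod_ne_zero_iff.2 fun p _ => zpow_ne_zero _ (by exact_mod_cast p.2.ne_zero)
  have h2 := key s
  rw [h1] at h2
  simpa [hq] using h2.symm

lemma lamP_inj (f : Nat.Primes →₀ ℚ) (h : lamP f = 0) : f = 0 := by
  have := log_primes_indep
  rw [linearIndependent_iff] at this
  exact this f h

lemma lamP_clear (f : Nat.Primes →₀ ℚ) : ∃ N : ℕ, N ≠ 0 ∧ ∃ a : ℚ, Real.exp (N * lamP f) = a := by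
  induction f using Finsupp.induction with
  | zero => exact ⟨1, one_ne_zero, 1, by simp⟩
  | single_add p c g _ _ ih =>
    obtain ⟨N, hN, a, ha⟩ := ih
    refine ⟨N * c.den, mul_ne_zero hN c.den_ne_zero, ((p:ℕ):ℚ) ^ (N * c.num) * a ^ c.den, ?_⟩
    have hp : (0:ℝ) < (p:ℕ) := by exact_mod_cast p.2.pos
    rw [map_add, lamP_single, mul_add, Real.exp_add]
    congr 1
    push_cast
    congr 1
    · have : (c.den : ℝ) * c = c.num := by exact_mod_cast Rat.den_mul_eq_num c
      rw [show (N:ℝ) * c.den * (c * Real.log (p:ℕ)) = Real.log (p:ℕ) * (N * (c.den * c)) by ring, this,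
        Real.exp_mul, Real.exp_log hp]
      exact_mod_cast Real.rpow_intCast (p:ℕ) (N * c.num)
    · rw [← ha, ← Real.exp_nat_mul]; congr 1; ring

/-- `∑ f_p log p + d ∑ g_p log p`. -/
noncomputable def phiP (d : ℝ) : ((Nat.Primes →₀ ℚ) × (Nat.Primes →₀ ℚ)) →ₗ[ℚ] ℝ :=
  lamP.coprod ((LinearMap.mulLeft ℚ d).comp lamP)

/-- `f_p + d g_p`. -/
noncomputable def psiP (d : ℝ) (p : Nat.Primes) :
    ((Nat.Primes →₀ ℚ) × (Nat.Primes →₀ ℚ)) →ₗ[ℚ] ℝ :=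
  let e : (Nat.Primes →₀ ℚ) →ₗ[ℚ] ℝ := (Algebra.linearMap ℚ ℝ).comp (Finsupp.lapply p)
  e.coprod ((LinearMap.mulLeft ℚ d).comp e)

lemma phiP_apply (d : ℝ) (f g) : phiP d (f, g) = lamP f + d * lamP g := rfl
lemma psiP_apply (d : ℝ) (p) (f g : Nat.Primes →₀ ℚ) : psiP d p (f, g) = f p + d * g p := rfl

lemma rel_finite (d : ℝ) (hd : Irrational d) : Module.Finite ℚ (LinearMap.ker (phiP d)) := by
  by_contra hcon
  have hr : (4:ℕ) ≤ Module.rank ℚ (LinearMap.ker (phiP d)) := by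
    by_contra h
    apply hcon
    rw [Module.finite_def]
    have h2 := not_le.1 h
    have := Module.rank_lt_aleph0_iff (R := ℚ) (M := LinearMap.ker (phiP d))
    have h3 := this.1 (h2.trans (Cardinal.natCast_lt_aleph0))
    exact h3.1
  obtain ⟨v, hv⟩ := Module.le_rank_iff.1 hr
  have hc : ∀ i, ∃ N : ℕ, N ≠ 0 ∧ (∃ a : ℚ, Real.exp (N * lamP (v i).1.2) = a) ∧
      (∃ b : ℚ, Real.exp (d * (N * lamP (v i).1.2)) = b) := by
    intro i
    obtain ⟨N1, h1, a1, e1⟩ := lamP_clear (v i).1.1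
    obtain ⟨N2, h2, a2, e2⟩ := lamP_clear (v i).1.2
    have hk : lamP (v i).1.1 + d * lamP (v i).1.2 = 0 := (v i).2
    refine ⟨N1 * N2, mul_ne_zero h1 h2, ⟨a2 ^ N1, ?_⟩, ⟨(a1 ^ N2)⁻¹, ?_⟩⟩
    · push_cast; rw [← e2, ← Real.exp_nat_mul]; congr 1; ring
    · push_cast; rw [← e1, ← Real.exp_nat_mul, ← Real.exp_neg]; congr 1
      linear_combination (N1 * N2 : ℝ) * hk
  choose N hN a b using hc
  choose a ha using a
  choose b hb using b
  refine four_exp d hd (fun i => N i * lamP (v i).1.2) ?_ a b ha hb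
  intro m hm
  have h1 : lamP (∑ i, ((m i : ℚ) * N i) • (v i).1.2) = 0 := by
    rw [map_sum, ← hm]
    refine Finset.sum_congr rfl fun i _ => ?_
    rw [map_smul, Rat.smul_def]; push_cast; ring
  have h2 : lamP (∑ i, ((m i : ℚ) * N i) • (v i).1.1) = 0 := by
    have : lamP (∑ i, ((m i : ℚ) * N i) • (v i).1.1) = - d * lamP (∑ i, ((m i : ℚ) * N i) • (v i).1.2) := by
      rw [map_sum, map_sum, Finset.mul_sum]
      refine Finset.sum_congr rfl fun i _ => ?_
      have hk : lamP (v i).1.1 + d * lamP (v i).1.2 = 0 := (v i).2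
      rw [map_smul, map_smul, Rat.smul_def, Rat.smul_def]
      linear_combination (((m i : ℚ) * N i : ℚ) : ℝ) * hk
    rw [this, h1, mul_zero]
  have h3 : ∑ i, ((m i : ℚ) * N i) • v i = 0 := by
    apply Subtype.ext
    apply Prod.ext
    · simpa [Prod.fst_sum] using lamP_inj _ h2
    · simpa [Prod.snd_sum] using lamP_inj _ h1
  have h4 := Fintype.linearIndependent_iff.1 hv _ h3
  funext i
  have := h4 i
  rcases mul_eq_zero.1 this with h | h
  · exact_mod_cast h
  · exact absurd (by exact_mod_cast h) (hN i)

lemma rel_support (d : ℝ) : ∃ Q0 : Finset ℕ, ∀ p : Nat.Primes, (p:ℕ) ∉ Q0 →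
    LinearMap.ker (phiP d) ≤ LinearMap.ker (psiP d p) := by
  by_cases hd : Irrational d
  · obtain ⟨S, hS⟩ := (Module.Finite.iff_fg.1 (rel_finite d hd))
    refine ⟨S.biUnion fun x => x.1.support.image (fun p : Nat.Primes => (p:ℕ)) ∪ x.2.support.image (fun p : Nat.Primes => (p:ℕ)), ?_⟩
    intro p hp
    rw [← hS, Submodule.span_le]
    rintro ⟨f, g⟩ hx
    simp only [Finset.mem_biUnion, Finset.mem_union, Finset.mem_image, not_exists, not_and, not_or] at hp
    obtain ⟨h1, h2⟩ := hp (f, g) hx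
    have hf : f p = 0 := by
      by_contra h
      exact h1 p (Finsupp.mem_support_iff.2 h) rfl
    have hg : g p = 0 := by
      by_contra h
      exact h2 p (Finsupp.mem_support_iff.2 h) rfl
    simp [psiP_apply, hf, hg]
  · obtain ⟨r, rfl⟩ := not_not.1 hd
    refine ⟨∅, fun p _ => ?_⟩
    rintro ⟨f, g⟩ h
    rw [LinearMap.mem_ker, phiP_apply] at h
    have h1 : lamP (f + r • g) = 0 := by
      rw [map_add, map_smul, Rat.smul_def, h]
    have h2 := DFunLike.congr_fun (lamP_inj _ h1) p
    rw [LinearMap.mem_ker, psiP_apply]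
    simp only [Finsupp.add_apply, Finsupp.smul_apply, smul_eq_mul, Finsupp.zero_apply] at h2
    exact_mod_cast h2

/-- coordinate functionals -/
lemma exists_coord (d : ℝ) : ∃ Q0 : Finset ℕ, ∀ p : ℕ, p.Prime → p ∉ Q0 → ∃ π : ℝ →+ ℝ,
    ∀ q : ℕ, q.Prime → π (Real.log q) = (if q = p then 1 else 0) ∧
      π (d * Real.log q) = (if q = p then d else 0) := by
  obtain ⟨Q0, hQ⟩ := rel_support d
  refine ⟨Q0, fun p hp hpQ => ?_⟩
  obtain ⟨p', hp'⟩ : ∃ p' : Nat.Primes, (p' : ℕ) = p := ⟨⟨p, hp⟩, rfl⟩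
  have hle := hQ p' (hp'.symm ▸ hpQ)
  obtain ⟨s, hs⟩ := (phiP d).rangeRestrict.exists_rightInverse_of_surjective
    (LinearMap.range_rangeRestrict _)
  obtain ⟨π, hπ⟩ := LinearMap.exists_extend ((psiP d p').comp s)
  have key : ∀ x, π (phiP d x) = psiP d p' x := by
    intro x
    have h1 : π (phiP d x) = psiP d p' (s ((phiP d).rangeRestrict x)) := by
      have := LinearMap.congr_fun hπ ((phiP d).rangeRestrict x)
      simpa using this
    rw [h1, ← sub_eq_zero, ← map_sub]
    apply hle
    rw [LinearMap.mem_ker, map_sub, sub_eq_zero]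
    have := LinearMap.congr_fun hs ((phiP d).rangeRestrict x)
    simpa using congrArg Subtype.val this
  refine ⟨π.toAddMonoidHom, fun q hq => ?_⟩
  obtain ⟨q', hq'⟩ : ∃ q' : Nat.Primes, (q' : ℕ) = q := ⟨⟨q, hq⟩, rfl⟩
  subst hp' hq'
  refine ⟨?_, ?_⟩
  · have := key (Finsupp.single q' 1, 0)
    rw [phiP_apply, psiP_apply, lamP_single] at this
    simp only [Rat.cast_one, one_mul, map_zero, mul_zero, add_zero, Finsupp.coe_zero, Pi.zero_apply,
      Rat.cast_zero, Finsupp.single_apply, ← Subtype.coe_inj] at this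
    rw [LinearMap.toAddMonoidHom_coe, this]
    simp only [Nat.Primes.coe_nat_inj]
    split_ifs <;> simp
  · have := key (0, Finsupp.single q' 1)
    rw [phiP_apply, psiP_apply, lamP_single] at this
    simp only [Rat.cast_one, one_mul, map_zero, zero_add, Finsupp.coe_zero, Pi.zero_apply,
      Rat.cast_zero, Finsupp.single_apply, ← Subtype.coe_inj] at this
    rw [LinearMap.toAddMonoidHom_coe, this]
    simp only [Nat.Primes.coe_nat_inj]
    split_ifs <;> simp

/-- `e^{i lam t}` -/
noncomputable def ef (lam t : ℝ) : ℂ := cexp ((lam * t : ℝ) * I)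

lemma ef_norm (l t : ℝ) : ‖ef l t‖ = 1 := by rw [ef, Complex.norm_exp_ofReal_mul_I]
lemma ef_add (l m t : ℝ) : ef (l + m) t = ef l t * ef m t := by
  rw [ef, ef, ef, ← Complex.exp_add]; congr 1; push_cast; ring
lemma ef_zero (t : ℝ) : ef 0 t = 1 := by simp [ef]
lemma ef_conj (l t : ℝ) : (starRingEnd ℂ) (ef l t) = ef (-l) t := by
  rw [ef, ef, ← Complex.exp_conj]; congr 1; simp
lemma ef_scale (l d t : ℝ) : ef l (d * t) = ef (d * l) t := by
  rw [ef, ef]; congr 2; push_cast; ring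
@[fun_prop] lemma ef_cont (l : ℝ) : Continuous (ef l) := by unfold ef; fun_prop

lemma cpow_shift (n : ℕ) (hn : n ≠ 0) (z : ℂ) (t : ℝ) :
    (n:ℂ) ^ (-(z + t * I)) = (n:ℂ) ^ (-z) * ef (-Real.log n) t := by
  have hn' : (n:ℂ) ≠ 0 := by exact_mod_cast hn
  rw [neg_add, Complex.cpow_add _ _ hn', Complex.cpow_def_of_ne_zero hn' (-(t * I)), ef]
  congr 2
  rw [← Complex.natCast_log]; push_cast; ring

lemma gauss_ft (l T : ℝ) (hT : 0 < T) :
    ‖∫ t : ℝ, ef l t * cexp (-((1/T^2 : ℝ) : ℂ) * t ^ 2)‖ ≤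
      √Real.pi * T * Real.exp (- (l^2 * T^2 / 4)) := by
  have h := fourierIntegral_gaussian (b := ((1/T^2 : ℝ) : ℂ)) (by rw [ofReal_re]; positivity) (l:ℂ)
  have h1 : ∀ t : ℝ, ef l t = cexp (I * l * t) := fun t => by rw [ef]; congr 1; push_cast; ring
  simp only [h1]
  rw [h, norm_mul]
  apply le_of_eq
  congr 1
  · rw [show ((Real.pi:ℂ) / ((1/T^2:ℝ):ℂ)) = ((Real.pi * T^2 : ℝ) : ℂ) by push_cast; field_simp]
    rw [Complex.norm_cpow_eq_rpow_re_of_pos (by positivity)]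
    rw [show ((1:ℂ)/2).re = 1/2 by simp, ← Real.sqrt_eq_rpow, Real.sqrt_mul' _ (by positivity),
      Real.sqrt_sq hT.le]
  · rw [Complex.norm_exp]
    congr 1
    rw [show -(l:ℂ)^2 / (4 * ((1/T^2:ℝ):ℂ)) = ((-(l^2 * T^2 / 4) : ℝ) : ℂ) by
      push_cast; field_simp]
    rw [ofReal_re]

lemma gauss_int (l T : ℝ) (hT : 0 < T) :
    Integrable (fun t : ℝ => ef l t * cexp (-((1/T^2 : ℝ) : ℂ) * t ^ 2)) := by
  refine (integrable_cexp_neg_mul_sq (b := ((1/T^2 : ℝ) : ℂ)) (by rw [ofReal_re]; positivity)).bdd_mul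
    (c := 1) (ef_cont l).aestronglyMeasurable (Eventually.of_forall fun t => (ef_norm l t).le)

lemma log_sep (X : ℝ) (m n : ℕ) (hm : 1 ≤ m) (hn : 1 ≤ n) (hmX : (m:ℝ) ≤ X) (hnX : (n:ℝ) ≤ X) :
    |(m:ℝ) - n| / X ≤ |Real.log m - Real.log n| := by
  wlog h : n ≤ m generalizing m n
  · have := this n m hn hm hnX hmX (le_of_not_ge h)
    rwa [abs_sub_comm, abs_sub_comm (Real.log m)]
  have hm0 : (0:ℝ) < m := by exact_mod_cast hm
  have hn0 : (0:ℝ) < n := by exact_mod_cast hn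
  have h' : (n:ℝ) ≤ m := by exact_mod_cast h
  have h1 : Real.log ((n:ℝ)/m) ≤ n/m - 1 := Real.log_le_sub_one_of_pos (by positivity)
  rw [Real.log_div hn0.ne' hm0.ne'] at h1
  rw [abs_of_nonneg (by linarith)]
  calc ((m:ℝ) - n)/X ≤ (m - n)/m := by
        apply div_le_div_of_nonneg_left (by linarith) hm0 hmX
    _ = 1 - n/m := by field_simp
    _ ≤ Real.log m - Real.log n := by linarith
    _ ≤ _ := le_abs_self _

lemma mean_value : ∃ C : ℝ, 0 < C ∧ ∀ (S : Finset ℕ) (X T : ℝ) (a : ℕ → ℂ), 0 < T →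
    (∀ n ∈ S, 1 ≤ n ∧ (n:ℝ) ≤ X) →
    ∫ t in (-T)..T, ‖∑ n ∈ S, a n * ef (-Real.log n) t‖^2 ≤
      C * (T + X^2 / T) * ∑ n ∈ S, ‖a n‖^2 := by
  set Z : ℝ := ∑' k : ℤ, 1 / (k:ℝ)^2 with hZ
  have hZs : Summable fun k : ℤ => 1 / (k:ℝ)^2 := Real.summable_one_div_int_pow.2 (by norm_num)
  have hZ0 : 0 ≤ Z := tsum_nonneg fun k => by positivity
  refine ⟨Real.exp 1 * √Real.pi * (1 + 4 * Z), by positivity, ?_⟩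
  intro S X T a hT hS
  set f : ℝ → ℂ := fun t => ∑ n ∈ S, a n * ef (-Real.log n) t with hf
  set G : ℝ → ℂ := fun t => cexp (-((1/T^2 : ℝ) : ℂ) * t ^ 2) with hG
  have hGr : ∀ t : ℝ, G t = ((Real.exp (-(1/T^2) * t^2) : ℝ) : ℂ) := fun t => by
    simp only [hG]; push_cast; rfl
  -- expand
  have hexp : ∀ t, ((‖f t‖^2 * Real.exp (-(1/T^2) * t^2) : ℝ) : ℂ) =
      ∑ m ∈ S, ∑ n ∈ S, (a m * (starRingEnd ℂ) (a n)) * (ef (-Real.log m + Real.log n) t * G t) := by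
    intro t
    rw [ofReal_mul, ← hGr]
    have : ((‖f t‖^2 : ℝ) : ℂ) = f t * (starRingEnd ℂ) (f t) := by
      rw [Complex.mul_conj, Complex.normSq_eq_norm_sq]
    rw [this, hf]
    simp only [map_sum, map_mul, ef_conj, neg_neg]
    rw [Finset.sum_mul_sum, Finset.sum_mul]
    refine Finset.sum_congr rfl fun m _ => ?_
    rw [Finset.sum_mul]
    refine Finset.sum_congr rfl fun n _ => ?_
    rw [ef_add]; ring
  have hint : ∀ m n : ℕ, Integrable fun t : ℝ => (a m * (starRingEnd ℂ) (a n)) *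
      (ef (-Real.log m + Real.log n) t * G t) := fun m n =>
    (gauss_int _ T hT).const_mul _
  have hintC : Integrable fun t : ℝ => ((‖f t‖^2 * Real.exp (-(1/T^2) * t^2) : ℝ) : ℂ) := by
    simp only [hexp]
    exact integrable_finsetSum _ fun m _ => integrable_finsetSum _ fun n _ => hint m n
  have hintR : Integrable fun t : ℝ => ‖f t‖^2 * Real.exp (-(1/T^2) * t^2) := by
    exact hintC.re
  have hcont : Continuous f := by
    simp only [hf]; fun_prop
  -- step 1
  have h1 : ∫ t in (-T)..T, ‖f t‖^2 ≤ Real.exp 1 * ∫ t : ℝ, ‖f t‖^2 * Real.exp (-(1/T^2) * t^2) := by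
    rw [intervalIntegral.integral_of_le (by linarith), ← integral_const_mul]
    calc ∫ t in Set.Ioc (-T) T, ‖f t‖^2
        ≤ ∫ t in Set.Ioc (-T) T, Real.exp 1 * (‖f t‖^2 * Real.exp (-(1/T^2) * t^2)) := by
          refine setIntegral_mono_on ?_ ?_ measurableSet_Ioc ?_
          · exact ((hcont.norm.pow 2).integrableOn_Icc).mono_set Set.Ioc_subset_Icc_self
          · exact (hintR.const_mul _).integrableOn
          · intro t ht
            have h2 : 1 ≤ Real.exp 1 * Real.exp (-(1/T^2) * t^2) := by
              rw [← Real.exp_add]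
              apply Real.one_le_exp
              have : t^2 ≤ T^2 := sq_le_sq' ht.1.le ht.2
              have : 1/T^2 * t^2 ≤ 1 := by
                rw [div_mul_eq_mul_div, one_mul]; exact (div_le_one (by positivity)).2 this
              linarith
            nlinarith [sq_nonneg ‖f t‖]
      _ ≤ _ := by
          refine setIntegral_le_integral (hintR.const_mul _) (Eventually.of_forall fun t => ?_)
          simp only [Pi.zero_apply]; positivity
  -- step 2
  have h2 : ∫ t : ℝ, ‖f t‖^2 * Real.exp (-(1/T^2) * t^2) ≤
      ∑ m ∈ S, ∑ n ∈ S, (‖a m‖ * ‖a n‖) *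
        (√Real.pi * T * Real.exp (- ((-Real.log m + Real.log n)^2 * T^2 / 4))) := by
    have : ((∫ t : ℝ, ‖f t‖^2 * Real.exp (-(1/T^2) * t^2) : ℝ) : ℂ) =
        ∑ m ∈ S, ∑ n ∈ S, (a m * (starRingEnd ℂ) (a n)) * ∫ t : ℝ, (ef (-Real.log m + Real.log n) t * G t) := by
      rw [← integral_complex_ofReal]
      simp only [hexp]
      rw [integral_finsetSum _ fun m _ => integrable_finsetSum _ fun n _ => hint m n]
      refine Finset.sum_congr rfl fun m _ => ?_
      rw [integral_finsetSum _ fun n _ => hint m n]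
      refine Finset.sum_congr rfl fun n _ => ?_
      rw [integral_const_mul]
    calc ∫ t : ℝ, ‖f t‖^2 * Real.exp (-(1/T^2) * t^2)
        ≤ ‖((∫ t : ℝ, ‖f t‖^2 * Real.exp (-(1/T^2) * t^2) : ℝ) : ℂ)‖ := by
          rw [Complex.norm_real]; exact le_abs_self _
      _ ≤ _ := by
          rw [this]
          refine (norm_sum_le _ _).trans (Finset.sum_le_sum fun m _ => (norm_sum_le _ _).trans
            (Finset.sum_le_sum fun n _ => ?_))
          rw [norm_mul, norm_mul, Complex.norm_conj]
          gcongr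
          exact gauss_ft _ T hT
  -- step 3: bound of the kernel
  have hk : ∀ m ∈ S, ∀ n ∈ S, T * Real.exp (- ((-Real.log m + Real.log n)^2 * T^2 / 4)) ≤
      (if m = n then T else 0) + 4 * (X^2 / T) * (1 / (((n:ℤ) - m : ℤ) : ℝ)^2) := by
    intro m hm n hn
    split_ifs with h
    · subst h; simp
    · have hd : (0:ℝ) < |(m:ℝ) - n| := abs_pos.2 (sub_ne_zero.2 (by exact_mod_cast h))
      have hX : 0 < X := lt_of_lt_of_le (by exact_mod_cast (hS m hm).1) (hS m hm).2
      have hs := log_sep X m n (hS m hm).1 (hS n hn).1 (hS m hm).2 (hS n hn).2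
      have hs2 : (|(m:ℝ) - n| / X)^2 ≤ (-Real.log m + Real.log n)^2 := by
        rw [← sq_abs (-Real.log m + Real.log n), show -Real.log m + Real.log n = -(Real.log m - Real.log n) by ring, abs_neg]
        gcongr
      have hpos : 0 < (|(m:ℝ) - n| / X)^2 := by positivity
      have hexp2 : Real.exp (- ((-Real.log m + Real.log n)^2 * T^2 / 4)) ≤ 4 / ((|(m:ℝ) - n| / X)^2 * T^2) := by
        calc Real.exp (- ((-Real.log m + Real.log n)^2 * T^2 / 4))
            ≤ Real.exp (- ((|(m:ℝ) - n| / X)^2 * T^2 / 4)) := by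
              apply Real.exp_le_exp.2; gcongr
          _ = (Real.exp ((|(m:ℝ) - n| / X)^2 * T^2 / 4))⁻¹ := Real.exp_neg _
          _ ≤ ((|(m:ℝ) - n| / X)^2 * T^2 / 4)⁻¹ := by
              apply inv_anti₀ (by positivity)
              linarith [Real.add_one_le_exp ((|(m:ℝ) - n| / X)^2 * T^2 / 4)]
          _ = _ := by rw [inv_div]
      calc T * Real.exp (- ((-Real.log m + Real.log n)^2 * T^2 / 4))
          ≤ T * (4 / ((|(m:ℝ) - n| / X)^2 * T^2)) := by gcongr
        _ = 4 * (X^2/T) * (1 / (|(m:ℝ) - n|)^2) := by field_simp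
        _ = _ := by rw [sq_abs]; push_cast; rw [zero_add, show ((n:ℝ) - m)^2 = (m - n)^2 by ring]
  have hsumZ : ∀ m : ℕ, ∑ n ∈ S, 1 / (((n:ℤ) - m : ℤ) : ℝ)^2 ≤ Z := by
    intro m
    have hinj : Set.InjOn (fun n : ℕ => (n:ℤ) - m) S := by
      intro x _ y _ h; simp only at h; omega
    have := Finset.sum_image (f := fun k : ℤ => 1 / (k:ℝ)^2) hinj
    rw [← this]
    exact hZs.sum_le_tsum _ fun k _ => by positivity
  have hsym : ∀ m n : ℕ, 1 / (((n:ℤ) - m : ℤ) : ℝ)^2 = 1 / (((m:ℤ) - n : ℤ) : ℝ)^2 := by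
    intro m n; congr 1; push_cast; ring
  set w : ℕ → ℕ → ℝ := fun m n => (if m = n then T else 0) + 4 * (X^2 / T) * (1 / (((n:ℤ) - m : ℤ) : ℝ)^2) with hw
  have hw0 : ∀ m n, 0 ≤ w m n := fun m n => by
    simp only [hw]; split_ifs <;> positivity
  have hwsum : ∀ m ∈ S, ∑ n ∈ S, w m n ≤ (1 + 4 * Z) * (T + X^2/T) := by
    intro m hm
    simp only [hw]
    rw [Finset.sum_add_distrib, ← Finset.mul_sum, Finset.sum_ite_eq, if_pos hm]
    have := hsumZ m
    have hx : 0 ≤ X^2/T := by positivity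
    nlinarith [mul_le_mul_of_nonneg_left this hx, mul_nonneg hZ0 hT.le]
  have hwsym : ∀ m n, w m n = w n m := by
    intro m n
    simp only [hw]
    rw [hsym m n]
    by_cases h : m = n
    · subst h; rfl
    · rw [if_neg h, if_neg (Ne.symm h)]
  have h3 : ∑ m ∈ S, ∑ n ∈ S, (‖a m‖ * ‖a n‖) * w m n ≤ (1 + 4 * Z) * (T + X^2/T) * ∑ n ∈ S, ‖a n‖^2 := by
    calc ∑ m ∈ S, ∑ n ∈ S, (‖a m‖ * ‖a n‖) * w m n
        ≤ ∑ m ∈ S, ∑ n ∈ S, (‖a m‖^2 * w m n / 2 + ‖a n‖^2 * w m n / 2) := by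
          refine Finset.sum_le_sum fun m _ => Finset.sum_le_sum fun n _ => ?_
          nlinarith [mul_nonneg (sq_nonneg (‖a m‖ - ‖a n‖)) (hw0 m n)]
      _ = ∑ m ∈ S, ∑ n ∈ S, ‖a m‖^2 * w m n := by
          simp only [Finset.sum_add_distrib]
          rw [Finset.sum_comm (f := fun m n => ‖a n‖^2 * w m n / 2)]
          rw [← Finset.sum_add_distrib]
          refine Finset.sum_congr rfl fun m _ => ?_
          rw [← Finset.sum_add_distrib]
          refine Finset.sum_congr rfl fun n _ => ?_
          rw [hwsym n m]; ring
      _ ≤ ∑ m ∈ S, ‖a m‖^2 * ((1 + 4 * Z) * (T + X^2/T)) := by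
          refine Finset.sum_le_sum fun m hm => ?_
          rw [← Finset.mul_sum]
          exact mul_le_mul_of_nonneg_left (hwsum m hm) (sq_nonneg _)
      _ = _ := by rw [← Finset.sum_mul, mul_comm]
  calc ∫ t in (-T)..T, ‖f t‖^2 ≤ _ := h1
    _ ≤ Real.exp 1 * (√Real.pi * ∑ m ∈ S, ∑ n ∈ S, (‖a m‖ * ‖a n‖) * w m n) := by
        refine mul_le_mul_of_nonneg_left (h2.trans ?_) (Real.exp_pos _).le
        rw [Finset.mul_sum]
        refine Finset.sum_le_sum fun m hm => ?_
        rw [Finset.mul_sum]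
        refine Finset.sum_le_sum fun n hn => ?_
        have := hk m hm n hn
        calc ‖a m‖ * ‖a n‖ * (√Real.pi * T * Real.exp (- ((-Real.log m + Real.log n)^2 * T^2 / 4)))
            = √Real.pi * (‖a m‖ * ‖a n‖ * (T * Real.exp (- ((-Real.log m + Real.log n)^2 * T^2 / 4)))) := by ring
          _ ≤ _ := by gcongr
    _ ≤ Real.exp 1 * (√Real.pi * ((1 + 4 * Z) * (T + X^2/T) * ∑ n ∈ S, ‖a n‖^2)) := by gcongr
    _ = _ := by ring

lemma id_thm {V : Set ℂ} (hV : IsOpen V) (hc : Convex ℝ V) {f g : ℂ → ℂ} (hf : DifferentiableOn ℂ f V)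
    (hg : DifferentiableOn ℂ g V) {z0 : ℂ} (h0 : z0 ∈ V) (h : ∀ᶠ z in nhds z0, f z = g z) :
    ∀ z ∈ V, f z = g z :=
  (hf.analyticOnNhd hV).eqOn_of_preconnected_of_eventuallyEq (hg.analyticOnNhd hV) hc.isPreconnected h0 h

/-- iterated differences of `x^{-s}` -/
noncomputable def Dk : ℕ → ℂ → ℝ → ℂ
  | 0, s, x => (x:ℂ) ^ (-s)
  | k+1, s, x => Dk k s x - Dk k s (x+1)

lemma Dk_diff (k : ℕ) : ∀ x : ℝ, 0 < x → Differentiable ℂ (fun s => Dk k s x) := by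
  induction k with
  | zero =>
    intro x hx
    simp only [Dk]
    have : (x:ℂ) ≠ 0 := by exact_mod_cast hx.ne'
    intro s
    exact (differentiableAt_id.neg).const_cpow (Or.inl this)
  | succ k ih =>
    intro x hx
    simp only [Dk]
    exact (ih x hx).sub (ih (x+1) (by linarith))

lemma Dk_deriv (k : ℕ) (s : ℂ) : ∀ x : ℝ, 0 < x → HasDerivAt (Dk k s) (-s * Dk k (s+1) x) x := by
  induction k with
  | zero =>
    intro x hx
    simp only [Dk]
    have h1 : HasDerivAt (fun y : ℂ => y ^ (-s)) (-s * (x:ℂ) ^ (-s - 1) * 1) (x:ℂ) :=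
      (hasDerivAt_id (x:ℂ)).cpow_const (Or.inl (by simpa using hx))
    have := h1.comp_ofReal
    rw [neg_add', ← mul_one (-s * _)]
    exact this
  | succ k ih =>
    intro x hx
    simp only [Dk]
    rw [mul_sub]
    exact (ih x hx).sub ((ih (x+1) (by linarith)).comp_add_const x 1)

lemma Dk_bound (k : ℕ) : ∀ (s : ℂ) (x : ℝ), 0 ≤ s.re → 0 < x →
    ‖Dk k s x‖ ≤ (∏ i ∈ Finset.range k, ‖s + i‖) * x ^ (-(s.re + k)) := by
  induction k with
  | zero =>
    intro s x hs hx
    simp only [Dk, Finset.range_zero, Finset.prod_empty, one_mul]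
    rw [Complex.norm_cpow_eq_rpow_re_of_pos hx]; simp
  | succ k ih =>
    intro s x hs hx
    simp only [Dk]
    have hb : ∀ y ∈ Set.Icc x (x+1), ‖-s * Dk k (s+1) y‖ ≤
        (∏ i ∈ Finset.range (k+1), ‖s + i‖) * x ^ (-(s.re + (k+1:ℕ))) := by
      intro y hy
      have hy0 : 0 < y := lt_of_lt_of_le hx hy.1
      rw [norm_mul, norm_neg, Finset.prod_range_succ', mul_comm (∏ _ ∈ _, _), mul_assoc]
      simp only [Nat.cast_zero, add_zero]
      gcongr
      refine (ih (s+1) y (by simp; linarith) hy0).trans ?_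
      have e1 : ∏ i ∈ Finset.range k, ‖s + 1 + i‖ = ∏ i ∈ Finset.range k, ‖s + (i + 1 : ℕ)‖ := by
        refine Finset.prod_congr rfl fun i _ => ?_
        congr 1; push_cast; ring
      rw [e1]
      gcongr
      have e2 : (s+1).re + k = s.re + (k+1:ℕ) := by simp; ring
      rw [e2]
      exact Real.rpow_le_rpow_of_nonpos hx hy.1 (by push_cast; linarith [Nat.cast_nonneg (α := ℝ) k])
    have := (convex_Icc x (x+1)).norm_image_sub_le_of_norm_hasDerivWithin_le
      (f := Dk k s) (f' := fun y => -s * Dk k (s+1) y)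
      (fun y hy => (Dk_deriv k s y (lt_of_lt_of_le hx hy.1)).hasDerivWithinAt) hb
      (Set.right_mem_Icc.2 (by linarith)) (Set.left_mem_Icc.2 (by linarith))
    simpa using this

lemma Dk_bound' (k : ℕ) (s : ℂ) (x R : ℝ) (hs : 0 ≤ s.re) (hx : 0 < x) (hR : ‖s‖ + k ≤ R) :
    ‖Dk k s x‖ ≤ R ^ k * x ^ (-(s.re + k)) := by
  refine (Dk_bound k s x hs hx).trans ?_
  gcongr
  calc ∏ i ∈ Finset.range k, ‖s + i‖ ≤ ∏ i ∈ Finset.range k, R := by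
        refine Finset.prod_le_prod (fun _ _ => norm_nonneg _) fun i hi => ?_
        refine (norm_add_le _ _).trans ?_
        have : (i:ℝ) ≤ k := by exact_mod_cast (Finset.mem_range.1 hi).le
        rw [Complex.norm_natCast]; linarith
    _ = R ^ k := by simp

/-- alternating tails -/
noncomputable def Tk (k : ℕ) (s : ℂ) (x : ℝ) : ℂ := ∑' j : ℕ, (-1:ℂ)^j * Dk k s (x + j)

lemma Tk_term (k : ℕ) (s : ℂ) (x R a : ℝ) (hs : 0 ≤ s.re) (hx : 1 ≤ x) (hR : ‖s‖ + k ≤ R)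
    (ha : a ≤ s.re + k) (j : ℕ) :
    ‖(-1:ℂ)^j * Dk k s (x + j)‖ ≤ R ^ k * (((j+1 : ℕ) : ℝ) ^ a)⁻¹ := by
  rw [norm_mul, norm_pow, norm_neg, norm_one, one_pow, one_mul]
  have hj : (0:ℝ) ≤ j := Nat.cast_nonneg j
  have hR0 : 0 ≤ R := le_trans (by positivity) hR
  refine (Dk_bound' k s (x+j) R hs (by linarith) hR).trans ?_
  gcongr
  rw [← Real.rpow_neg (by positivity)]
  calc (x + j) ^ (-(s.re + k)) ≤ (((j+1 : ℕ) : ℝ)) ^ (-(s.re + k)) :=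
        Real.rpow_le_rpow_of_nonpos (by positivity) (by push_cast; linarith) (by linarith [Nat.cast_nonneg (α := ℝ) k])
    _ ≤ _ := Real.rpow_le_rpow_of_exponent_le (by push_cast; linarith) (by linarith)

lemma sum_aux (a : ℝ) (ha : 1 < a) : Summable fun j : ℕ => (((j+1 : ℕ) : ℝ) ^ a)⁻¹ :=
  (summable_nat_add_iff 1).2 (Real.summable_nat_rpow_inv.2 ha)

lemma Tk_summable (k : ℕ) (s : ℂ) (x : ℝ) (hs : 0 ≤ s.re) (hk : 1 < s.re + k) (hx : 1 ≤ x) :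
    Summable fun j : ℕ => (-1:ℂ)^j * Dk k s (x + j) := by
  refine Summable.of_norm_bounded ((sum_aux _ hk).mul_left ((‖s‖+k)^k)) fun j => ?_
  exact Tk_term k s x _ _ hs hx le_rfl le_rfl j

lemma Tk_head (k : ℕ) (s : ℂ) (x : ℝ) (hs : 0 ≤ s.re) (hk : 1 < s.re + k) (hx : 1 ≤ x) :
    Tk k s x = Dk k s x - Tk k s (x+1) := by
  rw [Tk, (Tk_summable k s x hs hk hx).tsum_eq_zero_add, sub_eq_add_neg, Tk, ← tsum_neg]
  congr 1
  · simp
  · congr 1; funext j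
    rw [pow_succ]; push_cast
    rw [show x + (j + 1) = x + 1 + (j:ℝ) by ring]; ring

lemma Tk_succ (k : ℕ) (s : ℂ) (x : ℝ) (hs : 0 ≤ s.re) (hk : 1 < s.re + k) (hx : 1 ≤ x) :
    Tk k s x = (1/2) * Dk k s x + (1/2) * Tk (k+1) s x := by
  have h1 : Tk (k+1) s x = Tk k s x - Tk k s (x+1) := by
    rw [Tk, Tk, Tk, ← (Tk_summable k s x hs hk hx).tsum_sub (Tk_summable k s (x+1) hs hk (by linarith))]
    congr 1; funext j
    rw [← mul_sub, Dk, show x + j + 1 = x + 1 + (j:ℝ) by ring]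
  have h2 := Tk_head k s x hs hk hx
  rw [h1]; linear_combination (1/2) * h2

lemma T0_expand (s : ℂ) (x : ℝ) (hs : 1 < s.re) (hx : 1 ≤ x) (k : ℕ) :
    Tk 0 s x = ∑ j ∈ Finset.range k, (1/2)^(j+1) * Dk j s x + (1/2)^k * Tk k s x := by
  induction k with
  | zero => simp
  | succ k ih =>
    rw [ih, Finset.sum_range_succ, Tk_succ k s x (by linarith) (by linarith [Nat.cast_nonneg (α := ℝ) k]) hx]
    ring

lemma T0_split (s : ℂ) (hs : 1 < s.re) (N : ℕ) :
    Tk 0 s 1 = ∑ n ∈ Finset.range N, (-1:ℂ)^n * ((n+1 : ℕ) : ℂ)^(-s) + (-1)^N * Tk 0 s (N+1) := by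
  induction N with
  | zero => simp
  | succ N ih =>
    rw [ih, Finset.sum_range_succ, Tk_head 0 s (N+1) (by linarith) (by simpa using hs)
      (by linarith [Nat.cast_nonneg (α := ℝ) N])]
    simp only [Dk]
    push_cast
    ring

lemma T0_eta (s : ℂ) (hs : 1 < s.re) : Tk 0 s 1 = (1 - 2^(1-s)) * riemannZeta s := by
  have hz := zeta_eq_tsum_one_div_nat_add_one_cpow hs
  have hsum : Summable fun n : ℕ => ((n+1 : ℕ) : ℂ)^(-s) := by
    have := (summable_nat_add_iff 1).2 (Complex.summable_one_div_nat_cpow.2 hs)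
    refine this.congr fun n => ?_
    rw [Complex.cpow_neg, one_div]
  have hz' : riemannZeta s = ∑' n : ℕ, ((n+1 : ℕ) : ℂ)^(-s) := by
    rw [hz]; congr 1; funext n; rw [Complex.cpow_neg, one_div]; push_cast; rfl
  have hodd : ∀ m : ℕ, ((2*m+1+1 : ℕ) : ℂ)^(-s) = 2^(-s) * ((m+1:ℕ):ℂ)^(-s) := by
    intro m
    rw [show 2*m+1+1 = 2*(m+1) by ring, Nat.cast_mul, Complex.natCast_mul_natCast_cpow]
    norm_num
  have he : Summable fun m : ℕ => ((2*m+1 : ℕ) : ℂ)^(-s) :=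
    hsum.comp_injective (i := fun m : ℕ => 2 * m) (fun a b h => by simpa using h)
  have ho : Summable fun m : ℕ => ((2*m+1+1 : ℕ) : ℂ)^(-s) :=
    hsum.comp_injective (i := fun m : ℕ => 2 * m + 1) (fun a b h => by simpa using h)
  have h1 := tsum_even_add_odd (f := fun n : ℕ => ((n+1 : ℕ) : ℂ)^(-s)) he ho
  have h2 : Tk 0 s 1 = ∑' m : ℕ, ((2*m+1 : ℕ) : ℂ)^(-s) - ∑' m : ℕ, ((2*m+1+1 : ℕ) : ℂ)^(-s) := by
    have h3 := tsum_even_add_odd (f := fun n : ℕ => (-1:ℂ)^n * ((n+1 : ℕ) : ℂ)^(-s))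
      (by simpa [pow_mul] using he) (by simpa [pow_succ, pow_mul] using ho.neg)
    have h4 : Tk 0 s 1 = ∑' n : ℕ, (-1:ℂ)^n * ((n+1 : ℕ) : ℂ)^(-s) := by
      rw [Tk]; congr 1; funext n; simp only [Dk]; push_cast; rw [add_comm]
    rw [h4, ← h3, sub_eq_add_neg, ← tsum_neg]
    congr 1
    · congr 1; funext m; simp [pow_mul]
    · congr 1; funext m; simp [pow_mul, pow_succ]
  rw [h2]
  have h5 : ∑' m : ℕ, ((2*m+1+1 : ℕ) : ℂ)^(-s) = 2^(-s) * riemannZeta s := by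
    rw [hz', ← tsum_mul_left]; congr 1; funext m; exact hodd m
  rw [← hz'] at h1
  rw [h5] at h1 ⊢
  have h6 : (2:ℂ)^(1-s) = 2 * 2^(-s) := by
    rw [sub_eq_add_neg, Complex.cpow_add _ _ two_ne_zero, Complex.cpow_one]
  rw [h6]
  linear_combination h1

lemma Tk_diffOn (k : ℕ) (hk : 1 ≤ k) (x : ℝ) (hx : 1 ≤ x) :
    DifferentiableOn ℂ (fun s => Tk k s x) {s : ℂ | 0 < s.re} := by
  intro s0 hs0
  have hs0' : 0 < s0.re := hs0
  set U : Set ℂ := {s | s0.re / 2 < s.re} ∩ Metric.ball 0 (‖s0‖ + 1) with hU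
  have hUo : IsOpen U := (isOpen_lt continuous_const Complex.continuous_re).inter Metric.isOpen_ball
  have hmem : s0 ∈ U := ⟨by simp only [Set.mem_setOf_eq]; linarith, by simp⟩
  have hk' : (1:ℝ) ≤ k := by exact_mod_cast hk
  have := differentiableOn_tsum_of_summable_norm (F := fun (j : ℕ) (s : ℂ) => (-1:ℂ)^j * Dk k s (x + j))
    (U := U) (u := fun j : ℕ => (‖s0‖ + 1 + k)^k * (((j+1 : ℕ) : ℝ) ^ (s0.re / 2 + k))⁻¹)
    ((sum_aux _ (by linarith)).mul_left _)
    (fun j => ((Dk_diff k (x+j) (by positivity)).const_mul _).differentiableOn) hUo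
    (fun j w hw => by
      have h1 : s0.re/2 < w.re := hw.1
      have h2 : ‖w‖ < ‖s0‖ + 1 := by simpa using hw.2
      exact Tk_term k w x _ _ (by linarith) hx (by linarith) (by linarith) j)
  exact (this.differentiableAt (hUo.mem_nhds hmem)).differentiableWithinAt

lemma eta_formula (k N : ℕ) (hk : 1 ≤ k) (s : ℂ) (h0 : 0 < s.re) (h1 : s.re < 1) :
    (1 - 2^(1-s)) * riemannZeta s = ∑ n ∈ Finset.range N, (-1:ℂ)^n * ((n+1 : ℕ) : ℂ)^(-s) +
      (-1)^N * (∑ j ∈ Finset.range k, (1/2)^(j+1) * Dk j s (N+1) + (1/2)^k * Tk k s (N+1)) := by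
  set g : ℂ → ℂ := fun s => ∑ n ∈ Finset.range N, (-1:ℂ)^n * ((n+1 : ℕ) : ℂ)^(-s) +
      (-1)^N * (∑ j ∈ Finset.range k, (1/2)^(j+1) * Dk j s (N+1) + (1/2)^k * Tk k s (N+1)) with hg
  set f : ℂ → ℂ := fun s => (1 - 2^(1-s)) * riemannZeta s with hf
  have hN : (1:ℝ) ≤ N + 1 := by linarith [Nat.cast_nonneg (α := ℝ) N]
  have hgd : DifferentiableOn ℂ g {s : ℂ | 0 < s.re} := by
    refine DifferentiableOn.add ?_ (DifferentiableOn.const_mul (DifferentiableOn.add ?_ ?_) _)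
    · refine DifferentiableOn.fun_sum fun n _ => DifferentiableOn.const_mul ?_ _
      intro s _
      exact ((differentiableAt_id.neg).const_cpow (Or.inl (by exact_mod_cast n.succ_ne_zero))).differentiableWithinAt
    · exact DifferentiableOn.fun_sum fun j _ => ((Dk_diff j _ (by linarith)).const_mul _).differentiableOn
    · exact (Tk_diffOn k hk _ hN).const_mul _
  have hfd : ∀ s : ℂ, s ≠ 1 → DifferentiableAt ℂ f s := by
    intro s hs
    refine DifferentiableAt.mul ?_ (differentiableAt_riemannZeta hs)
    refine (differentiableAt_const _).sub ?_
    exact ((differentiableAt_const _).sub differentiableAt_id).const_cpow (Or.inl two_ne_zero)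
  have heq : ∀ s : ℂ, 1 < s.re → f s = g s := by
    intro s hs
    simp only [hf, hg]
    rw [← T0_eta s hs, T0_split s hs N, T0_expand s (N+1) hs hN k]
  have e1 : ∀ s ∈ {s : ℂ | 0 < s.re} ∩ {s : ℂ | 0 < s.im}, f s = g s := by
    refine id_thm (z0 := 2 + I) ?_ ?_ ?_ ?_ ?_ ?_
    · exact (isOpen_lt continuous_const Complex.continuous_re).inter (isOpen_lt continuous_const Complex.continuous_im)
    · exact (convex_halfSpace_re_gt 0).inter (convex_halfSpace_im_gt 0)
    · intro s hs
      refine (hfd s ?_).differentiableWithinAt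
      rintro rfl
      have : 0 < (1:ℂ).im := hs.2
      simp at this
    · exact hgd.mono Set.inter_subset_left
    · simp
    · have : {s : ℂ | 1 < s.re} ∈ nhds (2 + I) :=
        (isOpen_lt continuous_const Complex.continuous_re).mem_nhds (by simp)
      filter_upwards [this] with s hs using heq s hs
  have e2 : ∀ s ∈ {s : ℂ | 0 < s.re} ∩ {s : ℂ | s.re < 1}, f s = g s := by
    refine id_thm (z0 := 1/2 + I) ?_ ?_ ?_ ?_ ?_ ?_
    · exact (isOpen_lt continuous_const Complex.continuous_re).inter (isOpen_lt Complex.continuous_re continuous_const)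
    · exact (convex_halfSpace_re_gt 0).inter (convex_halfSpace_re_lt 1)
    · intro s hs
      refine (hfd s ?_).differentiableWithinAt
      rintro rfl
      have : (1:ℂ).re < 1 := hs.2
      simp at this
    · exact hgd.mono Set.inter_subset_left
    · simp; norm_num
    · have : {s : ℂ | 0 < s.re} ∩ {s : ℂ | 0 < s.im} ∈ nhds (1/2 + I : ℂ) :=
        ((isOpen_lt continuous_const Complex.continuous_re).inter (isOpen_lt continuous_const Complex.continuous_im)).mem_nhds (by simp)
      filter_upwards [this] with s hs using e1 s hs
  exact e2 s ⟨h0, h1⟩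

/-- remainder bound -/
lemma eta_approx (k N : ℕ) (hk : 2 ≤ k) (hN : 1 ≤ N) (s : ℂ) (h0 : 0 < s.re) (h1 : s.re < 1) (R : ℝ)
    (hR : ‖s‖ + k ≤ R) (hRN : R ≤ N) :
    ‖(1 - 2^(1-s)) * riemannZeta s - ∑ n ∈ Finset.range N, (-1:ℂ)^n * ((n+1 : ℕ) : ℂ)^(-s)‖ ≤
      k * (N:ℝ)^(-s.re) + R^k * (N:ℝ)^(2 - (k:ℝ)) * ∑' j : ℕ, (((j+1 : ℕ) : ℝ)^(2:ℝ))⁻¹ := by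
  have hN0 : (0:ℝ) < N := by exact_mod_cast hN
  have hN1 : (1:ℝ) ≤ N + 1 := by linarith
  have hR0 : 0 ≤ R := le_trans (by positivity) hR
  rw [eta_formula k N (by omega) s h0 h1, add_sub_cancel_left, norm_mul, norm_pow, norm_neg, norm_one, one_pow, one_mul]
  refine (norm_add_le _ _).trans (add_le_add ?_ ?_)
  · refine (norm_sum_le _ _).trans ?_
    calc ∑ j ∈ Finset.range k, ‖(1/2:ℂ)^(j+1) * Dk j s (N+1)‖ ≤ ∑ j ∈ Finset.range k, (N:ℝ)^(-s.re) := by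
          refine Finset.sum_le_sum fun j hj => ?_
          have hjk : (j:ℝ) ≤ k := by exact_mod_cast (Finset.mem_range.1 hj).le
          rw [norm_mul]
          have hh : ‖(1/2:ℂ)^(j+1)‖ ≤ 1 := by
            rw [norm_pow]; apply pow_le_one₀ (norm_nonneg _); norm_num
          calc ‖(1/2:ℂ)^(j+1)‖ * ‖Dk j s (N+1)‖ ≤ 1 * (R^j * ((N:ℝ)+1)^(-(s.re + j))) := by
                gcongr
                exact Dk_bound' j s _ R h0.le (by linarith) (by linarith)
            _ ≤ (N:ℝ)^j * (N:ℝ)^(-(s.re+j)) := by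
                rw [one_mul]
                exact mul_le_mul (pow_le_pow_left₀ hR0 hRN _) (Real.rpow_le_rpow_of_nonpos hN0 (by linarith)
                  (by linarith [Nat.cast_nonneg (α := ℝ) j])) (by positivity) (by positivity)
            _ = (N:ℝ)^(-s.re) := by
                rw [← Real.rpow_natCast, ← Real.rpow_add hN0]; congr 1; ring
      _ = _ := by simp
  · rw [norm_mul]
    have hh : ‖(1/2:ℂ)^k‖ ≤ 1 := by
      rw [norm_pow]; apply pow_le_one₀ (norm_nonneg _); norm_num
    have hk' : (2:ℝ) ≤ k := by exact_mod_cast hk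
    have hterm : ∀ j : ℕ, ‖(-1:ℂ)^j * Dk k s ((N:ℝ) + 1 + j)‖ ≤
        R^k * (N:ℝ)^(2-(k:ℝ)) * (((j+1 : ℕ) : ℝ)^(2:ℝ))⁻¹ := by
      intro j
      have hj : (0:ℝ) ≤ j := Nat.cast_nonneg j
      rw [norm_mul, norm_pow, norm_neg, norm_one, one_pow, one_mul]
      refine (Dk_bound' k s _ R h0.le (by linarith) hR).trans ?_
      rw [mul_assoc]
      gcongr
      rw [← Real.rpow_neg (by positivity)]
      calc ((N:ℝ)+1+j)^(-(s.re+k)) ≤ ((N:ℝ)+1+j)^(-(k:ℝ)) :=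
            Real.rpow_le_rpow_of_exponent_le (by linarith) (by linarith)
        _ = ((N:ℝ)+1+j)^(2-(k:ℝ)) * ((N:ℝ)+1+j)^(-(2:ℝ)) := by
            rw [← Real.rpow_add (by linarith)]; congr 1; ring
        _ ≤ (N:ℝ)^(2-(k:ℝ)) * ((j+1:ℕ):ℝ)^(-(2:ℝ)) := by
            exact mul_le_mul (Real.rpow_le_rpow_of_nonpos hN0 (by linarith) (by linarith))
              (Real.rpow_le_rpow_of_nonpos (by positivity) (by push_cast; linarith) (by norm_num))
              (by positivity) (by positivity)
    have hT : ‖Tk k s (N+1)‖ ≤ R^k * (N:ℝ)^(2-(k:ℝ)) * ∑' j : ℕ, (((j+1 : ℕ) : ℝ)^(2:ℝ))⁻¹ := by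
      rw [Tk, ← tsum_mul_left]
      exact tsum_of_norm_bounded (((sum_aux 2 (by norm_num)).mul_left _).hasSum) hterm
    calc ‖(1/2:ℂ)^k‖ * ‖Tk k s (N+1)‖ ≤ 1 * ‖Tk k s (N+1)‖ := by gcongr
      _ ≤ _ := by rw [one_mul]; exact hT

/-- mean-square smallness -/
def MS (σ1 σ2 T0 : ℝ) (F : ℕ → ℂ → ℂ) : Prop :=
  (∀ Y, ContinuousOn (F Y) {s : ℂ | 0 < s.re ∧ s.re < 1}) ∧
  ∀ η : ℝ, 0 < η → ∃ Y0 : ℕ, ∀ Y : ℕ, Y0 ≤ Y → ∃ T1 : ℝ, 1 ≤ T1 ∧ ∀ T : ℝ, T1 ≤ T → ∀ z : ℂ,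
    σ1 ≤ z.re → z.re ≤ σ2 → |z.im| ≤ T0 → ∫ t in (-T)..T, ‖F Y (z + t * I)‖^2 ≤ η * T

lemma line_cont {F : ℂ → ℂ} (hF : ContinuousOn F {s : ℂ | 0 < s.re ∧ s.re < 1}) (z : ℂ) (h0 : 0 < z.re)
    (h1 : z.re < 1) : Continuous fun t : ℝ => F (z + t * I) := by
  refine hF.comp_continuous (by fun_prop) fun t => ?_
  simp [h0, h1]

lemma MS_add {σ1 σ2 T0 : ℝ} (h1 : 0 < σ1) (h2 : σ2 < 1) {F G : ℕ → ℂ → ℂ} (hF : MS σ1 σ2 T0 F)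
    (hG : MS σ1 σ2 T0 G) : MS σ1 σ2 T0 (fun Y s => F Y s + G Y s) := by
  refine ⟨fun Y => (hF.1 Y).add (hG.1 Y), fun η hη => ?_⟩
  obtain ⟨Y1, hY1⟩ := hF.2 (η/4) (by linarith)
  obtain ⟨Y2, hY2⟩ := hG.2 (η/4) (by linarith)
  refine ⟨max Y1 Y2, fun Y hY => ?_⟩
  obtain ⟨T1, hT1, e1⟩ := hY1 Y (le_of_max_le_left hY)
  obtain ⟨T2, hT2, e2⟩ := hY2 Y (le_of_max_le_right hY)
  refine ⟨max T1 T2, le_max_of_le_left hT1, fun T hT z hz1 hz2 hz3 => ?_⟩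
  have a1 := e1 T (le_of_max_le_left hT) z hz1 hz2 hz3
  have a2 := e2 T (le_of_max_le_right hT) z hz1 hz2 hz3
  have hT0 : 1 ≤ T := hT1.trans (le_of_max_le_left hT)
  have c1 := line_cont (hF.1 Y) z (by linarith) (by linarith)
  have c2 := line_cont (hG.1 Y) z (by linarith) (by linarith)
  calc ∫ t in (-T)..T, ‖F Y (z + t * I) + G Y (z + t * I)‖^2
      ≤ ∫ t in (-T)..T, (2 * ‖F Y (z + t * I)‖^2 + 2 * ‖G Y (z + t * I)‖^2) := by
        refine intervalIntegral.integral_mono_on (by linarith) ?_ ?_ fun t _ => ?_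
        · exact ((c1.add c2).norm.pow 2).intervalIntegrable _ _
        · exact (((c1.norm.pow 2).const_mul 2).add ((c2.norm.pow 2).const_mul 2)).intervalIntegrable _ _
        · have := norm_add_le (F Y (z + t * I)) (G Y (z + t * I))
          have h0 := norm_nonneg (F Y (z + t * I) + G Y (z + t * I))
          nlinarith [sq_nonneg (‖F Y (z + t * I)‖ - ‖G Y (z + t * I)‖)]
    _ = 2 * (∫ t in (-T)..T, ‖F Y (z + t * I)‖^2) + 2 * ∫ t in (-T)..T, ‖G Y (z + t * I)‖^2 := by
        rw [intervalIntegral.integral_add, intervalIntegral.integral_const_mul, intervalIntegral.integral_const_mul]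
        · exact ((c1.norm.pow 2).const_mul 2).intervalIntegrable _ _
        · exact ((c2.norm.pow 2).const_mul 2).intervalIntegrable _ _
    _ ≤ η * T := by linarith

lemma MS_mul {σ1 σ2 T0 B : ℝ} (h1 : 0 < σ1) (h2 : σ2 < 1) {F : ℕ → ℂ → ℂ} (hF : MS σ1 σ2 T0 F)
    {g : ℂ → ℂ} (hg : ContinuousOn g {s : ℂ | 0 < s.re ∧ s.re < 1})
    (hB : ∀ s : ℂ, σ1 ≤ s.re → s.re ≤ σ2 → ‖g s‖ ≤ B) : MS σ1 σ2 T0 (fun Y s => g s * F Y s) := by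
  refine ⟨fun Y => hg.mul (hF.1 Y), fun η hη => ?_⟩
  obtain ⟨Y1, hY1⟩ := hF.2 (η/(B^2+1)) (by positivity)
  refine ⟨Y1, fun Y hY => ?_⟩
  obtain ⟨T1, hT1, e1⟩ := hY1 Y hY
  refine ⟨T1, hT1, fun T hT z hz1 hz2 hz3 => ?_⟩
  have a1 := e1 T hT z hz1 hz2 hz3
  have hT0 : 1 ≤ T := hT1.trans hT
  have c1 := line_cont (hF.1 Y) z (by linarith) (by linarith)
  have c2 := line_cont hg z (by linarith) (by linarith)
  calc ∫ t in (-T)..T, ‖g (z + t * I) * F Y (z + t * I)‖^2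
      ≤ ∫ t in (-T)..T, (B^2+1) * ‖F Y (z + t * I)‖^2 := by
        refine intervalIntegral.integral_mono_on (by linarith) ?_ ?_ fun t _ => ?_
        · exact ((c2.mul c1).norm.pow 2).intervalIntegrable _ _
        · exact ((c1.norm.pow 2).const_mul _).intervalIntegrable _ _
        · rw [norm_mul, mul_pow]
          have := hB (z + t * I) (by simpa using hz1) (by simpa using hz2)
          have : ‖g (z + t * I)‖^2 ≤ B^2 + 1 := by
            have := pow_le_pow_left₀ (norm_nonneg _) this 2
            linarith
          gcongr
    _ ≤ (B^2+1) * (η/(B^2+1) * T) := by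
        rw [intervalIntegral.integral_const_mul]; gcongr
    _ = η * T := by field_simp

lemma block (θ : ℝ) (hθ : 0 < θ) : ∃ C : ℝ, 0 < C ∧ ∀ (S : Finset ℕ) (A X T : ℝ) (ε : ℕ → ℂ) (z : ℂ),
    0 < T → 1 ≤ A → (∀ n, ‖ε n‖ ≤ 1) → (∀ n ∈ S, A ≤ n ∧ (n:ℝ) ≤ X) → 1/2 + 2 * θ ≤ z.re →
    ∫ t in (-T)..T, ‖∑ n ∈ S, ε n * (n:ℂ)^(-(z + t * I))‖^2 ≤ C * (T + X^2/T) * A^(-(3*θ)) := by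
  obtain ⟨C, hC, hMV⟩ := mean_value
  set Z : ℝ := ∑' n : ℕ, ((n:ℝ)^(1+θ))⁻¹ with hZ
  have hZs : Summable fun n : ℕ => ((n:ℝ)^(1+θ))⁻¹ := Real.summable_nat_rpow_inv.2 (by linarith)
  have hZ0 : 0 ≤ Z := tsum_nonneg fun n => by positivity
  refine ⟨C * (Z + 1), by positivity, ?_⟩
  intro S A X T ε z hT hA hε hS hz
  have hpos : ∀ n ∈ S, 1 ≤ n := fun n hn => by
    have := hA.trans (hS n hn).1; exact_mod_cast this
  have h1 := hMV S X T (fun n => ε n * (n:ℂ)^(-z)) hT fun n hn => ⟨hpos n hn, (hS n hn).2⟩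
  have h2 : ∀ t : ℝ, ∑ n ∈ S, ε n * (n:ℂ)^(-(z + t * I)) = ∑ n ∈ S, ε n * (n:ℂ)^(-z) * ef (-Real.log n) t := by
    intro t
    refine Finset.sum_congr rfl fun n hn => ?_
    rw [cpow_shift n (by have := hpos n hn; omega), mul_assoc]
  simp only [h2]
  refine h1.trans ?_
  have h3 : ∑ n ∈ S, ‖ε n * (n:ℂ)^(-z)‖^2 ≤ A^(-(3*θ)) * Z := by
    calc ∑ n ∈ S, ‖ε n * (n:ℂ)^(-z)‖^2 ≤ ∑ n ∈ S, A^(-(3*θ)) * ((n:ℝ)^(1+θ))⁻¹ := by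
          refine Finset.sum_le_sum fun n hn => ?_
          have hn0 : (0:ℝ) < n := by exact_mod_cast hpos n hn
          have hn1 : (1:ℝ) ≤ n := by exact_mod_cast hpos n hn
          rw [norm_mul, mul_pow, Complex.norm_natCast_cpow_of_pos (hpos n hn), ← Real.rpow_neg hn0.le]
          have e1 : ((n:ℝ)^((-z).re))^2 ≤ (n:ℝ)^(-(3*θ)) * (n:ℝ)^(-(1+θ)) := by
            rw [← Real.rpow_natCast, ← Real.rpow_mul hn0.le, ← Real.rpow_add hn0]
            apply Real.rpow_le_rpow_of_exponent_le hn1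
            rw [neg_re]; push_cast; linarith
          have e2 : (n:ℝ)^(-(3*θ)) ≤ A^(-(3*θ)) :=
            Real.rpow_le_rpow_of_nonpos (by linarith) (hS n hn).1 (by linarith)
          have e3 : ‖ε n‖^2 ≤ 1 := pow_le_one₀ (norm_nonneg _) (hε n)
          calc ‖ε n‖^2 * ((n:ℝ)^((-z).re))^2 ≤ 1 * ((n:ℝ)^(-(3*θ)) * (n:ℝ)^(-(1+θ))) := by
                exact mul_le_mul e3 e1 (by positivity) zero_le_one
            _ ≤ _ := by
                rw [one_mul]; exact mul_le_mul_of_nonneg_right e2 (by positivity)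
      _ = A^(-(3*θ)) * ∑ n ∈ S, ((n:ℝ)^(1+θ))⁻¹ := by rw [Finset.mul_sum]
      _ ≤ _ := by
          have : 0 ≤ A^(-(3*θ)) := by positivity
          exact mul_le_mul_of_nonneg_left (hZs.sum_le_tsum _ fun n _ => by positivity) this
  have hA0 : 0 < A^(-(3*θ)) := by positivity
  have hX : 0 ≤ X^2/T := by positivity
  calc C * (T + X^2/T) * ∑ n ∈ S, ‖ε n * (n:ℂ)^(-z)‖^2 ≤ C * (T + X^2/T) * (A^(-(3*θ)) * Z) := by
        exact mul_le_mul_of_nonneg_left h3 (by positivity)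
    _ ≤ C * (T + X^2/T) * (A^(-(3*θ)) * (Z+1)) := by gcongr; linarith
    _ = _ := by ring

lemma cpow_contOn (S : Finset ℕ) (hS : ∀ n ∈ S, 1 ≤ n) (ε : ℕ → ℂ) :
    Continuous (fun s : ℂ => ∑ n ∈ S, ε n * (n:ℂ)^(-s)) := by
  refine continuous_finsetSum _ fun n hn => continuous_const.mul ?_
  have : (n:ℂ) ≠ 0 := by have := hS n hn; exact_mod_cast (by omega : n ≠ 0)
  exact continuous_neg.const_cpow (Or.inl this)

lemma tend_neg_rpow (a c η : ℝ) (ha : 0 < a) (hη : 0 < η) : ∃ x0 : ℝ, 1 ≤ x0 ∧ ∀ x : ℝ, x0 ≤ x → c * x^(-a) ≤ η := by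
  have h := (tendsto_rpow_neg_atTop ha).const_mul c
  rw [mul_zero] at h
  obtain ⟨x0, hx0⟩ := eventually_atTop.1 (h.eventually (ge_mem_nhds hη))
  exact ⟨max x0 1, le_max_right _ _, fun x hx => hx0 x (le_of_max_le_left hx)⟩

lemma MS_block {σ1 σ2 T0 : ℝ} (hσ : 1/2 < σ1) (p : ℕ) (ε : ℕ → ℂ) (hε : ∀ n, ‖ε n‖ ≤ 1) :
    MS σ1 σ2 T0 (fun Y s => ∑ n ∈ Finset.Ioc Y (p * Y), ε n * (n:ℂ)^(-s)) := by
  refine ⟨fun Y => (cpow_contOn _ (fun n hn => by have := (Finset.mem_Ioc.1 hn).1; omega) ε).continuousOn, ?_⟩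
  intro η hη
  obtain ⟨C, hC, hb⟩ := block ((σ1 - 1/2)/2) (by linarith)
  obtain ⟨x0, hx0, hx⟩ := tend_neg_rpow (3 * ((σ1 - 1/2)/2)) (2 * C) η (by linarith) hη
  refine ⟨⌈x0⌉₊, fun Y hY => ⟨p * Y + 1, by linarith [Nat.cast_nonneg (α := ℝ) (p*Y), Nat.cast_mul (α := ℝ) p Y], ?_⟩⟩
  intro T hT z hz1 _ _
  have hY' : x0 ≤ Y := (Nat.le_ceil _).trans (by exact_mod_cast hY)
  have hpY : (0:ℝ) ≤ p * Y := by positivity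
  have hT0 : 0 < T := by linarith
  have := hb (Finset.Ioc Y (p * Y)) Y (p * Y) T ε z hT0 (by linarith) hε (fun n hn => by
    rw [Finset.mem_Ioc] at hn
    exact ⟨by exact_mod_cast hn.1.le, by exact_mod_cast hn.2⟩) (by linarith)
  refine this.trans ?_
  have h1 : (p * Y : ℝ)^2 / T ≤ T := by
    rw [div_le_iff₀ hT0]; nlinarith
  have h2 := hx Y hY'
  have h3 : 0 < (Y:ℝ)^(-(3 * ((σ1 - 1/2)/2))) := Real.rpow_pos_of_pos (by linarith) _
  calc C * (T + (p * Y : ℝ)^2 / T) * (Y:ℝ)^(-(3 * ((σ1 - 1/2)/2)))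
      ≤ C * (T + T) * (Y:ℝ)^(-(3 * ((σ1 - 1/2)/2))) := by
        refine mul_le_mul_of_nonneg_right (mul_le_mul_of_nonneg_left (by linarith) hC.le) h3.le
    _ = (2 * C * (Y:ℝ)^(-(3 * ((σ1 - 1/2)/2)))) * T := by ring
    _ ≤ η * T := by gcongr

lemma sum_range_Ioc (N : ℕ) (s : ℂ) : ∑ n ∈ Finset.range N, (-1:ℂ)^n * ((n+1 : ℕ) : ℂ)^(-s) =
    ∑ n ∈ Finset.Ioc 0 N, (-1:ℂ)^(n+1) * (n:ℂ)^(-s) := by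
  induction N with
  | zero => simp
  | succ N ih =>
    rw [Finset.sum_range_succ, Finset.sum_Ioc_succ_top (Nat.zero_le N), ih]
    congr 2
    rw [pow_succ, pow_succ]; ring

lemma zeta_contOn : ContinuousOn riemannZeta {s : ℂ | 0 < s.re ∧ s.re < 1} := by
  intro s hs
  refine (differentiableAt_riemannZeta ?_).continuousAt.continuousWithinAt
  rintro rfl
  have : (1:ℂ).re < 1 := hs.2
  simp at this

lemma const_cpow_cont (n : ℕ) (hn : n ≠ 0) : Continuous (fun s : ℂ => (n:ℂ)^(-s)) :=
  continuous_neg.const_cpow (Or.inl (by exact_mod_cast hn))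

lemma two_cpow_cont : Continuous (fun s : ℂ => 1 - (2:ℂ)^(1-s)) :=
  continuous_const.sub ((continuous_const.sub continuous_id).const_cpow (Or.inl two_ne_zero))

lemma three_sq {T : ℝ} (hT : 0 ≤ T) (F f1 f2 : ℝ → ℂ) (c0 : Continuous F) (c1' : Continuous f1) (c2' : Continuous f2)
    (k : ℝ) (h : ∀ t ∈ Set.Icc (-T) T, ‖F t - f1 t - f2 t‖^2 ≤ k) :
    ∫ t in (-T)..T, ‖F t‖^2 ≤ 2 * T * (3 * k) + 3 * (∫ t in (-T)..T, ‖f1 t‖^2) + 3 * ∫ t in (-T)..T, ‖f2 t‖^2 := by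
  calc _ ≤ ∫ t in (-T)..T, (3 * k + 3 * ‖f1 t‖^2 + 3 * ‖f2 t‖^2) := by
        refine intervalIntegral.integral_mono_on (by linarith) ?_ ?_ fun t ht => ?_
        · exact (c0.norm.pow 2).intervalIntegrable _ _
        · exact ((continuous_const.add ((c1'.norm.pow 2).const_mul 3)).add ((c2'.norm.pow 2).const_mul 3)).intervalIntegrable _ _
        · have h1 := h t ht
          have e : F t = (F t - f1 t - f2 t) + f1 t + f2 t := by ring
          have n1 := norm_add₃_le (a := F t - f1 t - f2 t) (b := f1 t) (c := f2 t)
          rw [← e] at n1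
          have n0 := norm_nonneg (F t)
          generalize ‖F t - f1 t - f2 t‖ = a at *
          generalize ‖f1 t‖ = b at *
          generalize ‖f2 t‖ = c at *
          generalize ‖F t‖ = x at *
          have : x^2 ≤ (a+b+c)^2 := pow_le_pow_left₀ n0 n1 2
          nlinarith [sq_nonneg (a-b), sq_nonneg (b-c), sq_nonneg (a-c)]
    _ = _ := by
        generalize 3 * k = c0
        have e0 : ∫ t in (-T)..T, c0 = 2 * T * c0 := by
          rw [intervalIntegral.integral_const, smul_eq_mul]; ring
        rw [intervalIntegral.integral_add, intervalIntegral.integral_add, intervalIntegral.integral_const_mul,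
          intervalIntegral.integral_const_mul, e0]
        · exact continuous_const.intervalIntegrable _ _
        · exact ((c1'.norm.pow 2).const_mul 3).intervalIntegrable _ _
        · exact (continuous_const.add ((c1'.norm.pow 2).const_mul 3)).intervalIntegrable _ _
        · exact ((c2'.norm.pow 2).const_mul 3).intervalIntegrable _ _

set_option maxHeartbeats 2000000 in
lemma MS_eta {σ1 σ2 T0 : ℝ} (hσ : 1/2 < σ1) (hσ2 : σ2 < 1) :
    MS σ1 σ2 T0 (fun Y s => (1 - 2^(1-s)) * riemannZeta s - ∑ n ∈ Finset.Ioc 0 Y, (-1:ℂ)^(n+1) * (n:ℂ)^(-s)) := by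
  have hcont : ∀ Y : ℕ, ContinuousOn (fun s : ℂ => (1 - 2^(1-s)) * riemannZeta s -
      ∑ n ∈ Finset.Ioc 0 Y, (-1:ℂ)^(n+1) * (n:ℂ)^(-s)) {s : ℂ | 0 < s.re ∧ s.re < 1} := fun Y =>
    (two_cpow_cont.continuousOn.mul zeta_contOn).sub
      (cpow_contOn _ (fun n hn => (Finset.mem_Ioc.1 hn).1) (fun n => (-1)^(n+1))).continuousOn
  refine ⟨hcont, fun η hη => ?_⟩
  set θ : ℝ := (σ1 - 1/2)/2 with hθ
  have hθ0 : 0 < θ := by rw [hθ]; linarith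
  obtain ⟨C, hC, hb⟩ := block θ hθ0
  obtain ⟨k, hk⟩ := exists_nat_ge (max 2 ((3 + 2 * θ)/θ))
  have hk2 : 2 ≤ k := by exact_mod_cast (le_of_max_le_left hk)
  have hk3 : 3 + 2 * θ ≤ θ * k := by
    have := le_of_max_le_right hk
    rw [div_le_iff₀ hθ0] at this; linarith
  set Z2 : ℝ := ∑' j : ℕ, (((j+1 : ℕ) : ℝ)^(2:ℝ))⁻¹ with hZ2
  have hZ20 : 0 ≤ Z2 := tsum_nonneg fun j => by positivity
  set K : ℝ := k + 2^k * Z2 with hK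
  have hK0 : 0 ≤ K := by positivity
  obtain ⟨y0, hy0, hy⟩ := tend_neg_rpow (3*θ) (2*C) (η/9) (by linarith) (by linarith)
  obtain ⟨x1, hx1, hx⟩ := tend_neg_rpow θ (5*C) (η/9) hθ0 (by linarith)
  obtain ⟨x2, hx2, hxx⟩ := tend_neg_rpow θ 2 1 hθ0 one_pos
  refine ⟨⌈y0⌉₊, fun Y hY => ?_⟩
  have hY' : y0 ≤ Y := (Nat.le_ceil _).trans (by exact_mod_cast hY)
  set T1 : ℝ := max (max x1 x2) (max (Y + 1 + |T0| + k) (2 * K^2 * 9 / η)) with hT1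
  refine ⟨T1, le_max_of_le_left (le_max_of_le_left hx1), fun T hT z hz1 hz2 hz3 => ?_⟩
  have t1 : x1 ≤ T := le_trans (le_max_of_le_left (le_max_left _ _)) hT
  have t2 : x2 ≤ T := le_trans (le_max_of_le_left (le_max_right _ _)) hT
  have t3 : Y + 1 + |T0| + k ≤ T := le_trans (le_max_of_le_right (le_max_left _ _)) hT
  have t4 : 2 * K^2 * 9 / η ≤ T := le_trans (le_max_of_le_right (le_max_right _ _)) hT
  have hTone : 1 ≤ T := hx1.trans t1
  have hTpos : 0 < T := by linarith
  have hk0 : (0:ℝ) ≤ k := Nat.cast_nonneg k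
  set N : ℕ := ⌈T^(1+θ)⌉₊ with hN
  have hpw1 : T ≤ T^(1+θ) := by
    conv_lhs => rw [← Real.rpow_one T]
    exact Real.rpow_le_rpow_of_exponent_le hTone (by linarith)
  have hpw : 2 * T ≤ T^(1+θ) := by
    have h1 := hxx T t2
    have h2 : T^(1+θ) * T^(-θ) = T := by
      rw [← Real.rpow_add hTpos]; simp
    have h3 : 0 < T^(1+θ) := by positivity
    nlinarith
  have hNlow : T^(1+θ) ≤ N := Nat.le_ceil _
  have hNup : (N:ℝ) ≤ 2 * T^(1+θ) := by
    have := Nat.ceil_lt_add_one (show 0 ≤ T^(1+θ) by positivity)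
    have : (N:ℝ) < T^(1+θ) + 1 := this
    linarith
  set M : ℕ := ⌊T⌋₊ with hM
  have hMT : (M:ℝ) ≤ T := Nat.floor_le hTpos.le
  have hMT1 : T < M + 1 := Nat.lt_floor_add_one T
  have hYM : Y ≤ M := Nat.le_floor (by linarith [abs_nonneg T0])
  have hMN : M ≤ N := by
    have : (M:ℝ) ≤ N := hMT.trans (hpw1.trans hNlow)
    exact_mod_cast this
  have hNpos : 1 ≤ N := by
    have : (1:ℝ) ≤ N := hTone.trans (hpw1.trans hNlow)
    exact_mod_cast this
  have hNr : (0:ℝ) < N := by exact_mod_cast hNpos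
  -- remainder
  have hrem : ∀ t ∈ Set.Icc (-T) T, ‖(1 - 2^(1-(z + t * I))) * riemannZeta (z + t * I) -
      ∑ n ∈ Finset.Ioc 0 N, (-1:ℂ)^(n+1) * (n:ℂ)^(-(z + t * I))‖^2 ≤ K^2 * T⁻¹ := by
    intro t ht
    set s : ℂ := z + t * I with hs
    have hsre : s.re = z.re := by simp [hs]
    have hsn : ‖s‖ + k ≤ 2 * T := by
      have e1 : ‖s‖ ≤ |s.re| + |s.im| := Complex.norm_le_abs_re_add_abs_im s
      have e2 : s.im = z.im + t := by simp [hs]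
      have e3 : |s.im| ≤ |T0| + T := by
        rw [e2]
        refine (abs_add_le _ _).trans (add_le_add (hz3.trans (le_abs_self _)) (abs_le.2 ht))
      have e4 : |s.re| ≤ 1 := by rw [hsre, abs_le]; constructor <;> linarith
      have : (0:ℝ) ≤ Y := Nat.cast_nonneg Y
      linarith
    have h := eta_approx k N hk2 hNpos s (by rw [hsre]; linarith) (by rw [hsre]; linarith) (2*T) hsn
      (hpw.trans hNlow)
    rw [sum_range_Ioc, ← hZ2] at h
    have b1 : (N:ℝ)^(-s.re) ≤ T^(-(1/2:ℝ)) := by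
      calc (N:ℝ)^(-s.re) ≤ T^(-s.re) := Real.rpow_le_rpow_of_nonpos hTpos (hpw1.trans hNlow) (by rw [hsre]; linarith)
        _ ≤ _ := Real.rpow_le_rpow_of_exponent_le hTone (by rw [hsre]; linarith)
    have b2 : (2*T)^k * (N:ℝ)^(2-(k:ℝ)) ≤ 2^k * T^(-(1/2:ℝ)) := by
      have hk' : (2:ℝ) ≤ k := by exact_mod_cast hk2
      calc (2*T)^k * (N:ℝ)^(2-(k:ℝ)) ≤ (2*T)^k * (T^(1+θ))^(2-(k:ℝ)) := by
            refine mul_le_mul_of_nonneg_left ?_ (by positivity)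
            exact Real.rpow_le_rpow_of_nonpos (by positivity) hNlow (by linarith)
        _ = 2^k * T^((k:ℝ) + (1+θ)*(2-(k:ℝ))) := by
            rw [mul_pow, ← Real.rpow_mul hTpos.le, Real.rpow_add hTpos, Real.rpow_natCast]; ring
        _ ≤ 2^k * T^(-(1/2:ℝ)) := by
            refine mul_le_mul_of_nonneg_left ?_ (by positivity)
            apply Real.rpow_le_rpow_of_exponent_le hTone
            nlinarith
    have b3 : ‖(1 - 2^(1-s)) * riemannZeta s - ∑ n ∈ Finset.Ioc 0 N, (-1:ℂ)^(n+1) * (n:ℂ)^(-s)‖ ≤ K * T^(-(1/2:ℝ)) := by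
      refine h.trans ?_
      calc (k:ℝ) * (N:ℝ)^(-s.re) + (2*T)^k * (N:ℝ)^(2-(k:ℝ)) * Z2
          ≤ k * T^(-(1/2:ℝ)) + 2^k * T^(-(1/2:ℝ)) * Z2 :=
            add_le_add (mul_le_mul_of_nonneg_left b1 hk0) (mul_le_mul_of_nonneg_right b2 hZ20)
        _ = _ := by rw [hK]; ring
    calc _ ≤ (K * T^(-(1/2:ℝ)))^2 := pow_le_pow_left₀ (norm_nonneg _) b3 2
      _ = K^2 * T⁻¹ := by
          rw [mul_pow, ← Real.rpow_natCast (T^(-(1/2:ℝ))), ← Real.rpow_mul hTpos.le, ← Real.rpow_neg_one]; norm_num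
  -- blocks
  have B1 := hb (Finset.Ioc Y M) Y T T (fun n => (-1)^(n+1)) z hTpos (by linarith) (fun n => by simp)
    (fun n hn => by
      rw [Finset.mem_Ioc] at hn
      exact ⟨by exact_mod_cast hn.1.le, le_trans (by exact_mod_cast hn.2) hMT⟩) (by linarith)
  have B2 := hb (Finset.Ioc M N) T (2 * T^(1+θ)) T (fun n => (-1)^(n+1)) z hTpos hTone (fun n => by simp)
    (fun n hn => by
      rw [Finset.mem_Ioc] at hn
      refine ⟨?_, le_trans (by exact_mod_cast hn.2) hNup⟩
      have : (M:ℝ) + 1 ≤ n := by exact_mod_cast hn.1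
      linarith) (by linarith)
  have B1' : C * (T + T^2/T) * (Y:ℝ)^(-(3*θ)) ≤ η/9 * T := by
    have := hy Y hY'
    have e : T^2/T = T := by field_simp
    rw [e]
    calc C * (T + T) * (Y:ℝ)^(-(3*θ)) = (2 * C * (Y:ℝ)^(-(3*θ))) * T := by ring
      _ ≤ _ := by gcongr
  have B2' : C * (T + (2 * T^(1+θ))^2/T) * T^(-(3*θ)) ≤ η/9 * T := by
    have h1 := hx T t1
    have e1 : (2 * T^(1+θ))^2/T = 4 * T^(1+2*θ) := by
      rw [mul_pow, ← Real.rpow_natCast (T^(1+θ)), ← Real.rpow_mul hTpos.le, div_eq_mul_inv, ← Real.rpow_neg_one,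
        mul_assoc, ← Real.rpow_add hTpos]
      norm_num; congr 1; ring
    have e2 : T ≤ T^(1+2*θ) := by
      conv_lhs => rw [← Real.rpow_one T]
      exact Real.rpow_le_rpow_of_exponent_le hTone (by linarith)
    have e3 : T^(1+2*θ) * T^(-(3*θ)) = T^(-θ) * T := by
      conv_rhs => rw [mul_comm, ← Real.rpow_one_add' hTpos.le (by
        intro h
        have : θ = 1 := by linarith
        have h5 : σ1 = 5/2 := by rw [hθ] at this; linarith
        linarith)]
      rw [← Real.rpow_add hTpos]; congr 1; ring
    rw [e1]
    calc C * (T + 4 * T^(1+2*θ)) * T^(-(3*θ)) ≤ C * (5 * T^(1+2*θ)) * T^(-(3*θ)) := by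
          refine mul_le_mul_of_nonneg_right (mul_le_mul_of_nonneg_left (by linarith) hC.le) (by positivity)
      _ = 5 * C * (T^(1+2*θ) * T^(-(3*θ))) := by ring
      _ = (5 * C * T^(-θ)) * T := by rw [e3]; ring
      _ ≤ _ := by gcongr
  have hsplit : ∀ s : ℂ, ∑ n ∈ Finset.Ioc 0 N, (-1:ℂ)^(n+1) * (n:ℂ)^(-s) =
      ∑ n ∈ Finset.Ioc 0 Y, (-1:ℂ)^(n+1) * (n:ℂ)^(-s) + ∑ n ∈ Finset.Ioc Y M, (-1:ℂ)^(n+1) * (n:ℂ)^(-s) +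
      ∑ n ∈ Finset.Ioc M N, (-1:ℂ)^(n+1) * (n:ℂ)^(-s) := by
    intro s
    rw [Finset.sum_Ioc_consecutive _ (Nat.zero_le Y) hYM, Finset.sum_Ioc_consecutive _ (Nat.zero_le M) hMN]
  have c0 := line_cont (hcont Y) z (by linarith) (by linarith)
  have c1 := line_cont (cpow_contOn (Finset.Ioc Y M) (fun n hn => by have := (Finset.mem_Ioc.1 hn).1; omega)
    (fun n => (-1)^(n+1))).continuousOn z (by linarith) (by linarith)
  have c2 := line_cont (cpow_contOn (Finset.Ioc M N) (fun n hn => by have := (Finset.mem_Ioc.1 hn).1; omega)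
    (fun n => (-1)^(n+1))).continuousOn z (by linarith) (by linarith)
  refine (three_sq (by linarith) _ _ _ c0 c1 c2 (K^2*T⁻¹) ?_).trans ?_
  · intro t ht
    have h1 := hrem t ht
    rw [hsplit] at h1
    refine le_trans (le_of_eq ?_) h1
    congr 2
    ring
  refine le_trans (b := 3 * (η/9 * T) + 3 * (η/9 * T) + 3 * (η/9 * T)) ?_ (le_of_eq (by ring))
  have b1 := B1.trans B1'
  have b2 := B2.trans B2'
  have b3 : 2 * T * (3 * (K^2 * T⁻¹)) ≤ 3 * (η/9 * T) := by
    rw [div_le_iff₀ hη] at t4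
    have : 2 * T * (3 * (K^2 * T⁻¹)) = 6 * K^2 := by field_simp; ring
    rw [this]; nlinarith
  exact add_le_add (add_le_add b3 (by linarith)) (by linarith)

lemma MS_congr {σ1 σ2 T0 : ℝ} (h1 : 0 < σ1) (h2 : σ2 < 1) {F G : ℕ → ℂ → ℂ} (hF : MS σ1 σ2 T0 F)
    (h : ∀ Y s, 0 < s.re → s.re < 1 → G Y s = F Y s) : MS σ1 σ2 T0 G := by
  refine ⟨fun Y => (hF.1 Y).congr fun s hs => h Y s hs.1 hs.2, fun η hη => ?_⟩
  obtain ⟨Y0, hY0⟩ := hF.2 η hη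
  refine ⟨Y0, fun Y hY => ?_⟩
  obtain ⟨T1, hT1, H⟩ := hY0 Y hY
  refine ⟨T1, hT1, fun T hT z a b c => ?_⟩
  refine le_trans (le_of_eq ?_) (H T hT z a b c)
  congr 1; funext t
  rw [h Y (z + t * I) (by simp; linarith) (by simp; linarith)]

lemma psum (p : ℕ) (hp : 1 ≤ p) (c : ℕ → ℂ) (hc : ∀ m, c (p * m) = c m) (Y : ℕ) (s : ℂ) :
    (p:ℂ)^(-s) * ∑ m ∈ Finset.Ioc 0 Y, c m * (m:ℂ)^(-s) =
      ∑ n ∈ Finset.Ioc 0 (p*Y), (if p ∣ n then c n else 0) * (n:ℂ)^(-s) := by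
  classical
  have : ∀ n, (if p ∣ n then c n else 0) * (n:ℂ)^(-s) = if p ∣ n then c n * (n:ℂ)^(-s) else 0 := by
    intro n; split_ifs <;> simp
  simp_rw [this]
  rw [← Finset.sum_filter, Finset.mul_sum]
  refine Finset.sum_bij (fun m _ => p * m) ?_ ?_ ?_ ?_
  · intro m hm
    simp only [Finset.mem_filter, Finset.mem_Ioc] at hm ⊢
    exact ⟨⟨Nat.mul_pos hp hm.1, Nat.mul_le_mul_left p hm.2⟩, dvd_mul_right _ _⟩
  · intro a _ b _ h
    exact Nat.eq_of_mul_eq_mul_left hp h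
  · intro n hn
    simp only [Finset.mem_filter, Finset.mem_Ioc] at hn
    obtain ⟨⟨h1, h2⟩, k, rfl⟩ := hn
    refine ⟨k, ?_, rfl⟩
    rw [Finset.mem_Ioc]
    exact ⟨Nat.pos_of_mul_pos_left h1, Nat.le_of_mul_le_mul_left h2 hp⟩
  · intro m hm
    rw [hc, Nat.cast_mul, Complex.natCast_mul_natCast_cpow]; ring

lemma MS_zeta {σ1 σ2 T0 : ℝ} (hσ : 1/2 < σ1) (hσ2 : σ2 < 1) :
    MS σ1 σ2 T0 (fun Y s => riemannZeta s - ∑ n ∈ Finset.Ioc 0 Y, (n:ℂ)^(-s)) := by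
  have h0 : 0 < σ1 := by linarith
  have hlow : ∀ s : ℂ, (2:ℝ)^(1-s.re) - 1 ≤ ‖1 - (2:ℂ)^(1-s)‖ := by
    intro s
    have e : ‖(2:ℂ)^(1-s)‖ = (2:ℝ)^(1-s.re) := by
      have := Complex.norm_natCast_cpow_of_pos (n := 2) (by norm_num) (1-s)
      simpa using this
    rw [← e, norm_sub_rev]
    have := norm_sub_norm_le ((2:ℂ)^(1-s)) 1
    simpa using this
  have hne : ∀ s : ℂ, s.re < 1 → 1 - (2:ℂ)^(1-s) ≠ 0 := by
    intro s hs
    have h1 := hlow s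
    have : 1 < (2:ℝ)^(1-s.re) := Real.one_lt_rpow (by norm_num) (by linarith)
    rw [← norm_pos_iff]; linarith
  have A := MS_add h0 hσ2 (MS_eta (T0 := T0) hσ hσ2) (MS_mul (B := 2) h0 hσ2 (MS_block (σ2 := σ2) (T0 := T0) hσ 2
    (fun n => if 2 ∣ n then (1:ℂ) else 0) (fun n => by split_ifs <;> simp)) (g := fun _ => 2) continuousOn_const
    (fun _ _ _ => by simp))
  have hB : 0 < (2:ℝ)^(1-σ2) - 1 := by
    have : 1 < (2:ℝ)^(1-σ2) := Real.one_lt_rpow (by norm_num) (by linarith)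
    linarith
  have B := MS_mul (B := ((2:ℝ)^(1-σ2) - 1)⁻¹) h0 hσ2 A (g := fun s => (1 - (2:ℂ)^(1-s))⁻¹)
    (two_cpow_cont.continuousOn.inv₀ fun s hs => hne s hs.2) (fun s _ h2 => by
      rw [norm_inv]
      refine inv_anti₀ hB ((sub_le_sub_right ?_ 1).trans (hlow s))
      exact Real.rpow_le_rpow_of_exponent_le (by norm_num) (by linarith))
  refine MS_congr h0 hσ2 B fun Y s h1 h2 => ?_
  have hn := hne s h2
  rw [eq_inv_mul_iff_mul_eq₀ hn]
  have e1 := psum 2 (by norm_num) (fun _ => 1) (fun _ => rfl) Y s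
  have e2 : (2:ℂ)^(1-s) = 2 * (2:ℂ)^(-s) := by
    rw [sub_eq_add_neg, Complex.cpow_add _ _ (by norm_num), Complex.cpow_one]
  have e3 : ∑ n ∈ Finset.Ioc 0 Y, (-1:ℂ)^(n+1) * (n:ℂ)^(-s) = ∑ n ∈ Finset.Ioc 0 Y, (n:ℂ)^(-s)
      - 2 * ∑ n ∈ Finset.Ioc 0 Y, (if 2 ∣ n then (1:ℂ) else 0) * (n:ℂ)^(-s) := by
    rw [Finset.mul_sum, ← Finset.sum_sub_distrib]
    refine Finset.sum_congr rfl fun n _ => ?_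
    split_ifs with h
    · rw [pow_succ, Even.neg_one_pow (even_iff_two_dvd.2 h)]; ring
    · rw [pow_succ, Odd.neg_one_pow (by rw [← Nat.not_even_iff_odd, even_iff_two_dvd]; exact h)]; ring
  rw [← Finset.sum_Ioc_consecutive _ (Nat.zero_le Y) (by omega : Y ≤ 2 * Y)] at e1
  simp only [one_mul] at e1
  push_cast at e1
  rw [e3, e2]
  linear_combination 2 * e1

def cop (P : Finset ℕ) (n : ℕ) : ℂ := if ∀ p ∈ P, ¬ p ∣ n then 1 else 0

lemma cop_norm (P : Finset ℕ) (n : ℕ) : ‖cop P n‖ ≤ 1 := by unfold cop; split_ifs <;> simp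

lemma MS_prod {σ1 σ2 T0 : ℝ} (hσ : 1/2 < σ1) (hσ2 : σ2 < 1) (P : Finset ℕ) (hP : ∀ p ∈ P, p.Prime) :
    MS σ1 σ2 T0 (fun Y s => riemannZeta s * ∏ p ∈ P, (1 - (p:ℂ)^(-s)) -
      ∑ n ∈ Finset.Ioc 0 Y, cop P n * (n:ℂ)^(-s)) := by
  have h0 : 0 < σ1 := by linarith
  induction P using Finset.induction_on with
  | empty => simpa [cop] using MS_zeta hσ hσ2
  | insert p P hp ih =>
    have hpp : p.Prime := hP p (Finset.mem_insert_self _ _)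
    have ih := ih fun q hq => hP q (Finset.mem_insert_of_mem hq)
    have A := MS_mul (B := 2) h0 hσ2 ih (g := fun s => 1 - (p:ℂ)^(-s))
      (continuous_const.sub (const_cpow_cont p hpp.ne_zero)).continuousOn (fun s h1 _ => by
        refine (norm_sub_le _ _).trans ?_
        rw [Complex.norm_natCast_cpow_of_pos hpp.pos]
        have : (p:ℝ)^((-s).re) ≤ 1 := Real.rpow_le_one_of_one_le_of_nonpos (by exact_mod_cast hpp.one_le) (by simp; linarith)
        simp only [norm_one]; linarith)
    have B := MS_add h0 hσ2 A (MS_block (σ2 := σ2) (T0 := T0) hσ p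
      (fun n => - (if p ∣ n then cop P n else 0)) (fun n => by
        rw [norm_neg]; split_ifs <;> simp [cop_norm]))
    refine MS_congr h0 hσ2 B fun Y s _ _ => ?_
    have hc : ∀ m, cop P (p * m) = cop P m := by
      intro m
      unfold cop
      congr 1
      refine propext (forall₂_congr fun q hq => ?_)
      have hq' := hP q (Finset.mem_insert_of_mem hq)
      rw [hq'.dvd_mul, Nat.prime_dvd_prime_iff_eq hq' hpp]
      have : q ≠ p := fun h => hp (h ▸ hq)
      tauto
    have e1 := psum p hpp.one_le (cop P) hc Y s
    rw [← Finset.sum_Ioc_consecutive _ (Nat.zero_le Y) (Nat.le_mul_of_pos_left Y hpp.pos)] at e1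
    have e3 : ∑ n ∈ Finset.Ioc 0 Y, cop (insert p P) n * (n:ℂ)^(-s) = ∑ n ∈ Finset.Ioc 0 Y, cop P n * (n:ℂ)^(-s)
        - ∑ n ∈ Finset.Ioc 0 Y, (if p ∣ n then cop P n else 0) * (n:ℂ)^(-s) := by
      rw [← Finset.sum_sub_distrib]
      refine Finset.sum_congr rfl fun n _ => ?_
      by_cases h : p ∣ n <;> simp [cop, h]
    have e4 : ∑ n ∈ Finset.Ioc Y (p*Y), -(if p ∣ n then cop P n else 0) * (n:ℂ)^(-s) =
        - ∑ n ∈ Finset.Ioc Y (p*Y), (if p ∣ n then cop P n else 0) * (n:ℂ)^(-s) := by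
      rw [← Finset.sum_neg_distrib]
      exact Finset.sum_congr rfl fun n _ => by ring
    rw [Finset.prod_insert hp, e3, e4]
    linear_combination - e1

def Rect (a b T : ℝ) : Set ℂ := {z | a ≤ z.re ∧ z.re ≤ b ∧ |z.im| ≤ T}

lemma Rect_compact (a b T : ℝ) : IsCompact (Rect a b T) := by
  have : Rect a b T = Complex.equivRealProdCLM.symm '' (Set.Icc a b ×ˢ Set.Icc (-T) T) := by
    ext z
    constructor
    · rintro ⟨h1, h2, h3⟩
      exact ⟨(z.re, z.im), ⟨⟨h1, h2⟩, abs_le.1 h3⟩, by apply Complex.ext <;> simp⟩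
    · rintro ⟨⟨x, y⟩, ⟨h1, h2⟩, rfl⟩
      exact ⟨by simpa using h1.1, by simpa using h1.2, by simpa [abs_le] using h2⟩
  rw [this]
  exact (isCompact_Icc.prod isCompact_Icc).image Complex.equivRealProdCLM.symm.continuous

lemma circ_bound {G : ℂ → ℂ} {s : ℂ} {R ρ : ℝ} (hG : DifferentiableOn ℂ G (Metric.ball s R)) (h0 : 0 < ρ) (h1 : ρ < R) :
    ENNReal.ofReal (2 * Real.pi * ‖G s‖^2) ≤
      ∫⁻ θ in Set.Ioo (-Real.pi) Real.pi, ENNReal.ofReal (‖G (s + ρ * (Real.cos θ + Real.sin θ * I))‖^2) := by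
  have hcm : ∀ θ : ℝ, s + ρ * (Real.cos θ + Real.sin θ * I) = circleMap s ρ θ := by
    intro θ
    rw [circleMap, Complex.exp_mul_I, Complex.ofReal_cos, Complex.ofReal_sin]
  simp_rw [hcm]
  have hd : DiffContOnCl ℂ (fun z => G z ^ 2) (Metric.ball s |ρ|) := by
    rw [abs_of_pos h0]
    refine DifferentiableOn.diffContOnCl ?_
    rw [closure_ball _ h0.ne']
    exact (hG.mono (Metric.closedBall_subset_ball h1)).pow 2
  have e := hd.circleAverage
  rw [Real.circleAverage_eq_integral_add (-Real.pi)] at e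
  have hc : Continuous fun θ : ℝ => G (circleMap s ρ θ) := by
    refine hG.continuousOn.comp_continuous (continuous_circleMap s ρ) fun θ => ?_
    rw [Metric.mem_ball, dist_eq_norm, circleMap_sub_center, norm_circleMap_zero, abs_of_pos h0]
    exact h1
  have key : 2 * Real.pi * ‖G s‖^2 ≤ ∫ θ in (-Real.pi)..Real.pi, ‖G (circleMap s ρ θ)‖^2 := by
    have e' : ∫ θ in (-Real.pi)..Real.pi, (G (circleMap s ρ θ))^2 = (2 * Real.pi : ℝ) • (G s)^2 := by
      have h3 := congrArg (fun x => (2 * Real.pi : ℝ) • x) e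
      rw [smul_smul, mul_inv_cancel₀ (by positivity), one_smul] at h3
      rw [← h3, intervalIntegral.integral_comp_add_right (fun θ => (G (circleMap s ρ θ))^2)]
      congr 1 <;> ring
    have h4 := intervalIntegral.norm_integral_le_integral_norm (f := fun θ => (G (circleMap s ρ θ))^2) (μ := volume)
      (by linarith [Real.pi_pos] : -Real.pi ≤ Real.pi)
    rw [e', norm_smul, norm_pow] at h4
    simp only [norm_pow, Real.norm_eq_abs] at h4
    rwa [abs_of_pos (by positivity : 0 < 2 * Real.pi)] at h4
  refine (ENNReal.ofReal_le_ofReal key).trans (le_of_eq ?_)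
  rw [intervalIntegral.integral_of_le (by linarith [Real.pi_pos]), integral_Ioc_eq_integral_Ioo,
    ofReal_integral_eq_lintegral_ofReal]
  · exact ((hc.norm.pow 2).integrableOn_Icc (a := -Real.pi) (b := Real.pi)).mono_set Set.Ioo_subset_Icc_self
  · exact Eventually.of_forall fun _ => by positivity

lemma area_bound {r : ℝ} (hr : 0 < r) : ∃ C : ℝ, 0 < C ∧ ∀ (G : ℂ → ℂ) (s : ℂ),
    DifferentiableOn ℂ G (Metric.ball s r) →
    ENNReal.ofReal (C * ‖G s‖^2) ≤ ∫⁻ z in Metric.ball s r, ENNReal.ofReal (‖G z‖^2) := by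
  refine ⟨(r/2) * (2 * Real.pi) * (r/2), by positivity, fun G s hG => ?_⟩
  set F : ℂ → ℝ≥0∞ := (Metric.ball s r).indicator (fun z => ENNReal.ofReal (‖G z‖^2)) with hF
  have hFm : Measurable F := by
    refine measurable_of_restrict_of_restrict_compl (s := Metric.ball s r) Metric.isOpen_ball.measurableSet ?_ ?_
    · have : ContinuousOn (fun z => ENNReal.ofReal (‖G z‖^2)) (Metric.ball s r) :=
        ENNReal.continuous_ofReal.comp_continuousOn (hG.continuousOn.norm.pow 2)
      have e : (Metric.ball s r).domRestrict F = (Metric.ball s r).domRestrict (fun z => ENNReal.ofReal (‖G z‖^2)) := by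
        funext x
        simp only [Set.domRestrict_apply, hF]
        rw [Set.indicator_of_mem x.2]
      rw [e]
      exact this.domRestrict.measurable
    · have e : (Metric.ball s r)ᶜ.domRestrict F = fun _ => 0 := by
        funext x
        simp only [Set.domRestrict_apply, hF]
        rw [Set.indicator_of_notMem x.2]
      rw [e]
      exact measurable_const
  rw [← lintegral_indicator Metric.isOpen_ball.measurableSet]
  change _ ≤ ∫⁻ z, F z
  rw [← lintegral_add_left_eq_self F s, ← Complex.lintegral_comp_polarCoord_symm, polarCoord_target,
    Measure.volume_eq_prod, ← Measure.prod_restrict, lintegral_prod _ (by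
      refine Measurable.aemeasurable ?_
      refine (ENNReal.measurable_ofReal.comp measurable_fst).smul (hFm.comp ?_)
      refine measurable_const.add ?_
      have : (fun p : ℝ × ℝ => Complex.polarCoord.symm p) = fun p => (p.1:ℂ) * (Real.cos p.2 + Real.sin p.2 * Complex.I) := by
        funext p; simp
      change Measurable (fun p : ℝ × ℝ => Complex.polarCoord.symm p)
      rw [this]; fun_prop)]
  have hsub : Set.Ioo (r/2) r ⊆ Set.Ioi (0:ℝ) := fun x hx => lt_trans (by positivity) hx.1
  refine le_trans ?_ (lintegral_mono_set hsub)
  calc ENNReal.ofReal ((r/2) * (2 * Real.pi) * (r/2) * ‖G s‖^2)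
      = ∫⁻ x in Set.Ioo (r/2) r, ENNReal.ofReal (r/2) * ENNReal.ofReal (2 * Real.pi * ‖G s‖^2) := by
        rw [setLIntegral_const, Real.volume_Ioo, ← ENNReal.ofReal_mul (by positivity), ← ENNReal.ofReal_mul (by positivity)]
        congr 1; ring
    _ ≤ _ := by
        refine setLIntegral_mono' measurableSet_Ioo fun x hx => ?_
        have hx0 : 0 < x := hsub hx
        simp only [smul_eq_mul]
        rw [lintegral_const_mul' _ _ ENNReal.ofReal_ne_top]
        refine mul_le_mul' (ENNReal.ofReal_le_ofReal hx.1.le) ((circ_bound hG hx0 hx.2).trans (le_of_eq ?_))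
        refine lintegral_congr fun θ => ?_
        rw [hF, Set.indicator_of_mem, Complex.polarCoord_symm_apply]
        rw [Metric.mem_ball, dist_eq_norm, add_sub_cancel_left, Complex.norm_polarCoord_symm, abs_of_pos hx0]
        exact hx.2

lemma sup_L2 {r : ℝ} (hr : 0 < r) : ∃ C : ℝ, 0 < C ∧ ∀ (a b T : ℝ) (G : ℂ → ℂ),
    DifferentiableOn ℂ G {z | a - 2 * r < z.re ∧ z.re < b + 2 * r} → ∀ s ∈ Rect a b T,
    ‖G s‖^2 ≤ C * ∫ z in Rect (a-r) (b+r) (T+r), ‖G z‖^2 := by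
  obtain ⟨C, hC, H⟩ := area_bound hr
  refine ⟨C⁻¹, by positivity, fun a b T G hG s hs => ?_⟩
  have hsub : Metric.ball s r ⊆ Rect (a-r) (b+r) (T+r) := by
    intro z hz
    rw [Metric.mem_ball, dist_eq_norm] at hz
    have h1 := abs_le.1 ((Complex.abs_re_le_norm (z - s)).trans hz.le)
    have h2 := abs_le.1 ((Complex.abs_im_le_norm (z - s)).trans hz.le)
    have h3 := abs_le.1 hs.2.2
    simp only [Complex.sub_re, Complex.sub_im] at h1 h2
    exact ⟨by linarith [hs.1], by linarith [hs.2.1], abs_le.2 ⟨by linarith, by linarith⟩⟩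
  have hsub2 : Rect (a-r) (b+r) (T+r) ⊆ {z | a - 2 * r < z.re ∧ z.re < b + 2 * r} := fun z hz =>
    ⟨by linarith [hz.1], by linarith [hz.2.1]⟩
  have h := H G s (hG.mono (hsub.trans hsub2))
  have h' := h.trans (lintegral_mono_set hsub)
  have hi : IntegrableOn (fun z => ‖G z‖^2) (Rect (a-r) (b+r) (T+r)) :=
    ContinuousOn.integrableOn_compact (Rect_compact _ _ _) ((hG.mono hsub2).continuousOn.norm.pow 2)
  rw [← ofReal_integral_eq_lintegral_ofReal hi (Eventually.of_forall fun _ => by positivity),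
    ENNReal.ofReal_le_ofReal_iff (integral_nonneg fun _ => by positivity)] at h'
  rw [inv_mul_eq_div, le_div_iff₀ hC]; linarith

lemma PL_quad (Φ : ℂ → ℂ) (hΦ : Differentiable ℂ Φ) (C T β : ℝ) (hT : 0 ≤ T) (hC : 0 ≤ C)
    (h1 : ∀ w : ℂ, 0 ≤ w.re → 0 ≤ w.im → ‖Φ w‖ ≤ C * Real.exp (T * w.im))
    (h3 : ∀ x : ℝ, 0 ≤ x → ‖Φ x‖ ≤ C * Real.exp (-β * x)) (w : ℂ) (hw : 0 ≤ w.re) (hw' : 0 ≤ w.im) :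
    ‖Φ w‖ ≤ C * Real.exp (-β * w.re + T * w.im) := by
  have hn : ∀ w : ℂ, ‖cexp ((β + T * I) * w)‖ = Real.exp (β * w.re - T * w.im) := by
    intro w
    rw [Complex.norm_exp]; congr 1; simp
  have key : ‖Φ w * cexp ((β + T * I) * w)‖ ≤ C := by
    refine PhragmenLindelof.quadrant_I (f := fun w => Φ w * cexp ((β + T * I) * w)) ?_ ?_ ?_ ?_ hw hw'
    · exact (hΦ.mul (by fun_prop)).diffContOnCl
    · refine ⟨1, by norm_num, |β|, ?_⟩
      refine Asymptotics.IsBigO.of_bound C ?_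
      refine eventually_inf_principal.2 (Eventually.of_forall fun z hz => ?_)
      have hz1 : 0 < z.re := hz.1
      have hz2 : 0 < z.im := hz.2
      rw [norm_mul, hn, Real.norm_of_nonneg (Real.exp_pos _).le, Real.rpow_one]
      refine (mul_le_mul_of_nonneg_right (h1 z hz1.le hz2.le) (Real.exp_pos _).le).trans ?_
      rw [mul_assoc, ← Real.exp_add]
      refine mul_le_mul_of_nonneg_left (Real.exp_le_exp.2 ?_) hC
      have : β * z.re ≤ |β| * ‖z‖ := mul_le_mul (le_abs_self β) ((le_abs_self _).trans (Complex.abs_re_le_norm z)) hz1.le (abs_nonneg _)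
      linarith
    · intro x hx
      rw [norm_mul, hn]
      refine (mul_le_mul_of_nonneg_right (h3 x hx) (Real.exp_pos _).le).trans ?_
      rw [mul_assoc, ← Real.exp_add]; simp
    · intro x hx
      rw [norm_mul, hn]
      refine (mul_le_mul_of_nonneg_right (h1 (x * I) (by simp) (by simpa using hx)) (Real.exp_pos _).le).trans ?_
      rw [mul_assoc, ← Real.exp_add]; simp
  rw [norm_mul, hn] at key
  have := mul_le_mul_of_nonneg_right key (Real.exp_pos (-β * w.re + T * w.im)).le
  rw [mul_assoc, ← Real.exp_add] at this
  have e : β * w.re - T * w.im + (-β * w.re + T * w.im) = 0 := by ring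
  rwa [e, Real.exp_zero, mul_one] at this

lemma PL_ray (Φ : ℂ → ℂ) (hΦ : Differentiable ℂ Φ) (C T b β : ℝ) (hC : 0 ≤ C)
    (h1 : ∀ w : ℂ, 0 ≤ w.re → 0 ≤ w.im → ‖Φ w‖ ≤ C * Real.exp (-β * w.re + T * w.im))
    (h2 : ∀ w : ℂ, w.re ≤ 0 → 0 ≤ w.im → ‖Φ w‖ ≤ C * Real.exp (-b * w.re + T * w.im))
    (e : ℝ) (he : 0 < e) (he' : e < Real.pi / 2) (y : ℝ) (hy : 0 < y) :
    ‖Φ (y * I)‖ ≤ C * Real.exp ((T - (β - b)/2 * (Real.cos e / Real.sin e)) * y) := by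
  set lam : ℝ := T - (β - b)/2 * (Real.cos e / Real.sin e) with hlam
  set c : ℝ := (β + b)/2 with hc
  have hs : 0 < Real.sin e := Real.sin_pos_of_pos_of_lt_pi he (by linarith [Real.pi_pos])
  have hco : 0 < Real.cos e := Real.cos_pos_of_mem_Ioo ⟨by linarith, he'⟩
  have hls : lam * Real.sin e = T * Real.sin e - (β-b)/2 * Real.cos e := by
    rw [hlam]; field_simp
  have hn : ∀ w : ℂ, ‖cexp ((c + lam * I) * w)‖ = Real.exp (c * w.re - lam * w.im) := by
    intro w
    rw [Complex.norm_exp]; congr 1; simp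
  set z0 : ℂ := Real.log y + (Real.pi/2 : ℝ) * I with hz0
  have hez0 : cexp z0 = y * I := by
    rw [hz0, Complex.exp_add, ← Complex.ofReal_exp, Real.exp_log hy]
    congr 1
    push_cast
    exact Complex.exp_pi_div_two_mul_I
  have key : ‖Φ (cexp z0) * cexp ((c + lam * I) * cexp z0)‖ ≤ C := by
    refine PhragmenLindelof.horizontal_strip (f := fun z => Φ (cexp z) * cexp ((c + lam * I) * cexp z))
      (a := e) (b := Real.pi - e) ?_ ?_ ?_ ?_ ?_ ?_
    · refine Differentiable.diffContOnCl ?_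
      exact (hΦ.comp Complex.differentiable_exp).mul (by fun_prop)
    · refine ⟨1, ?_, |β| + |b| + |T| + |c| + |lam|, ?_⟩
      · rw [lt_div_iff₀ (by linarith)]; linarith
      · refine Asymptotics.IsBigO.of_bound C ?_
        refine eventually_inf_principal.2 (Eventually.of_forall fun z hz => ?_)
        have hz1 : e < z.im := hz.1
        have hz2 : z.im < Real.pi - e := hz.2
        have him : 0 ≤ (cexp z).im := by
          rw [Complex.exp_im]
          exact mul_nonneg (Real.exp_pos _).le (Real.sin_nonneg_of_nonneg_of_le_pi (by linarith) (by linarith))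
        have hnz : ‖cexp z‖ ≤ Real.exp |z.re| := by
          rw [Complex.norm_exp]; exact Real.exp_le_exp.2 (le_abs_self _)
        set w := cexp z
        have hre := (Complex.abs_re_le_norm w).trans hnz
        have him2 := (Complex.abs_im_le_norm w).trans hnz
        have hx : ∀ r u : ℝ, |u| ≤ Real.exp |z.re| → r * u ≤ |r| * Real.exp |z.re| := fun r u hu => by
          refine (le_abs_self _).trans ?_
          rw [abs_mul]
          exact mul_le_mul_of_nonneg_left hu (abs_nonneg _)
        have hr0 : 0 ≤ Real.exp |z.re| := (Real.exp_pos _).le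
        rw [norm_mul, hn, Real.norm_of_nonneg (Real.exp_pos _).le, one_mul]
        have hw : ‖Φ w‖ ≤ C * Real.exp ((|β| + |b| + |T|) * Real.exp |z.re|) := by
          have hT := hx T _ him2
          rcases le_total 0 w.re with h | h
          · refine (h1 w h him).trans (mul_le_mul_of_nonneg_left (Real.exp_le_exp.2 ?_) hC)
            have := hx (-β) _ hre
            rw [abs_neg] at this
            have := mul_nonneg (abs_nonneg b) hr0
            linarith
          · refine (h2 w h him).trans (mul_le_mul_of_nonneg_left (Real.exp_le_exp.2 ?_) hC)
            have := hx (-b) _ hre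
            rw [abs_neg] at this
            have := mul_nonneg (abs_nonneg β) hr0
            linarith
        refine (mul_le_mul_of_nonneg_right hw (Real.exp_pos _).le).trans ?_
        rw [mul_assoc, ← Real.exp_add]
        refine mul_le_mul_of_nonneg_left (Real.exp_le_exp.2 ?_) hC
        have := hx c _ hre
        have h5 := hx (-lam) _ him2
        rw [abs_neg] at h5
        linarith
    · intro z hz
      have h0 := Real.exp_pos z.re
      have hre : (cexp z).re = Real.exp z.re * Real.cos e := by rw [Complex.exp_re, hz]
      have him : (cexp z).im = Real.exp z.re * Real.sin e := by rw [Complex.exp_im, hz]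
      rw [norm_mul, hn]
      refine (mul_le_mul_of_nonneg_right (h1 _ (by rw [hre]; positivity) (by rw [him]; positivity)) (Real.exp_pos _).le).trans ?_
      rw [mul_assoc, ← Real.exp_add, hre, him]
      have : -β * (Real.exp z.re * Real.cos e) + T * (Real.exp z.re * Real.sin e) +
        (c * (Real.exp z.re * Real.cos e) - lam * (Real.exp z.re * Real.sin e)) = 0 := by
        rw [hc]; linear_combination (-Real.exp z.re) * hls
      rw [this]; simp
    · intro z hz
      have h0 := Real.exp_pos z.re
      have hre : (cexp z).re = - (Real.exp z.re * Real.cos e) := by rw [Complex.exp_re, hz, Real.cos_pi_sub]; ring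
      have him : (cexp z).im = Real.exp z.re * Real.sin e := by rw [Complex.exp_im, hz, Real.sin_pi_sub]
      rw [norm_mul, hn]
      refine (mul_le_mul_of_nonneg_right (h2 _ (by rw [hre]; exact neg_nonpos.2 (by positivity)) (by rw [him]; positivity)) (Real.exp_pos _).le).trans ?_
      rw [mul_assoc, ← Real.exp_add, hre, him]
      have : -b * (-(Real.exp z.re * Real.cos e)) + T * (Real.exp z.re * Real.sin e) +
        (c * (-(Real.exp z.re * Real.cos e)) - lam * (Real.exp z.re * Real.sin e)) = 0 := by
        rw [hc]; linear_combination (-Real.exp z.re) * hls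
      rw [this]; simp
    · simp [hz0]; linarith
    · simp [hz0]; linarith
  rw [hez0, norm_mul, hn] at key
  have := mul_le_mul_of_nonneg_right key (Real.exp_pos (lam * y)).le
  rw [mul_assoc, ← Real.exp_add] at this
  simpa using this

lemma PLzero (Φ : ℂ → ℂ) (hΦ : Differentiable ℂ Φ) (C T b β : ℝ) (hb : b < β) (hT : 0 ≤ T) (hC : 0 ≤ C)
    (h1 : ∀ w : ℂ, 0 ≤ w.re → 0 ≤ w.im → ‖Φ w‖ ≤ C * Real.exp (T * w.im))
    (h2 : ∀ w : ℂ, w.re ≤ 0 → 0 ≤ w.im → ‖Φ w‖ ≤ C * Real.exp (-b * w.re + T * w.im))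
    (h3 : ∀ x : ℝ, 0 ≤ x → ‖Φ x‖ ≤ C * Real.exp (-β * x)) (w : ℂ) : Φ w = 0 := by
  have hq := PL_quad Φ hΦ C T β hT hC h1 h3
  have hy0 : ∀ y : ℝ, 0 < y → Φ (y * I) = 0 := by
    intro y hy
    rw [← norm_le_zero_iff]
    have hlim : Tendsto (fun e : ℝ => C * Real.exp ((T - (β - b)/2 * (Real.cos e / Real.sin e)) * y)) (nhdsWithin 0 (Set.Ioi 0)) (nhds (C * 0)) := by
      refine Tendsto.const_mul _ (Real.tendsto_exp_atBot.comp ?_)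
      refine Tendsto.atBot_mul_const hy ?_
      simp_rw [sub_eq_add_neg T]
      refine tendsto_const_nhds.add_atBot ?_
      refine tendsto_neg_atTop_atBot.comp ?_
      refine Tendsto.const_mul_atTop (by linarith) ?_
      have hs : Tendsto Real.sin (nhdsWithin 0 (Set.Ioi 0)) (nhdsWithin 0 (Set.Ioi 0)) := by
        refine tendsto_nhdsWithin_iff.2 ⟨?_, ?_⟩
        · have := Real.continuous_sin.tendsto 0
          rw [Real.sin_zero] at this
          exact this.mono_left nhdsWithin_le_nhds
        · filter_upwards [Ioo_mem_nhdsGT Real.pi_pos] with x hx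
          exact Real.sin_pos_of_pos_of_lt_pi hx.1 hx.2
      have hc : Tendsto Real.cos (nhdsWithin 0 (Set.Ioi 0)) (nhds 1) := by
        have := Real.continuous_cos.tendsto 0
        rw [Real.cos_zero] at this
        exact this.mono_left nhdsWithin_le_nhds
      have := hc.pos_mul_atTop one_pos (tendsto_inv_nhdsGT_zero.comp hs)
      simpa [div_eq_mul_inv] using this
    rw [mul_zero] at hlim
    refine ge_of_tendsto hlim ?_
    filter_upwards [Ioo_mem_nhdsGT (half_pos Real.pi_pos)] with e he
    exact PL_ray Φ hΦ C T b β hC hq h2 e he.1 he.2 y hy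
  have hA : AnalyticOnNhd ℂ Φ Set.univ := fun z _ => hΦ.analyticAt z
  have hfr : ∃ᶠ z in nhdsWithin I {I}ᶜ, Φ z = 0 := by
    have ht : Tendsto (fun y : ℝ => (y:ℂ) * I) (nhdsWithin 1 (Set.Ioi 1)) (nhdsWithin I {I}ᶜ) := by
      refine tendsto_nhdsWithin_iff.2 ⟨?_, ?_⟩
      · have : Continuous fun y : ℝ => (y:ℂ) * I := by fun_prop
        have := this.tendsto 1
        simp only [ofReal_one, one_mul] at this
        exact this.mono_left nhdsWithin_le_nhds
      · filter_upwards [self_mem_nhdsWithin] with y hy h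
        have := congrArg Complex.im h
        simp at this
        rw [this] at hy; exact lt_irrefl _ (Set.mem_Ioi.1 hy)
    refine ht.frequently (Eventually.frequently ?_)
    filter_upwards [self_mem_nhdsWithin] with y hy
    exact hy0 y (lt_trans one_pos hy)
  exact hA.eqOn_zero_of_preconnected_of_frequently_eq_zero isPreconnected_univ (Set.mem_univ I) hfr (Set.mem_univ w)

lemma ev_lin (a b : ℝ) (c : ℝ) (hc : 1 < c) : ∀ᶠ k : ℕ in atTop, a * k + b ≤ c^k := by
  have h1 : Tendsto (fun k : ℕ => (a * k + b) * (c⁻¹)^k) atTop (nhds 0) := by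
    have t1 := tendsto_self_mul_const_pow_of_lt_one (r := c⁻¹) (by positivity) (inv_lt_one_of_one_lt₀ hc)
    have t2 := tendsto_pow_atTop_nhds_zero_of_lt_one (r := c⁻¹) (by positivity) (inv_lt_one_of_one_lt₀ hc)
    have := (t1.const_mul a).add (t2.const_mul b)
    simp only [mul_zero, add_zero] at this
    refine this.congr fun k => by ring
  filter_upwards [h1.eventually_le_const (zero_lt_one)] with k hk
  rw [inv_pow, ← div_eq_mul_inv, div_le_one (by positivity)] at hk
  exact hk

def blk (k : ℕ) : Finset ℕ := (Finset.Ioc (4^k) (4^(k+1))).filter Nat.Prime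

lemma primes_block : ∀ᶠ k : ℕ in atTop, (4:ℝ)^k ≤ (blk k).card * ((k+1) * Real.log 4) := by
  filter_upwards [ev_lin 64 128 2 (by norm_num)] with k hk
  have hth : ∀ k : ℕ, Chebyshev.theta ((4^k : ℕ):ℝ) = ∑ p ∈ (Finset.Ioc 0 (4^k)).filter Nat.Prime, Real.log p := by
    intro k; rw [Chebyshev.theta, Nat.floor_natCast]
  have h1 := Chebyshev.theta_ge (4^(k+1))
  have h2 := Chebyshev.theta_le_log4_mul_x (x := ((4^k : ℕ):ℝ)) (by positivity)
  have hsplit : Chebyshev.theta ((4^(k+1) : ℕ):ℝ) = Chebyshev.theta ((4^k : ℕ):ℝ) + ∑ p ∈ blk k, Real.log p := by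
    rw [hth, hth, blk, Finset.sum_filter, Finset.sum_filter, Finset.sum_filter,
      Finset.sum_Ioc_consecutive _ (Nat.zero_le _) (Nat.pow_le_pow_right (by norm_num) (by omega))]
  have hB : ∑ p ∈ blk k, Real.log p ≤ (blk k).card * ((k+1) * Real.log 4) := by
    rw [← nsmul_eq_mul]
    refine Finset.sum_le_card_nsmul _ _ _ fun p hp => ?_
    simp only [blk, Finset.mem_filter, Finset.mem_Ioc] at hp
    have : Real.log p ≤ Real.log ((4:ℝ)^(k+1)) := Real.log_le_log (by exact_mod_cast hp.2.pos) (by exact_mod_cast hp.1.2)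
    rw [Real.log_pow] at this
    push_cast at this; exact this
  have l4 : Real.log 4 = 2 * Real.log 2 := by
    rw [show (4:ℝ) = 2^2 by norm_num, Real.log_pow]; norm_num
  have l2 := Real.log_two_gt_d9
  have l2' := Real.log_two_lt_d9
  have hs : √((4^(k+1) : ℕ):ℝ) = 2^(k+1) := by
    rw [show ((4^(k+1) : ℕ):ℝ) = (2^(k+1))^2 by push_cast; rw [← pow_mul, mul_comm, pow_mul]; norm_num]
    exact Real.sqrt_sq (by positivity)
  have hl : Real.log (((4^(k+1) : ℕ):ℝ) + 1) ≤ (k+2) * Real.log 4 := by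
    have : Real.log (((4^(k+1) : ℕ):ℝ) + 1) ≤ Real.log ((4:ℝ)^(k+2)) := by
      refine Real.log_le_log (by positivity) ?_
      push_cast
      have : (1:ℝ) ≤ 4^k := one_le_pow₀ (by norm_num)
      rw [pow_succ, pow_add]; nlinarith
    rw [Real.log_pow] at this
    exact_mod_cast this
  have hl' : Real.log ((4^(k+1) : ℕ):ℝ) = (k+1) * Real.log 4 := by
    push_cast; rw [Real.log_pow]; push_cast; ring
  rw [hs, hl'] at h1
  have e4 : (4:ℝ)^k = 2^k * 2^k := by rw [← mul_pow]; norm_num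
  push_cast at h1 h2 hsplit
  rw [pow_succ (4:ℝ), pow_succ (2:ℝ), l4] at h1
  rw [pow_succ (4:ℝ)] at hsplit
  rw [l4] at h2 hl
  have g1 : (1:ℝ) ≤ 2^k := one_le_pow₀ (by norm_num)
  have e5 : (64 * (k:ℝ) + 128) * 2^k ≤ 4^k := by rw [e4]; exact mul_le_mul_of_nonneg_right hk (by positivity)
  have hk0 : (0:ℝ) ≤ k := Nat.cast_nonneg k
  push_cast at hl
  rw [pow_succ (4:ℝ)] at hl
  have h6 : ((k:ℝ)+2) * (2 * Real.log 2) ≤ (2*k+4) * 2^k := by nlinarith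
  have h7 : 2 * ((2:ℝ)^k * 2) * ((k+1) * (2 * Real.log 2)) ≤ (8 * k + 8) * 2^k := by
    have : (0:ℝ) ≤ 2^k * (k+1) := by positivity
    nlinarith
  have h8 : (4:ℝ)^k * 4 * Real.log 2 - 2 * Real.log 2 * 4^k ≥ 1.38 * 4^k := by nlinarith [pow_pos (by norm_num : (0:ℝ)<4) k]
  have h9 : (10 * (k:ℝ) + 12) * 2^k * 5 ≤ 4^k := by nlinarith
  have : (10 * (k:ℝ) + 12) * 2^k = (2*k+4) * 2^k + (8 * k + 8) * 2^k := by ring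
  clear hk hth hs hl' e4 e5
  generalize Chebyshev.theta ((4:ℝ)^k * 4) = t1 at *
  generalize Chebyshev.theta ((4:ℝ)^k) = t2 at *
  generalize Real.log ((4:ℝ)^k * 4 + 1) = t3 at *
  generalize 2 * ((2:ℝ)^k * 2) * ((k+1) * (2 * Real.log 2)) = t4 at *
  have hA : (0:ℝ) < 4^k := by positivity
  generalize (4:ℝ)^k = A at *
  refine le_trans ?_ hB
  generalize (10 * (k:ℝ) + 12) * 2^k = t5 at *
  generalize (2 * (k:ℝ) + 4) * 2^k = t6 at *
  generalize (8 * (k:ℝ) + 8) * 2^k = t7 at *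
  have : 1.38 * A - 0.2 * A ≥ A := by nlinarith
  linarith

lemma fin_mono {n : ℕ} (e : Fin n ↪o ℕ) (a b : ℕ) (hb : a + b < n) : e ⟨a, by omega⟩ + b ≤ e ⟨a+b, hb⟩ := by
  induction b with
  | zero => simp
  | succ b ih =>
    have := ih (by omega)
    have h2 : e ⟨a+b, by omega⟩ < e ⟨a+(b+1), hb⟩ := e.strictMono (by rw [Fin.lt_def]; simp)
    omega

lemma good_pts (φ : ℝ → ℝ) (hφ : ∀ x, 0 ≤ φ x) (Q : Finset ℕ) (M : ℝ) (hM0 : 0 < M)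
    (hM : ∀ F : Finset ℕ, (∀ p ∈ F, p.Prime ∧ p ∉ Q) → ∑ p ∈ F, φ (Real.log p) ≤ M) (m : ℕ) (hm : 1 ≤ m) :
    ∀ᶠ k : ℕ in atTop, ∃ x : ℕ → ℝ, (∀ j < m, x j ∈ Set.Icc (k * Real.log 4) ((k+1) * Real.log 4) ∧
      φ (x j) ≤ 2 * M * ((k+1) * Real.log 4) / 4^k) ∧
      ∀ i < m, ∀ j < m, i ≠ j → 1 / (16 * m * ((k+1) * Real.log 4)) ≤ |x i - x j| := by
  have hB : 0 < Real.log 4 := Real.log_pos (by norm_num)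
  filter_upwards [primes_block, ev_lin (2 * m * Real.log 4) (2 * m * Real.log 4) 4 (by norm_num),
    ev_lin 0 (Q.sup id : ℕ) 4 (by norm_num)] with k h1 h2 h3
  classical
  have hk1 : 0 < ((k:ℝ)+1) * Real.log 4 := by positivity
  set q : ℝ := ((k:ℝ)+1) * Real.log 4 with hq
  have h4 : (0:ℝ) < 4^k := by positivity
  set μ : ℝ := 2 * M * q / 4^k with hμ
  have hμ0 : 0 < μ := by positivity
  set G := (blk k).filter (fun p : ℕ => φ (Real.log p) ≤ μ) with hG
  set Bd := (blk k).filter (fun p : ℕ => ¬ φ (Real.log p) ≤ μ) with hBd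
  have hcard : G.card + Bd.card = (blk k).card := by
    rw [hG, hBd]; exact Finset.card_filter_add_card_filter_not _
  have hQ : ∀ p ∈ blk k, p.Prime ∧ p ∉ Q := by
    intro p hp
    simp only [blk, Finset.mem_filter, Finset.mem_Ioc] at hp
    refine ⟨hp.2, fun hpQ => ?_⟩
    have : p ≤ Q.sup id := Finset.le_sup (f := id) hpQ
    have h5 : ((Q.sup id : ℕ):ℝ) ≤ ((4^k : ℕ):ℝ) := by push_cast; linarith
    have := Nat.cast_le.1 h5
    omega
  have hbad : (Bd.card : ℝ) * μ ≤ M := by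
    refine le_trans ?_ (hM Bd fun p hp => hQ p (Finset.mem_filter.1 hp).1)
    rw [← nsmul_eq_mul]
    exact Finset.card_nsmul_le_sum _ _ _ fun p hp => (not_le.1 (Finset.mem_filter.1 hp).2).le
  set y : ℝ := 4^k / (2 * q) with hy
  have hy0 : 0 < y := by positivity
  have hbad' : (Bd.card : ℝ) ≤ y := by
    have : (Bd.card:ℝ) ≤ M / μ := by rw [le_div_iff₀ hμ0]; exact hbad
    refine this.trans (le_of_eq ?_)
    rw [hμ, hy]; field_simp
  have hgood : y ≤ G.card := by
    have : (G.card : ℝ) + Bd.card = (blk k).card := by exact_mod_cast hcard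
    have h5 : 2 * y ≤ (blk k).card := by
      rw [show 2 * y = 4^k / q by rw [hy]; field_simp, div_le_iff₀ hk1]; exact h1
    linarith
  have hm0 : (0:ℝ) < m := by exact_mod_cast hm
  set L := ⌊y / m⌋₊ with hL
  have hym : 1 ≤ y / m := by
    rw [le_div_iff₀ hm0, hy, le_div_iff₀ (by positivity)]
    rw [hq]; linarith
  have hL1 : 1 ≤ L := Nat.le_floor (by simpa using hym)
  have hLy : y / (2 * m) ≤ L := by
    have := Nat.lt_floor_add_one (y / m)
    rw [← hL] at this
    have h6 : y / (2 * m) = y / m / 2 := by rw [mul_comm, ← div_div]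
    have h7 : (1:ℝ) ≤ L := by exact_mod_cast hL1
    rw [h6]; linarith
  have hLm : m * L ≤ G.card := by
    have : (L:ℝ) ≤ y / m := Nat.floor_le (by positivity)
    rw [le_div_iff₀ hm0] at this
    have : ((m * L : ℕ):ℝ) ≤ G.card := by push_cast; linarith
    exact_mod_cast this
  have hlt : ∀ j, j < m → j * L < G.card := fun j hj => by
    have : (j+1) * L ≤ m * L := Nat.mul_le_mul_right _ hj
    nlinarith
  set e := G.orderEmbOfFin rfl with he
  have heG : ∀ i, e i ∈ G := fun i => Finset.orderEmbOfFin_mem G rfl i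
  have heb : ∀ i, 4^k < e i ∧ e i ≤ 4^(k+1) := fun i => by
    have := (Finset.mem_filter.1 (heG i)).1
    simp only [blk, Finset.mem_filter, Finset.mem_Ioc] at this
    exact this.1
  refine ⟨fun j => if h : j < m then Real.log (e ⟨j * L, hlt j h⟩) else 0, ?_, ?_⟩
  · intro j hj
    simp only [hj, dif_pos]
    have hb := heb ⟨j * L, hlt j hj⟩
    refine ⟨⟨?_, ?_⟩, (Finset.mem_filter.1 (heG _)).2⟩
    · rw [← Real.log_pow]
      exact Real.log_le_log h4 (by exact_mod_cast hb.1.le)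
    · have : Real.log (e ⟨j * L, hlt j hj⟩) ≤ Real.log ((4:ℝ)^(k+1)) :=
        Real.log_le_log (by have := hb.1; exact_mod_cast (Nat.pos_of_ne_zero (by omega))) (by exact_mod_cast hb.2)
      rw [Real.log_pow] at this
      push_cast at this; exact this
  · have key : ∀ i < m, ∀ j, (hj : j < m) → (hij : i < j) → 1 / (16 * m * q) ≤ Real.log (e ⟨j * L, hlt j hj⟩) -
        Real.log (e ⟨i * L, hlt i (hij.trans hj)⟩) := by
      intro i hi j hj hij
      obtain ⟨d, rfl⟩ := Nat.exists_eq_add_of_lt hij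
      have h5 := fin_mono e (i * L) ((d+1) * L) (by have := hlt _ hj; nlinarith)
      have e1 : (⟨i * L + (d+1) * L, by have := hlt _ hj; nlinarith⟩ : Fin G.card) = ⟨(i+d+1)*L, hlt _ hj⟩ := by
        ext; simp only; ring
      rw [e1] at h5
      set p := e ⟨i * L, hlt i hi⟩ with hp
      set r := e ⟨(i+d+1)*L, hlt _ hj⟩ with hr
      have hpp : 0 < p := by exact lt_of_le_of_lt (Nat.zero_le _) (heb ⟨i * L, hlt i hi⟩).1
      have hr4 : r ≤ 4^(k+1) := (heb _).2
      have hpr : p + L ≤ r := by nlinarith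
      have hp0 : (0:ℝ) < p := by exact_mod_cast hpp
      have hr0 : (0:ℝ) < r := by exact_mod_cast (by omega : 0 < r)
      rw [← Real.log_div hr0.ne' hp0.ne']
      refine le_trans ?_ (Real.one_sub_inv_le_log_of_pos (by positivity))
      rw [inv_div]
      have h8 : (p:ℝ) + L ≤ r := by exact_mod_cast hpr
      have h9 : (r:ℝ) ≤ 4^(k+1) := by exact_mod_cast hr4
      calc 1 / (16 * m * q) = y / (2 * m) / 4^(k+1) := by rw [hy, pow_succ]; field_simp; norm_num
        _ ≤ L / 4^(k+1) := by gcongr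
        _ ≤ L / r := by gcongr
        _ ≤ 1 - p / r := by rw [le_sub_iff_add_le, ← add_div, div_le_one hr0]; linarith
    intro i hi j hj hij
    simp only [hi, hj, dif_pos]
    rcases lt_or_gt_of_ne hij with h | h
    · rw [abs_sub_comm]; exact (key i hi j hj h).trans (le_abs_self _)
    · exact (key j hj i hi h).trans (le_abs_self _)

lemma prod_fact (A : ℝ) (n : ℕ) : ∏ x ∈ Finset.range n, A / ((x:ℝ)+1) = A^n / n.factorial := by
  induction n with
  | zero => simp
  | succ n ih => rw [Finset.prod_range_succ, ih, Nat.factorial_succ]; push_cast; rw [pow_succ]; field_simp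

lemma lag_prod (K m : ℕ) (hK : 1 ≤ K) (z : ℕ → ℕ → ℝ) (t δ B : ℝ) (hδ : 0 < δ) (hB : 0 < B) (hδ2 : δ ≤ 2*K*B)
    (h1 : ∀ i < K, ∀ j < m, |t - z i j| ≤ 2*K*B)
    (h2 : ∀ i < K, ∀ i' < K, ∀ j < m, ∀ j' < m, i ≠ i' → |(i:ℝ)-i'| * B ≤ |z i j - z i' j'|)
    (h3 : ∀ i < K, ∀ j < m, ∀ j' < m, j ≠ j' → δ ≤ |z i j - z i j'|) (i j : ℕ) (hi : i < K) (hj : j < m) :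
    ∏ p ∈ ((Finset.range K) ×ˢ (Finset.range m)).erase (i,j), (|t - z p.1 p.2| / |z i j - z p.1 p.2|)
      ≤ ((2*K*B/δ) * Real.exp (4*K))^m := by
  classical
  have hK0 : (1:ℝ) ≤ K := by exact_mod_cast hK
  set g : ℕ → ℝ := fun i' => if i' = i then 2*K*B/δ else 2*K/|(i:ℝ)-i'| with hg
  have hpos : ∀ i', i' ≠ i → 1 ≤ |(i:ℝ)-i'| := by
    intro i' h
    have : (1:ℤ) ≤ |(i:ℤ) - i'| := Int.one_le_abs (by omega)
    exact_mod_cast this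
  have hg1 : ∀ i' < K, 1 ≤ g i' := by
    intro i' hi'
    simp only [hg]
    split_ifs with h
    · rw [le_div_iff₀ hδ]; linarith
    · rw [le_div_iff₀ (by linarith [hpos i' h])]
      have a1 : (i:ℝ) ≤ K := by exact_mod_cast hi.le
      have a2 : (i':ℝ) ≤ K := by exact_mod_cast hi'.le
      have a3 : (0:ℝ) ≤ i := by positivity
      have a4 : (0:ℝ) ≤ i' := by positivity
      rw [one_mul]
      exact abs_le.2 ⟨by linarith, by linarith⟩
  calc _ ≤ ∏ p ∈ ((Finset.range K) ×ˢ (Finset.range m)).erase (i,j), g p.1 := by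
        refine Finset.prod_le_prod (fun _ _ => by positivity) ?_
        rintro ⟨i', j'⟩ hp
        simp only [Finset.mem_erase, Finset.mem_product, Finset.mem_range, ne_eq, Prod.mk.injEq] at hp
        obtain ⟨hne, hi', hj'⟩ := hp
        simp only [hg]
        split_ifs with h
        · subst h
          have : j ≠ j' := fun h => hne ⟨rfl, h.symm⟩
          exact div_le_div₀ (by positivity) (h1 _ hi' _ hj') hδ (h3 _ hi' _ hj _ hj' this)
        · have q := h2 i hi i' hi' j hj j' hj' (Ne.symm h)
          have q1 := hpos i' h
          calc |t - z i' j'| / |z i j - z i' j'| ≤ 2*K*B / (|(i:ℝ)-i'| * B) :=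
                div_le_div₀ (by positivity) (h1 _ hi' _ hj') (by positivity) q
            _ = _ := by field_simp
    _ ≤ ∏ p ∈ ((Finset.range K) ×ˢ (Finset.range m)), g p.1 := by
        refine Finset.prod_le_prod_of_subset_of_one_le (Finset.erase_subset _ _) ?_ ?_
        · intro p hp
          have := (Finset.mem_product.1 (Finset.mem_erase.1 hp).2).1
          exact zero_le_one.trans (hg1 _ (Finset.mem_range.1 this))
        · intro p hp _
          exact hg1 _ (Finset.mem_range.1 (Finset.mem_product.1 hp).1)
    _ = (∏ i' ∈ Finset.range K, g i')^m := by
        rw [Finset.prod_product]; simp [Finset.prod_pow]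
    _ ≤ _ := by
        obtain ⟨r, rfl⟩ := Nat.exists_eq_add_of_lt hi
        refine pow_le_pow_left₀ (Finset.prod_nonneg fun i' h => zero_le_one.trans (hg1 i' (Finset.mem_range.1 h))) ?_ m
        set KK : ℝ := ((i + r + 1 : ℕ):ℝ) with hKK
        rw [show i + r + 1 = (i+1) + r by ring, Finset.prod_range_add, Finset.prod_range_succ]
        have e1 : ∏ x ∈ Finset.range i, g x = (2*KK)^i / i.factorial := by
          rw [← prod_fact, ← Finset.prod_range_reflect]
          refine Finset.prod_congr rfl fun x hx => ?_
          have hx := Finset.mem_range.1 hx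
          simp only [hg, if_neg (by omega : ¬ (i - 1 - x = i))]
          congr 1
          have : ((i - 1 - x : ℕ):ℝ) = i - 1 - x := by
            rw [Nat.cast_sub (by omega), Nat.cast_sub (by omega)]; simp
          rw [this, abs_of_nonneg (by linarith [(Nat.cast_nonneg x : (0:ℝ) ≤ x)])]; ring
        have e2 : ∏ x ∈ Finset.range r, g (i+1+x) = (2*KK)^r / r.factorial := by
          rw [← prod_fact]
          refine Finset.prod_congr rfl fun x hx => ?_
          simp only [hg, if_neg (by omega : ¬ (i + 1 + x = i))]
          congr 1
          push_cast
          rw [abs_sub_comm, abs_of_nonneg (by linarith [(Nat.cast_nonneg x : (0:ℝ) ≤ x)])]; ring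
        have e3 : g i = 2*KK*B/δ := by simp [hg]
        rw [e1, e2, e3]
        have f1 := Real.pow_div_factorial_le_exp (2*KK) (by linarith) i
        have f2 := Real.pow_div_factorial_le_exp (2*KK) (by linarith) r
        calc _ = (2*KK*B/δ) * ((2*KK)^i / i.factorial * ((2*KK)^r / r.factorial)) := by ring
          _ ≤ (2*KK*B/δ) * (Real.exp (2*KK) * Real.exp (2*KK)) := by
              refine mul_le_mul_of_nonneg_left (mul_le_mul f1 f2 (by positivity) (by positivity)) (by positivity)
          _ = _ := by rw [← Real.exp_add]; congr 2; ring

lemma lag_bound (f : ℕ → ℝ → ℝ) (hf : ∀ j x, HasDerivAt (f j) (f (j+1) x) x) (C R a b : ℝ)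
    (K m : ℕ) (hK : 1 ≤ K) (z : ℕ → ℕ → ℝ) (t δ B E : ℝ) (hδ : 0 < δ) (hB : 0 < B) (hδ2 : δ ≤ 2*K*B)
    (hC : ∀ x ∈ Set.Icc a b, |f (K*m) x| ≤ C * R^(K*m)) (hC0 : 0 ≤ C) (hR : 0 ≤ R)
    (ht : t ∈ Set.Icc a b) (hz : ∀ i < K, ∀ j < m, z i j ∈ Set.Icc a b)
    (h1 : ∀ i < K, ∀ j < m, |t - z i j| ≤ 2*K*B)
    (h2 : ∀ i < K, ∀ i' < K, ∀ j < m, ∀ j' < m, i ≠ i' → |(i:ℝ)-i'| * B ≤ |z i j - z i' j'|)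
    (h3 : ∀ i < K, ∀ j < m, ∀ j' < m, j ≠ j' → δ ≤ |z i j - z i j'|)
    (hE : ∀ i < K, ∀ j < m, |f 0 (z i j)| ≤ E) :
    |f 0 t| ≤ (K*m) * (E * ((2*K*B/δ) * Real.exp (4*K))^m) +
      C * ((R*(2*K*B))^(K*m) / (K*m).factorial) := by
  classical
  set S := (Finset.range K) ×ˢ (Finset.range m) with hS
  have hmem : ∀ p ∈ S, p.1 < K ∧ p.2 < m := fun p hp => by
    simpa [hS] using hp
  have hinj : Set.InjOn (fun p : ℕ × ℕ => z p.1 p.2) S := by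
    rintro ⟨i, j⟩ hp ⟨i', j'⟩ hp' h
    obtain ⟨a1, a2⟩ := hmem _ hp
    obtain ⟨b1, b2⟩ := hmem _ hp'
    simp only at h a1 a2 b1 b2
    by_cases hi : i = i'
    · subst hi
      by_cases hj : j = j'
      · rw [hj]
      · have := h3 i a1 j a2 j' b2 hj
        rw [h, sub_self, abs_zero] at this; linarith
    · have := h2 i a1 i' b1 j a2 j' b2 hi
      rw [h, sub_self, abs_zero] at this
      have h5 : 0 < |(i:ℝ) - i'| := abs_pos.2 (sub_ne_zero.2 (by exact_mod_cast hi))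
      nlinarith
  set Z := S.image (fun p : ℕ × ℕ => z p.1 p.2) with hZ
  have hcard : Z.card = K * m := by
    rw [hZ, Finset.card_image_of_injOn hinj]; simp [hS]
  have key := interp_error f hf a b Z (by
    intro x hx
    obtain ⟨p, hp, rfl⟩ := Finset.mem_image.1 hx
    exact hz _ (hmem p hp).1 _ (hmem p hp).2) (C * R^(K*m)) (by rw [hcard]; exact hC) t ht
  rw [hcard] at key
  have k1 : ∏ z ∈ Z, |t - z| ≤ (2*K*B)^(K*m) := by
    rw [← hcard, ← Finset.prod_const]
    refine Finset.prod_le_prod (fun _ _ => abs_nonneg _) ?_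
    intro x hx
    obtain ⟨p, hp, rfl⟩ := Finset.mem_image.1 hx
    exact h1 _ (hmem p hp).1 _ (hmem p hp).2
  have k2 : |∑ x ∈ Z, f 0 x * ∏ w ∈ Z.erase x, (t - w) / (x - w)| ≤
      (K*m) * (E * ((2*K*B/δ) * Real.exp (4*K))^m) := by
    rw [hZ, Finset.sum_image hinj]
    refine (Finset.abs_sum_le_sum_abs _ _).trans ?_
    have : ∀ p ∈ S, |f 0 (z p.1 p.2) * ∏ w ∈ (S.image (fun p : ℕ × ℕ => z p.1 p.2)).erase (z p.1 p.2), (t - w) / (z p.1 p.2 - w)|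
        ≤ E * ((2*K*B/δ) * Real.exp (4*K))^m := by
      rintro ⟨i, j⟩ hp
      obtain ⟨a1, a2⟩ := hmem _ hp
      rw [abs_mul]
      have hEE := hE i a1 j a2
      refine mul_le_mul hEE ?_ (abs_nonneg _) ((abs_nonneg _).trans hEE)
      have e1 : (S.image (fun p : ℕ × ℕ => z p.1 p.2)).erase (z i j) = (S.erase (i,j)).image (fun p : ℕ × ℕ => z p.1 p.2) := by
        ext x
        simp only [Finset.mem_erase, Finset.mem_image]
        constructor
        · rintro ⟨hne, q, hq, rfl⟩
          exact ⟨q, ⟨fun h => hne (by rw [h]), hq⟩, rfl⟩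
        · rintro ⟨q, ⟨hne, hq⟩, rfl⟩
          exact ⟨fun h => hne (hinj hq hp h), q, hq, rfl⟩
      simp only [e1]
      rw [Finset.prod_image (fun x hx y hy h => hinj (Finset.mem_of_mem_erase hx) (Finset.mem_of_mem_erase hy) h), Finset.abs_prod]
      simp only [abs_div]
      exact lag_prod K m hK z t δ B hδ hB hδ2 h1 h2 h3 i j a1 a2
    refine (Finset.sum_le_card_nsmul _ _ _ this).trans (le_of_eq ?_)
    rw [nsmul_eq_mul]; simp [hS]
  have k3 : C * R^(K*m) / (K*m).factorial * ∏ z ∈ Z, |t - z| ≤ C * ((R*(2*K*B))^(K*m) / (K*m).factorial) := by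
    calc _ ≤ C * R^(K*m) / (K*m).factorial * (2*K*B)^(K*m) := mul_le_mul_of_nonneg_left k1 (by positivity)
      _ = _ := by rw [mul_pow]; ring
  have := abs_sub_abs_le_abs_sub (f 0 t) (∑ x ∈ Z, f 0 x * ∏ w ∈ Z.erase x, (t - w) / (x - w))
  linarith

lemma dec1 (M B β ν u : ℝ) (m K : ℕ) (hM : 0 < M) (hB : 0 < B) (hB2 : B ≤ 2) (hm : (2:ℝ) ≤ m) (hu : 0 < u) (hβ : 0 < (1-β)/2)
    (hν : ν = (1-β)/10) (hK : (K:ℝ) * m ≤ ν*u) (hKu : (K:ℝ) * m ≤ u) (hKu' : (K:ℝ) ≤ u) :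
    (K*m:ℝ) * (2*M*(2*u*B)*(16 * Real.exp (-u + K*B)) * ((2*K*B/(1/(16*m*(2*u*B)))) * Real.exp (4*K))^m) ≤
      4*M*B*(64*m*B^2)^m * ((2*m+2).factorial / ((1-β)/2)^(2*m+2)) * 16 * Real.exp (-β*u) := by
  set c := (1-β)/2 with hc
  have h1 : u^(2*m+2) ≤ (2*m+2).factorial / c^(2*m+2) * Real.exp (c*u) := by
    have := Real.pow_div_factorial_le_exp (c*u) (by positivity) (2*m+2)
    rw [div_le_iff₀ (by positivity), mul_pow] at this
    rw [div_mul_eq_mul_div, le_div_iff₀ (by positivity)]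
    linarith
  have h2 : 2*K*B/(1/(16*m*(2*u*B))) ≤ 64*m*B^2*u^2 := by
    rw [div_div_eq_mul_div, div_one]
    have : (K:ℝ) * (64*m*B^2*u) ≤ u * (64*m*B^2*u) := mul_le_mul_of_nonneg_right hKu' (by positivity)
    linarith
  have h3 : ((2*K*B/(1/(16*m*(2*u*B)))) * Real.exp (4*K))^m ≤ (64*m*B^2)^m * u^(2*m) * Real.exp (4*(K*m)) := by
    rw [mul_pow, ← Real.exp_nat_mul, pow_mul, ← mul_pow]
    refine mul_le_mul (pow_le_pow_left₀ (by positivity) h2 m) (le_of_eq (by ring_nf)) (by positivity) (by positivity)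
  have h4 : Real.exp (-u + K*B) * Real.exp (4*(K*m)) ≤ Real.exp (-β*u) * Real.exp (-(c*u)) := by
    rw [← Real.exp_add, ← Real.exp_add]
    refine Real.exp_le_exp.2 ?_
    have : (K:ℝ)*B ≤ K*m := mul_le_mul_of_nonneg_left (by linarith) (by positivity)
    rw [hν] at hK
    rw [hc]; linarith
  calc _ ≤ u * (2*M*(2*u*B)*(16 * Real.exp (-u + K*B)) * ((64*m*B^2)^m * u^(2*m) * Real.exp (4*(K*m)))) := by
        refine mul_le_mul hKu (mul_le_mul_of_nonneg_left h3 (by positivity)) (by positivity) hu.le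
    _ = 4*M*B*16*(64*m*B^2)^m * u^(2*m+2) * (Real.exp (-u + K*B) * Real.exp (4*(K*m))) := by ring
    _ ≤ 4*M*B*16*(64*m*B^2)^m * ((2*m+2).factorial / c^(2*m+2) * Real.exp (c*u)) * (Real.exp (-β*u) * Real.exp (-(c*u))) := by
        refine mul_le_mul (mul_le_mul_of_nonneg_left h1 (by positivity)) h4 (by positivity) (by positivity)
    _ = 4*M*B*(64*m*B^2)^m * ((2*m+2).factorial / c^(2*m+2)) * 16 * Real.exp (-β*u) * (Real.exp (c*u) * Real.exp (-(c*u))) := by ring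
    _ = _ := by rw [← Real.exp_add, add_neg_cancel, Real.exp_zero, mul_one]

lemma dec2 (R B β ν u : ℝ) (m K : ℕ) (hR : 0 < R) (hB : 0 < B) (hm : (2:ℝ) ≤ m) (hu : 0 < u) (hβ : β < 1) (hν : 0 < ν)
    (hK : ν*u < (K+1:ℝ) * m) (h : 2*R*B*Real.exp 1 * Real.exp (1/ν) ≤ m) :
    (R*(2*K*B))^(K*m) / (K*m).factorial ≤ Real.exp (m/ν) * Real.exp (-β*u) := by
  have e1 : R*(2*K*B) = 2*R*B/m * ((K*m:ℕ):ℝ) := by push_cast; field_simp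
  have h1 := Real.pow_div_factorial_le_exp ((K*m:ℕ):ℝ) (by positivity) (K*m)
  have h2 : 2*R*B/m * Real.exp 1 ≤ Real.exp (-(1/ν)) := by
    rw [Real.exp_neg, ← one_div, le_div_iff₀ (by positivity), div_mul_eq_mul_div, div_mul_eq_mul_div, div_le_one (by positivity)]
    exact h
  calc _ = (2*R*B/m)^(K*m) * (((K*m:ℕ):ℝ)^(K*m) / (K*m).factorial) := by rw [e1, mul_pow]; ring
    _ ≤ (2*R*B/m)^(K*m) * Real.exp ((K*m:ℕ):ℝ) := mul_le_mul_of_nonneg_left h1 (by positivity)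
    _ = (2*R*B/m * Real.exp 1)^(K*m) := by rw [mul_pow, ← Real.exp_nat_mul, mul_one]
    _ ≤ (Real.exp (-(1/ν)))^(K*m) := pow_le_pow_left₀ (by positivity) h2 _
    _ = Real.exp (((K*m:ℕ):ℝ) * (-(1/ν))) := by rw [← Real.exp_nat_mul]
    _ ≤ Real.exp (m/ν + -β*u) := by
        refine Real.exp_le_exp.2 ?_
        have : u ≤ (K+1)*m/ν := by rw [le_div_iff₀ hν]; linarith
        have e : ((K*m:ℕ):ℝ) * (-(1/ν)) = m/ν - (K+1)*m/ν := by push_cast; ring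
        rw [e]; nlinarith
    _ = _ := Real.exp_add _ _

set_option maxHeartbeats 1600000 in
lemma decay (f : ℕ → ℝ → ℝ) (hf : ∀ j x, HasDerivAt (f j) (f (j+1) x) x) (C R M β : ℝ) (hC0 : 0 < C) (hR : 0 < R)
    (hM0 : 0 < M) (hβ : β < 1) (hβ0 : 0 < β) (hC : ∀ j x, 0 ≤ x → |f j x| ≤ C * R^j) (Q : Finset ℕ)
    (hM : ∀ F : Finset ℕ, (∀ p ∈ F, p.Prime ∧ p ∉ Q) → ∑ p ∈ F, |f 0 (Real.log p)| ≤ M) :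
    ∃ C', 0 < C' ∧ ∀ u, 0 ≤ u → |f 0 u| ≤ C' * Real.exp (-β*u) := by
  have hB : 0 < Real.log 4 := Real.log_pos (by norm_num)
  have hB1 : Real.log 4 < 2 := by
    rw [show (4:ℝ) = 2^2 by norm_num, Real.log_pow]; have := Real.log_two_lt_d9; push_cast; linarith
  have hB2 : 1 < Real.log 4 := by
    rw [show (4:ℝ) = 2^2 by norm_num, Real.log_pow]; have := Real.log_two_gt_d9; push_cast; linarith
  set B := Real.log 4 with hBdef
  set ν : ℝ := (1-β)/10 with hν
  have hν0 : 0 < ν := by rw [hν]; linarith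
  have hν1 : ν < 1/10 := by rw [hν]; linarith
  obtain ⟨m, hm⟩ : ∃ m : ℕ, 2 ≤ m ∧ 2*R*B*Real.exp 1 * Real.exp (1/ν) ≤ m := by
    obtain ⟨m, hm⟩ := exists_nat_ge (2*R*B*Real.exp 1 * Real.exp (1/ν))
    exact ⟨m+2, by omega, by push_cast; linarith⟩
  obtain ⟨hm2, hm⟩ := hm
  have hm0 : (2:ℝ) ≤ m := by exact_mod_cast hm2
  obtain ⟨k0, hk0⟩ := eventually_atTop.1 (good_pts (fun x => |f 0 x|) (fun _ => abs_nonneg _) Q M hM0 hM m (by omega))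
  set C1 : ℝ := 4*M*B*(64*m*B^2)^m * ((2*m+2).factorial / ((1-β)/2)^(2*m+2)) * 16 with hC1
  have hβ2 : 0 < (1-β)/2 := by linarith
  have hC10 : 0 ≤ C1 := by positivity
  set u0 : ℝ := 4*(k0+4) + m/ν with hu0
  have hu00 : 0 < u0 := by positivity
  have big : ∀ u, u0 ≤ u → |f 0 u| ≤ (C1 + C * Real.exp (m/ν)) * Real.exp (-β*u) := by
    intro u hu
    have hmν : 0 < m/ν := by positivity
    have hu4 : 4*((k0:ℝ)+4) ≤ u := by linarith
    have huu : (16:ℝ) ≤ u := by linarith [(Nat.cast_nonneg k0 : (0:ℝ) ≤ k0)]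
    set K := ⌊ν*u/m⌋₊ with hK
    set n := ⌊u/B⌋₊ with hn
    have hn1 : (n:ℝ) * B ≤ u := by
      rw [← le_div_iff₀ hB]; exact Nat.floor_le (by positivity)
    have hn2 : u < (n+1:ℝ) * B := by
      rw [← div_lt_iff₀ hB]; exact Nat.lt_floor_add_one _
    have hK1 : (K:ℝ) * m ≤ ν*u := by
      rw [← le_div_iff₀ (by positivity)]; exact Nat.floor_le (by positivity)
    have hK2 : ν*u < (K+1:ℝ) * m := by
      rw [← div_lt_iff₀ (by positivity)]; exact Nat.lt_floor_add_one _
    have hK3 : 1 ≤ K := by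
      apply Nat.le_floor
      rw [Nat.cast_one, le_div_iff₀ (by positivity), one_mul]
      rw [mul_comm, ← div_le_iff₀ hν0]; linarith [(Nat.cast_nonneg k0 : (0:ℝ) ≤ k0)]
    have hK3' : (1:ℝ) ≤ K := by exact_mod_cast hK3
    have hνu : ν*u ≤ u/10 := by nlinarith
    have hKu : (K:ℝ) ≤ u/20 := by nlinarith
    have hnu : u/2 - 1 ≤ n := by nlinarith
    have hnk : k0 + K ≤ n := by
      have : ((k0 + K : ℕ):ℝ) ≤ n := by push_cast; linarith
      exact_mod_cast this
    obtain ⟨ks, hks⟩ := Nat.exists_eq_add_of_le (show K ≤ n by omega)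
    have hnR : (n:ℝ) = K + ks := by rw [hks]; push_cast; ring
    have hex : ∀ i : ℕ, ∃ x : ℕ → ℝ, (∀ j < m, x j ∈ Set.Icc (((ks+2*i : ℕ):ℝ) * Real.log 4) ((((ks+2*i:ℕ):ℝ)+1) * Real.log 4) ∧
      |f 0 (x j)| ≤ 2 * M * ((((ks+2*i:ℕ):ℝ)+1) * Real.log 4) / 4^(ks+2*i)) ∧
      ∀ i' < m, ∀ j < m, i' ≠ j → 1 / (16 * m * ((((ks+2*i:ℕ):ℝ)+1) * Real.log 4)) ≤ |x i' - x j| := fun i => hk0 (ks+2*i) (by omega)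
    choose z hz1 hz2 using hex
    have hnle : (n:ℝ) ≤ u := by nlinarith
    have hkm : ∀ i < K, (((ks+2*i:ℕ):ℝ)+1) ≤ 2*u := by
      intro i hi
      have : (i:ℝ) ≤ K := by exact_mod_cast hi.le
      push_cast; linarith
    have hzz : ∀ i < K, ∀ j < m, z i j ∈ Set.Icc (((ks:ℝ)+2*i)*B) (((ks:ℝ)+2*i+1)*B) := by
      intro i hi j hj
      have := (hz1 i j hj).1
      push_cast at this; exact this
    have hiK : ∀ i < K, (i:ℝ) + 1 ≤ K := fun i hi => by exact_mod_cast hi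
    set δ : ℝ := 1/(16*m*(2*u*B)) with hδ
    have hδ0 : 0 < δ := by positivity
    have hδ1 : δ ≤ 1 := by
      rw [hδ, div_le_one (by positivity)]
      have a1 : 1 ≤ u*B := by nlinarith
      have a2 : 1 * 1 ≤ (m:ℝ) * (u*B) := mul_le_mul (by linarith) a1 (by norm_num) (by linarith)
      linarith
    have key := lag_bound f hf C R (ks*B) (((ks:ℝ)+2*K)*B) K m hK3 z u δ B (2*M*(2*u*B)*(16 * Real.exp (-u + K*B)))
      hδ0 hB (by nlinarith) (fun x hx => hC _ _ (le_trans (by positivity) hx.1)) hC0.le hR.le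
      ⟨by nlinarith, by nlinarith⟩
      (fun i hi j hj => by
        have h := hzz i hi j hj
        have := hiK i hi
        exact ⟨le_trans (by nlinarith [(Nat.cast_nonneg i : (0:ℝ) ≤ i)]) h.1, h.2.trans (by nlinarith)⟩)
      (fun i hi j hj => by
        have h := hzz i hi j hj
        have h5 := hiK i hi
        have h6 : (0:ℝ) ≤ i*B := by positivity
        have h7 : ((i:ℝ)+1)*B ≤ K*B := mul_le_mul_of_nonneg_right h5 hB.le
        have h8 : 1*B ≤ K*B := mul_le_mul_of_nonneg_right hK3' hB.le
        rw [hnR] at hn1 hn2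
        refine abs_le.2 ⟨?_, ?_⟩
        · have := h.2; linarith
        · have := h.1; linarith)
      (fun i hi i' hi' j hj j' hj' hne => by
        have h := hzz i hi j hj
        have h' := hzz i' hi' j' hj'
        rcases lt_or_gt_of_ne hne with hlt | hlt
        · have e1 : (i:ℝ)+1 ≤ i' := by exact_mod_cast hlt
          have e2 : ((i:ℝ)+1)*B ≤ i'*B := mul_le_mul_of_nonneg_right e1 hB.le
          rw [abs_sub_comm, abs_of_nonneg (by linarith), abs_sub_comm]
          refine le_trans ?_ (le_abs_self _)
          linarith [h.2, h'.1]
        · have e1 : (i':ℝ)+1 ≤ i := by exact_mod_cast hlt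
          have e2 : ((i':ℝ)+1)*B ≤ i*B := mul_le_mul_of_nonneg_right e1 hB.le
          rw [abs_of_nonneg (by linarith)]
          refine le_trans ?_ (le_abs_self _)
          linarith [h.1, h'.2])
      (fun i hi j hj j' hj' hne => by
        refine le_trans ?_ (hz2 i j hj j' hj' hne)
        rw [hδ]
        refine one_div_le_one_div_of_le (by positivity) ?_
        refine mul_le_mul_of_nonneg_left ?_ (by positivity)
        exact mul_le_mul_of_nonneg_right (hkm i hi) hB.le)
      (fun i hi j hj => by
        refine (hz1 i j hj).2.trans ?_
        rw [div_eq_mul_inv]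
        refine mul_le_mul ?_ ?_ (by positivity) (by positivity)
        · refine mul_le_mul_of_nonneg_left ?_ (by positivity)
          exact mul_le_mul_of_nonneg_right (hkm i hi) hB.le
        · have e4 : (4:ℝ)^(ks+2*i) = Real.exp (((ks:ℝ)+2*i)*B) := by
            rw [← Real.rpow_natCast, Real.rpow_def_of_pos (by norm_num)]; congr 1; push_cast; ring
          rw [e4, ← Real.exp_neg]
          have e16 : (16:ℝ) = Real.exp (2*B) := by
            rw [hBdef, mul_comm, Real.exp_mul, Real.exp_log (by norm_num)]; norm_num
          rw [e16, ← Real.exp_add]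
          refine Real.exp_le_exp.2 ?_
          rw [hnR] at hn2
          have h6 : (0:ℝ) ≤ i*B := by positivity
          linarith)
    refine key.trans ?_
    rw [add_mul]
    refine add_le_add ?_ ?_
    · exact dec1 M B β ν u m K hM0 hB hB1.le hm0 (by linarith) hβ2 hν hK1 (by linarith) (by linarith)
    · have hup : 0 < u := by linarith
      have q := dec2 R B β ν u m K hR hB hm0 hup hβ hν0 hK2 hm
      exact (mul_le_mul_of_nonneg_left q hC0.le).trans (le_of_eq (mul_assoc _ _ _).symm)
  refine ⟨max (C1 + C * Real.exp (m/ν)) (C * Real.exp (β*u0)), by positivity, fun u hu => ?_⟩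
  by_cases h : u0 ≤ u
  · exact (big u h).trans (mul_le_mul_of_nonneg_right (le_max_left _ _) (by positivity))
  · have := hC 0 u hu
    rw [pow_zero, mul_one] at this
    refine this.trans ?_
    refine le_trans ?_ (mul_le_mul_of_nonneg_right (le_max_right _ _) (by positivity))
    rw [mul_assoc, ← Real.exp_add]
    refine le_mul_of_one_le_right hC0.le (Real.one_le_exp ?_)
    nlinarith

instance rect_cpt (a b T : ℝ) : CompactSpace (Rect a b T) := isCompact_iff_compactSpace.1 (Rect_compact a b T)

noncomputable def Xneg (a b T : ℝ) : C(Rect a b T, ℂ) := ⟨fun s => -(s:ℂ), by fun_prop⟩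

noncomputable def EE (a b T : ℝ) (w : ℂ) : C(Rect a b T, ℂ) := ⟨fun s => cexp (-(w * s)), by fun_prop⟩

lemma EE_eq (a b T : ℝ) (w : ℂ) : EE a b T w = NormedSpace.exp (w • Xneg a b T) := by
  ext s
  have := NormedSpace.map_exp (ContinuousMap.evalAlgHom ℂ ℂ s) (by
    change Continuous fun f : C(Rect a b T, ℂ) => f s
    fun_prop) (w • Xneg a b T)
  change (NormedSpace.exp (w • Xneg a b T)) s = _ at this
  rw [this]
  simp [EE, Xneg, Complex.exp_eq_exp_ℂ]

lemma EE_deriv (a b T : ℝ) (ℓ : C(Rect a b T, ℂ) →L[ℂ] ℂ) (j : ℕ) (w : ℂ) :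
    HasDerivAt (fun w => ℓ ((Xneg a b T)^j * EE a b T w)) (ℓ ((Xneg a b T)^(j+1) * EE a b T w)) w := by
  have h := hasDerivAt_exp_smul_const' (Xneg a b T) w
  simp only [← EE_eq] at h
  have h2 := (h.const_mul ((Xneg a b T)^j))
  have h3 := ℓ.hasFDerivAt.comp_hasDerivAt w h2
  rw [pow_succ, mul_assoc]
  exact h3

lemma EE_bd (a b T : ℝ) (j : ℕ) (R E : ℝ) (hR : 0 ≤ R) (hE : 0 ≤ E) (w : ℂ)
    (h1 : ∀ s ∈ Rect a b T, ‖s‖ ≤ R) (h2 : ∀ s ∈ Rect a b T, Real.exp (-(w*s).re) ≤ E) :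
    ‖(Xneg a b T)^j * EE a b T w‖ ≤ R^j * E := by
  rw [ContinuousMap.norm_le _ (by positivity)]
  intro s
  have e : ((Xneg a b T)^j * EE a b T w) s = (-(s:ℂ))^j * cexp (-(w * s)) := by
    simp [Xneg, EE]
  rw [e, norm_mul, norm_pow, norm_neg, Complex.norm_exp, Complex.neg_re]
  exact mul_le_mul (pow_le_pow_left₀ (norm_nonneg _) (h1 s s.2) _) (h2 s s.2) (Real.exp_pos _).le (by positivity)

lemma re_decay (a b T : ℝ) (ha : 0 < a) (ℓ : C(Rect a b T, ℂ) →L[ℂ] ℂ) (Q : Finset ℕ) (M β : ℝ) (hβ : β < 1) (hβ0 : 0 < β) (hM0 : 0 < M)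
    (hM : ∀ F : Finset ℕ, (∀ p ∈ F, p.Prime ∧ p ∉ Q) → ∑ p ∈ F, ‖ℓ (EE a b T (Real.log p))‖ ≤ M) :
    ∃ C', 0 < C' ∧ ∀ u : ℝ, 0 ≤ u → |(ℓ (EE a b T u)).re| ≤ C' * Real.exp (-β*u) := by
  obtain ⟨R, hR0, hR⟩ : ∃ R, 0 < R ∧ ∀ s ∈ Rect a b T, ‖s‖ ≤ R := by
    obtain ⟨R, hR⟩ := (Rect_compact a b T).exists_bound_of_continuousOn (f := id) continuousOn_id
    exact ⟨max R 1, by positivity, fun s hs => (hR s hs).trans (le_max_left _ _)⟩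
  have := decay (fun j x => (ℓ ((Xneg a b T)^j * EE a b T (x:ℂ))).re)
    (fun j x => (EE_deriv a b T ℓ j x).real_of_complex) (‖ℓ‖ + 1) R M β (by positivity) hR0 hM0 hβ hβ0 ?_ Q ?_
  · simpa using this
  · intro j x hx
    refine (Complex.abs_re_le_norm _).trans ((ℓ.le_opNorm _).trans ?_)
    refine mul_le_mul (by linarith) ?_ (norm_nonneg _) (by positivity)
    have := EE_bd a b T j R 1 hR0.le zero_le_one (x:ℂ) hR (fun s hs => by
      rw [Complex.re_ofReal_mul]
      refine Real.exp_le_one_iff.2 ?_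
      have := hs.1
      nlinarith)
    simpa using this
  · intro F hF
    refine le_trans (Finset.sum_le_sum fun p _ => ?_) (hM F hF)
    simpa using Complex.abs_re_le_norm _

lemma func_zero (a b T : ℝ) (ha : 0 < a) (hab : a ≤ b) (hb : b < 1) (hT : 0 ≤ T) (ℓ : C(Rect a b T, ℂ) →L[ℂ] ℂ) (Q : Finset ℕ) (M : ℝ) (hM0 : 0 < M)
    (hM : ∀ F : Finset ℕ, (∀ p ∈ F, p.Prime ∧ p ∉ Q) → ∑ p ∈ F, ‖ℓ (EE a b T (Real.log p))‖ ≤ M) (w : ℂ) :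
    ℓ (EE a b T w) = 0 := by
  obtain ⟨C1, hC1, h1⟩ := re_decay a b T ha ℓ Q M ((1+b)/2) (by linarith) (by linarith) hM0 hM
  obtain ⟨C2, hC2, h2⟩ := re_decay a b T ha ((-I) • ℓ) Q M ((1+b)/2) (by linarith) (by linarith) hM0 (by
    intro F hF
    simpa using hM F hF)
  have hbd : ∀ w : ℂ, ∀ E : ℝ, (∀ s ∈ Rect a b T, Real.exp (-(w*s).re) ≤ E) → 0 ≤ E → ‖ℓ (EE a b T w)‖ ≤ (‖ℓ‖ + C1 + C2) * E := by
    intro w E h hE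
    refine (ℓ.le_opNorm _).trans (mul_le_mul (by linarith) ?_ (norm_nonneg _) (by positivity))
    rw [ContinuousMap.norm_le _ hE]
    intro s
    have := h s s.2
    rw [← Complex.neg_re, ← Complex.norm_exp] at this
    exact this
  refine PLzero (fun w => ℓ (EE a b T w)) ?_ (‖ℓ‖ + C1 + C2) T b ((1+b)/2) (by linarith) hT (by positivity) ?_ ?_ ?_ w
  · intro w
    have := (EE_deriv a b T ℓ 0 w).differentiableAt
    simpa using this
  · intro w hw hw'
    refine hbd w _ (fun s hs => Real.exp_le_exp.2 ?_) (Real.exp_pos _).le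
    rw [Complex.mul_re]
    obtain ⟨s1, s2, s3⟩ := hs
    have := (abs_le.1 s3).2
    nlinarith
  · intro w hw hw'
    refine hbd w _ (fun s hs => Real.exp_le_exp.2 ?_) (Real.exp_pos _).le
    rw [Complex.mul_re]
    obtain ⟨s1, s2, s3⟩ := hs
    have := (abs_le.1 s3).2
    nlinarith
  · intro x hx
    have e1 := h1 x hx
    have e2 := h2 x hx
    have e3 : (((-I) • ℓ) (EE a b T x)).re = (ℓ (EE a b T x)).im := by simp
    rw [e3] at e2
    refine (Complex.norm_le_abs_re_add_abs_im _).trans ?_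
    have : 0 ≤ ‖ℓ‖ * Real.exp (-((1+b)/2)*x) := by positivity
    linarith

lemma EE_prime (a b T : ℝ) (p : ℕ) (hp : p ≠ 0) (s : Rect a b T) : EE a b T (Real.log p) s = (p:ℂ)^(-(s:ℂ)) := by
  rw [Complex.cpow_def_of_ne_zero (by exact_mod_cast hp), EE, ContinuousMap.coe_mk, Complex.natCast_log]
  congr 1; ring

lemma log_elem (a b T : ℝ) (ha : 0 < a) (p : ℕ) (hp : p.Prime) : ∃ g : C(Rect a b T, ℂ),
    (∀ s, g s = -Complex.log (1 - (p:ℂ)^(-(s:ℂ)))) ∧ ∀ ℓ : C(Rect a b T, ℂ) →L[ℂ] ℂ, (∀ w, ℓ (EE a b T w) = 0) → ℓ g = 0 := by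
  have hp1 : (1:ℝ) < p := by exact_mod_cast hp.one_lt
  have hlp : 0 < Real.log p := Real.log_pos hp1
  set r := Real.exp (-(Real.log p * a)) with hr
  have hr1 : r < 1 := Real.exp_lt_one_iff.2 (by nlinarith)
  set t : ℕ → C(Rect a b T, ℂ) := fun n => ((1:ℂ)/n) • EE a b T ((n * Real.log p : ℝ)) with ht
  have hbd : ∀ n, ‖t n‖ ≤ r^n := by
    intro n
    rw [ContinuousMap.norm_le _ (by positivity)]
    intro s
    simp only [ht, ContinuousMap.smul_apply, smul_eq_mul, norm_mul]
    have h1 : ‖(1:ℂ)/n‖ ≤ 1 := by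
      rw [norm_div, norm_one, Complex.norm_natCast]
      rcases Nat.eq_zero_or_pos n with h | h
      · simp [h]
      · rw [div_le_one (by exact_mod_cast h)]; exact_mod_cast h
    have h2 : ‖EE a b T ((n * Real.log p : ℝ)) s‖ ≤ r^n := by
      rw [EE, ContinuousMap.coe_mk, Complex.norm_exp, hr, ← Real.exp_nat_mul]
      refine Real.exp_le_exp.2 ?_
      rw [Complex.neg_re, Complex.re_ofReal_mul]
      have := mul_le_mul_of_nonneg_left s.2.1 (by positivity : 0 ≤ (n:ℝ) * Real.log p)
      linarith
    calc _ ≤ 1 * r^n := mul_le_mul h1 h2 (norm_nonneg _) (by norm_num)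
      _ = _ := one_mul _
  have hsum : Summable t := Summable.of_norm_bounded (summable_geometric_of_lt_one (Real.exp_pos _).le hr1) hbd
  refine ⟨∑' n, t n, fun s => ?_, fun ℓ hℓ => ?_⟩
  · have h1 : HasSum (fun n => t n s) ((∑' n, t n) s) := by
      have := hsum.hasSum
      exact this.map (ContinuousMap.evalAlgHom ℂ ℂ s) (by
        change Continuous fun f : C(Rect a b T, ℂ) => f s
        fun_prop)
    have hn : ‖(p:ℂ)^(-(s:ℂ))‖ < 1 := by
      rw [Complex.norm_natCast_cpow_of_pos hp.pos]
      exact Real.rpow_lt_one_of_one_lt_of_neg hp1 (by have := s.2.1; simp; linarith)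
    refine h1.unique ?_
    convert Complex.hasSum_taylorSeries_neg_log hn using 2 with n
    simp only [ht, ContinuousMap.smul_apply, smul_eq_mul]
    rw [← EE_prime a b T p hp.ne_zero s]
    simp only [EE, ContinuousMap.coe_mk]
    rw [← Complex.exp_nat_mul, one_div, div_eq_inv_mul]
    congr 2; push_cast; ring
  · rw [ContinuousLinearMap.map_tsum ℓ hsum]
    simp [ht, hℓ]

def Aset (a b T : ℝ) (Q : Finset ℕ) : Set C(Rect a b T, ℂ) :=
  {f | ∃ (F : Finset ℕ) (c : ℕ → ℂ), (∀ p ∈ F, p.Prime ∧ p ∉ Q) ∧ (∀ p, ‖c p‖ ≤ 1/4) ∧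
    f = ∑ p ∈ F, c p • EE a b T (Real.log p)}

lemma Aset_convex (a b T : ℝ) (Q : Finset ℕ) : Convex ℝ (Aset a b T Q) := by
  classical
  rintro _ ⟨F, c, hF, hc, rfl⟩ _ ⟨G, e, hG, he, rfl⟩ x y hx hy hxy
  refine ⟨F ∪ G, fun p => x * (if p ∈ F then c p else 0) + y * (if p ∈ G then e p else 0), ?_, ?_, ?_⟩
  · intro p hp
    rcases Finset.mem_union.1 hp with h | h
    exacts [hF p h, hG p h]
  · intro p
    have h1 : ‖(if p ∈ F then c p else 0)‖ ≤ 1/4 := by split_ifs; exacts [hc p, by simp]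
    have h2 : ‖(if p ∈ G then e p else 0)‖ ≤ 1/4 := by split_ifs; exacts [he p, by simp]
    refine (norm_add_le _ _).trans ?_
    rw [norm_mul, norm_mul, Complex.norm_of_nonneg hx, Complex.norm_of_nonneg hy]
    nlinarith
  · have e1 : ∑ p ∈ F, c p • EE a b T (Real.log p) = ∑ p ∈ F ∪ G, (if p ∈ F then c p else 0) • EE a b T (Real.log p) := by
      rw [← Finset.sum_subset (Finset.subset_union_left (s₁ := F) (s₂ := G))]
      · exact Finset.sum_congr rfl fun p hp => by rw [if_pos hp]
      · intro p _ hp; rw [if_neg hp, zero_smul]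
    have e2 : ∑ p ∈ G, e p • EE a b T (Real.log p) = ∑ p ∈ F ∪ G, (if p ∈ G then e p else 0) • EE a b T (Real.log p) := by
      rw [← Finset.sum_subset (Finset.subset_union_right (s₁ := F) (s₂ := G))]
      · exact Finset.sum_congr rfl fun p hp => by rw [if_pos hp]
      · intro p _ hp; rw [if_neg hp, zero_smul]
    rw [e1, e2, Finset.smul_sum, Finset.smul_sum, ← Finset.sum_add_distrib]
    refine Finset.sum_congr rfl fun p _ => ?_
    rw [add_smul, mul_smul, mul_smul]
    rfl

lemma Aset_dense (a b T : ℝ) (ha : 0 < a) (hab : a ≤ b) (hb : b < 1) (hT : 0 ≤ T) (Q : Finset ℕ) (f : C(Rect a b T, ℂ))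
    (hf : ∀ ℓ : C(Rect a b T, ℂ) →L[ℂ] ℂ, (∀ w, ℓ (EE a b T w) = 0) → ℓ f = 0) : f ∈ closure (Aset a b T Q) := by
  by_contra hcon
  obtain ⟨ℓ, u, h1, h2⟩ := RCLike.geometric_hahn_banach_closed_point (𝕜 := ℂ) (Aset_convex a b T Q).closure isClosed_closure hcon
  have h1' : ∀ g ∈ Aset a b T Q, (ℓ g).re < u := fun g hg => h1 g (subset_closure hg)
  have hu : 0 < u := by
    have := h1' 0 ⟨∅, 0, by simp, by simp, by simp⟩
    simpa using this
  have hz := func_zero a b T ha hab hb hT ℓ Q (4*u) (by positivity) (by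
    intro F hF
    set c : ℕ → ℂ := fun p => (1/4) * ((starRingEnd ℂ) (ℓ (EE a b T (Real.log p))) / ‖ℓ (EE a b T (Real.log p))‖) with hc
    have h3 := h1' _ ⟨F, c, hF, ?_, rfl⟩
    · rw [map_sum, Complex.re_sum] at h3
      have : ∀ p ∈ F, (ℓ (c p • EE a b T (Real.log p))).re = 1/4 * ‖ℓ (EE a b T (Real.log p))‖ := by
        intro p _
        rw [map_smul, smul_eq_mul]
        simp only [hc]
        generalize ℓ (EE a b T (Real.log p)) = v
        have : (1/4) * ((starRingEnd ℂ) v / ‖v‖) * v = ((1/4 * ‖v‖ : ℝ) : ℂ) := by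
          rcases eq_or_ne v 0 with rfl | hv
          · simp
          · have : ((‖v‖:ℝ):ℂ) ≠ 0 := by exact_mod_cast norm_ne_zero_iff.2 hv
            push_cast
            field_simp
            rw [Complex.conj_mul']
        rw [this, Complex.ofReal_re]
      rw [Finset.sum_congr rfl this, ← Finset.mul_sum] at h3
      linarith
    · intro p
      simp only [hc, norm_mul, norm_div, RCLike.norm_conj, Complex.norm_real, norm_norm]
      have := div_self_le_one ‖ℓ (EE a b T (Real.log p))‖
      have h14 : ‖(1:ℂ)‖/‖(4:ℂ)‖ = 1/4 := by norm_num
      rw [h14]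
      linarith)
  have := hf ℓ hz
  rw [this] at h2
  simp at h2
  linarith

lemma approx_real (a b T : ℝ) (ha : 0 < a) (hab : a ≤ b) (hb : b < 1) (hT : 0 ≤ T) (Q : Finset ℕ) (hQ : ∀ p ∈ Q, p.Prime)
    (η : ℝ) (hη : 0 < η) : ∃ (F : Finset ℕ) (c : ℕ → ℝ), (∀ p ∈ F, p.Prime ∧ p ∉ Q) ∧ (∀ p, |c p| ≤ 1/4) ∧
    ∀ s ∈ Rect a b T, ‖∑ p ∈ Q, -Complex.log (1 - (p:ℂ)^(-s)) + ∑ p ∈ F, (c p : ℂ) * (p:ℂ)^(-s)‖ < η := by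
  classical
  choose! g hg1 hg2 using fun (p : ℕ) (hp : p.Prime) => log_elem a b T ha p hp
  have hd := Aset_dense a b T ha hab hb hT Q (-∑ p ∈ Q, g p) (by
    intro ℓ hℓ
    rw [map_neg, map_sum, Finset.sum_eq_zero fun p hp => hg2 p (hQ p hp) ℓ hℓ, neg_zero])
  obtain ⟨_, ⟨F, c, hF, hc, rfl⟩, hdist⟩ := Metric.mem_closure_iff.1 hd η hη
  rw [dist_eq_norm, ContinuousMap.norm_lt_iff _ hη] at hdist
  have h1 : ∀ s ∈ Rect a b T, ‖∑ p ∈ Q, -Complex.log (1 - (p:ℂ)^(-s)) + ∑ p ∈ F, c p * (p:ℂ)^(-s)‖ < η := by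
    intro s hs
    have := hdist ⟨s, hs⟩
    rw [← norm_neg] at this
    refine lt_of_eq_of_lt (congrArg _ ?_) this
    rw [ContinuousMap.sub_apply, ContinuousMap.neg_apply, ContinuousMap.sum_apply, ContinuousMap.sum_apply]
    simp only [ContinuousMap.smul_apply, smul_eq_mul]
    rw [neg_sub, sub_neg_eq_add, add_comm]
    congr 1
    · exact Finset.sum_congr rfl fun p hp => by rw [EE_prime _ _ _ _ (hF p hp).1.ne_zero]
    · exact Finset.sum_congr rfl fun p hp => by rw [hg1 p (hQ p hp)]
  refine ⟨F, fun p => (c p).re, hF, fun p => (Complex.abs_re_le_norm _).trans (hc p), fun s hs => ?_⟩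
  have h2 := h1 s hs
  have hs' : (starRingEnd ℂ) s ∈ Rect a b T := by
    obtain ⟨s1, s2, s3⟩ := hs
    exact ⟨by simpa using s1, by simpa using s2, by simpa using s3⟩
  have h3 := h1 _ hs'
  have hcp : ∀ p : ℕ, (p:ℂ)^(-(starRingEnd ℂ) s) = (starRingEnd ℂ) ((p:ℂ)^(-s)) := by
    intro p
    rw [← map_neg, Complex.cpow_conj (p:ℂ) _ (by rw [Complex.natCast_arg]; exact Real.pi_pos.ne)]
    simp
  rw [← RCLike.norm_conj, map_add, map_sum, map_sum] at h3
  have e1 : ∑ p ∈ Q, (starRingEnd ℂ) (-Complex.log (1 - (p:ℂ)^(-(starRingEnd ℂ) s))) = ∑ p ∈ Q, -Complex.log (1 - (p:ℂ)^(-s)) := by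
    refine Finset.sum_congr rfl fun p hp => ?_
    have hn : ‖(p:ℂ)^(-s)‖ < 1 := by
      rw [Complex.norm_natCast_cpow_of_pos (hQ p hp).pos]
      exact Real.rpow_lt_one_of_one_lt_of_neg (by exact_mod_cast (hQ p hp).one_lt) (by have := hs.1; simp; linarith)
    have hsl : (1 - (p:ℂ)^(-s)).arg ≠ Real.pi := by
      have : 1 - (p:ℂ)^(-s) ∈ Complex.slitPlane := by
        have := Complex.mem_slitPlane_of_norm_lt_one (z := -(p:ℂ)^(-s)) (by rwa [norm_neg])
        rwa [← sub_eq_add_neg] at this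
      exact (Complex.mem_slitPlane_iff_arg.1 this).1
    rw [hcp, map_neg, show 1 - (starRingEnd ℂ) ((p:ℂ)^(-s)) = (starRingEnd ℂ) (1 - (p:ℂ)^(-s)) by simp,
      Complex.log_conj _ hsl, Complex.conj_conj]
  have e2 : ∑ p ∈ F, (starRingEnd ℂ) (c p * (p:ℂ)^(-(starRingEnd ℂ) s)) = ∑ p ∈ F, (starRingEnd ℂ) (c p) * (p:ℂ)^(-s) := by
    refine Finset.sum_congr rfl fun p hp => ?_
    rw [hcp, map_mul, Complex.conj_conj]
  rw [e1, e2] at h3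
  set S := ∑ p ∈ Q, -Complex.log (1 - (p:ℂ)^(-s))
  have e3 : S + ∑ p ∈ F, (((c p).re : ℝ):ℂ) * (p:ℂ)^(-s) = (1/2) * ((S + ∑ p ∈ F, c p * (p:ℂ)^(-s)) +
      (S + ∑ p ∈ F, (starRingEnd ℂ) (c p) * (p:ℂ)^(-s))) := by
    have : ∑ p ∈ F, (((c p).re : ℝ):ℂ) * (p:ℂ)^(-s) = (1/2) * (∑ p ∈ F, c p * (p:ℂ)^(-s) + ∑ p ∈ F, (starRingEnd ℂ) (c p) * (p:ℂ)^(-s)) := by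
      rw [← Finset.sum_add_distrib, Finset.mul_sum]
      refine Finset.sum_congr rfl fun p hp => ?_
      rw [Complex.re_eq_add_conj]; ring
    rw [this]; ring
  rw [e3, norm_mul]
  have := norm_add_le (S + ∑ p ∈ F, c p * (p:ℂ)^(-s)) (S + ∑ p ∈ F, (starRingEnd ℂ) (c p) * (p:ℂ)^(-s))
  norm_num at *
  linarith

open scoped NNReal

def MeanTo (u : ℝ → ℂ) (m : ℂ) : Prop :=
  Continuous u ∧ Tendsto (fun T : ℝ => (∫ t in (0:ℝ)..T, u t) / (T:ℂ)) atTop (nhds m)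

lemma MeanTo.add {u v : ℝ → ℂ} {m n : ℂ} (h : MeanTo u m) (k : MeanTo v n) : MeanTo (u + v) (m + n) := by
  refine ⟨h.1.add k.1, ?_⟩
  refine (h.2.add k.2).congr fun T => ?_
  have : ∫ t in (0:ℝ)..T, (u + v) t = (∫ t in (0:ℝ)..T, u t) + ∫ t in (0:ℝ)..T, v t :=
    intervalIntegral.integral_add (h.1.intervalIntegrable _ _) (k.1.intervalIntegrable _ _)
  rw [this, add_div]

lemma MeanTo.smul {u : ℝ → ℂ} {m : ℂ} (c : ℂ) (h : MeanTo u m) : MeanTo (c • u) (c * m) := by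
  refine ⟨h.1.const_smul c, ?_⟩
  refine (h.2.const_mul c).congr fun T => ?_
  have : ∫ t in (0:ℝ)..T, (c • u) t = c * ∫ t in (0:ℝ)..T, u t := by
    rw [← intervalIntegral.integral_const_mul]; rfl
  rw [this, mul_div_assoc]

lemma MeanTo.sub {u v : ℝ → ℂ} {m n : ℂ} (h : MeanTo u m) (k : MeanTo v n) : MeanTo (u - v) (m - n) := by
  have := h.add (k.smul (-1))
  convert this using 1
  · ext t; simp [sub_eq_add_neg]
  · ring

lemma MeanTo.unique {u : ℝ → ℂ} {m n : ℂ} (h : MeanTo u m) (k : MeanTo u n) : m = n :=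
  tendsto_nhds_unique h.2 k.2

lemma MeanTo_zero : MeanTo 0 0 := ⟨continuous_const, by simp⟩

lemma MeanTo_one : MeanTo 1 1 := by
  refine ⟨continuous_const, ?_⟩
  refine tendsto_const_nhds.congr' ?_
  filter_upwards [eventually_gt_atTop 0] with T hT
  have : ((T:ℝ):ℂ) ≠ 0 := by exact_mod_cast hT.ne'
  simp [this]

lemma MeanTo_ef (l : ℝ) (hl : l ≠ 0) : MeanTo (ef l) 0 := by
  refine ⟨ef_cont l, ?_⟩
  have hlI : (l:ℂ) * I ≠ 0 := mul_ne_zero (by exact_mod_cast hl) I_ne_zero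
  have h1 : ∀ T : ℝ, ∫ t in (0:ℝ)..T, ef l t = (ef l T - 1) / (l * I) := by
    intro T
    have := integral_exp_mul_complex (a := 0) (b := T) hlI
    have e : ∀ t : ℝ, ef l t = cexp ((l:ℂ) * I * t) := fun t => by rw [ef]; congr 1; push_cast; ring
    simp only [e]
    rw [this]; simp
  rw [tendsto_zero_iff_norm_tendsto_zero]
  refine squeeze_zero' (Eventually.of_forall fun _ => norm_nonneg _) ?_ (tendsto_const_nhds (x := 2/|l|) |>.div_atTop tendsto_id)
  filter_upwards [eventually_gt_atTop 0] with T hT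
  rw [h1, norm_div, norm_div]
  have : ‖ef l T - 1‖ ≤ 2 := (norm_sub_le _ _).trans (by rw [ef_norm]; norm_num)
  have h2 : ‖(l:ℂ) * I‖ = |l| := by simp
  have h3 : ‖(T:ℂ)‖ = T := by simp [abs_of_pos hT]
  rw [h2, h3]
  have : 0 < |l| := abs_pos.2 hl
  simp only [id]
  gcongr

def EP (S : Set ℝ) : Submodule ℂ (ℝ → ℂ) := Submodule.span ℂ (ef '' S)

lemma EP_ef {S : Set ℝ} {l : ℝ} (h : l ∈ S) : ef l ∈ EP S := Submodule.subset_span ⟨l, h, rfl⟩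

lemma EP_mono {S S' : Set ℝ} (h : S ⊆ S') {u : ℝ → ℂ} (hu : u ∈ EP S) : u ∈ EP S' :=
  Submodule.span_mono (Set.image_mono h) hu

lemma ef_mul (l m : ℝ) : ef l * ef m = ef (l + m) := by
  ext t; rw [Pi.mul_apply, ef_add]

lemma ef_z : ef 0 = 1 := by ext t; simp [ef_zero]

lemma EP_mul {S S' S'' : Set ℝ} (h : ∀ a ∈ S, ∀ b ∈ S', a + b ∈ S'') {u v : ℝ → ℂ} (hu : u ∈ EP S) (hv : v ∈ EP S') :
    u * v ∈ EP S'' := by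
  have h1 : u * v ∈ EP S * EP S' := Submodule.mul_mem_mul hu hv
  rw [EP, EP, Submodule.span_mul_span] at h1
  refine Submodule.span_mono ?_ h1
  rintro _ ⟨_, ⟨a, ha, rfl⟩, _, ⟨b, hb, rfl⟩, rfl⟩
  exact ⟨a + b, h a ha b hb, (ef_mul a b).symm⟩

lemma EP_mean {S : Set ℝ} {u : ℝ → ℂ} (hu : u ∈ EP S) : ∃ m, MeanTo u m := by
  induction hu using Submodule.span_induction with
  | mem x h =>
    obtain ⟨l, _, rfl⟩ := h
    by_cases hl : l = 0
    · exact ⟨1, by rw [hl, ef_z]; exact MeanTo_one⟩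
    · exact ⟨0, MeanTo_ef l hl⟩
  | zero => exact ⟨0, MeanTo_zero⟩
  | add x y _ _ h1 h2 => obtain ⟨m, h1⟩ := h1; obtain ⟨n, h2⟩ := h2; exact ⟨_, h1.add h2⟩
  | smul c x _ h => obtain ⟨m, h⟩ := h; exact ⟨_, h.smul c⟩

lemma EP_mean_zero {S : Set ℝ} (hS : 0 ∉ S) {u : ℝ → ℂ} (hu : u ∈ EP S) : MeanTo u 0 := by
  induction hu using Submodule.span_induction with
  | mem x h =>
    obtain ⟨l, hl, rfl⟩ := h
    exact MeanTo_ef l (fun h => hS (h ▸ hl))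
  | zero => exact MeanTo_zero
  | add x y _ _ h1 h2 => simpa using h1.add h2
  | smul c x _ h => simpa using h.smul c

noncomputable def Cone : Submodule ℝ≥0 (ℝ → ℂ) := Submodule.span ℝ≥0 (Set.range ef)

lemma Cone_mul {u v : ℝ → ℂ} (hu : u ∈ Cone) (hv : v ∈ Cone) : u * v ∈ Cone := by
  have h1 : u * v ∈ Cone * Cone := Submodule.mul_mem_mul hu hv
  rw [Cone, Submodule.span_mul_span] at h1
  refine Submodule.span_mono ?_ h1
  rintro _ ⟨_, ⟨a, rfl⟩, _, ⟨b, rfl⟩, rfl⟩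
  exact ⟨a + b, (ef_mul a b).symm⟩

lemma Cone_ef (l : ℝ) : ef l ∈ Cone := Submodule.subset_span ⟨l, rfl⟩

lemma Cone_one : (1 : ℝ → ℂ) ∈ Cone := ef_z ▸ Cone_ef 0

lemma Cone_mean {u : ℝ → ℂ} (hu : u ∈ Cone) : ∃ m : ℝ≥0, MeanTo u ((m:ℝ):ℂ) := by
  induction hu using Submodule.span_induction with
  | mem x h =>
    obtain ⟨l, rfl⟩ := h
    by_cases hl : l = 0
    · exact ⟨1, by rw [hl, ef_z]; simpa using MeanTo_one⟩
    · exact ⟨0, by simpa using MeanTo_ef l hl⟩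
  | zero => exact ⟨0, by simpa using MeanTo_zero⟩
  | add x y _ _ h1 h2 =>
    obtain ⟨m, h1⟩ := h1; obtain ⟨n, h2⟩ := h2
    exact ⟨m+n, by have := h1.add h2; push_cast; exact this⟩
  | smul c x _ h =>
    obtain ⟨m, h⟩ := h
    refine ⟨c*m, ?_⟩
    have := h.smul ((c:ℝ):ℂ)
    push_cast
    exact this

lemma MeanTo_mono {u v : ℝ → ℝ} {m n : ℝ} (h : MeanTo (fun t => (u t : ℂ)) m) (k : MeanTo (fun t => (v t : ℂ)) n)
    (huv : ∀ t, u t ≤ v t) : m ≤ n := by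
  have conv : ∀ {u : ℝ → ℝ} {m : ℝ}, MeanTo (fun t => (u t : ℂ)) m → Tendsto (fun T : ℝ => (∫ t in (0:ℝ)..T, u t) / T) atTop (nhds m) := by
    intro u m h
    have := (Complex.continuous_re.tendsto _).comp h.2
    refine this.congr fun T => ?_
    simp only [Function.comp]
    rw [intervalIntegral.integral_ofReal, ← Complex.ofReal_div, Complex.ofReal_re]
  refine le_of_tendsto_of_tendsto (conv h) (conv k) ?_
  filter_upwards [eventually_gt_atTop 0] with T hT
  have cr : ∀ {u : ℝ → ℝ} {m : ℂ}, MeanTo (fun t => (u t : ℂ)) m → Continuous u := fun h => by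
    have := Complex.continuous_re.comp h.1
    exact this
  have := intervalIntegral.integral_mono_on (μ := volume) (a := 0) (b := T) hT.le ((cr h).intervalIntegrable _ _) ((cr k).intervalIntegrable _ _) (fun t _ => huv t)
  gcongr

lemma MeanTo_re {u : ℝ → ℝ} {m : ℝ} (h : MeanTo (fun t => (u t : ℂ)) m) : Tendsto (fun T : ℝ => (∫ t in (0:ℝ)..T, u t) / T) atTop (nhds m) := by
  have := (Complex.continuous_re.tendsto _).comp h.2
  refine this.congr fun T => ?_
  simp only [Function.comp]
  rw [intervalIntegral.integral_ofReal, ← Complex.ofReal_div, Complex.ofReal_re]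

noncomputable def fej (n : ℕ) (l t : ℝ) : ℝ := ‖∑ k ∈ Finset.range n, ef (k*l) t‖^2 / n

lemma fej_nonneg (n : ℕ) (l t : ℝ) : 0 ≤ fej n l t := by unfold fej; positivity

lemma fej_cont (n : ℕ) (l : ℝ) : Continuous (fej n l) := by
  unfold fej
  exact ((continuous_finsetSum _ fun k _ => ef_cont _).norm.pow 2).div_const _

lemma fej_eq (n : ℕ) (l : ℝ) : (fun t => ((fej n l t : ℝ):ℂ)) =
    ∑ j ∈ Finset.range n, ∑ k ∈ Finset.range n, ((1:ℂ)/n) • ef ((j-k)*l) := by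
  ext t
  rw [fej]
  push_cast
  rw [← Complex.mul_conj', map_sum, Finset.sum_mul_sum, Finset.sum_div]
  simp only [Finset.sum_apply]
  refine Finset.sum_congr rfl fun j _ => ?_
  rw [Finset.sum_div]
  refine Finset.sum_congr rfl fun k _ => ?_
  rw [ef_conj, ← ef_add, Pi.smul_apply, smul_eq_mul]
  rw [show (j:ℝ)*l + -((k:ℝ)*l) = (j-k)*l by ring]; ring

lemma fej_cone (n : ℕ) (hn : 1 ≤ n) (l : ℝ) : (fun t => ((fej n l t : ℝ):ℂ)) - 1 ∈ Cone := by
  classical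
  have hn0 : (n:ℂ) ≠ 0 := by exact_mod_cast (by omega : n ≠ 0)
  have e : (fun t => ((fej n l t : ℝ):ℂ)) - 1 = ∑ j ∈ Finset.range n, ∑ k ∈ (Finset.range n).erase j, ((1:ℂ)/n) • ef ((j-k)*l) := by
    rw [fej_eq]
    have h1 : (1 : ℝ → ℂ) = ∑ j ∈ Finset.range n, ((1:ℂ)/n) • (1 : ℝ → ℂ) := by
      rw [Finset.sum_const, Finset.card_range]
      ext t; simp [hn0]
    rw [h1, ← Finset.sum_sub_distrib]
    refine Finset.sum_congr rfl fun j hj => ?_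
    rw [← Finset.add_sum_erase _ _ hj, sub_self, zero_mul, ef_z, add_sub_cancel_left]
  rw [e]
  refine Submodule.sum_mem _ fun j _ => Submodule.sum_mem _ fun k _ => ?_
  have : ((1:ℂ)/n) • ef ((j-k)*l) = ((1:ℝ≥0)/n) • ef ((j-k)*l) := by
    ext t; simp only [Pi.smul_apply, smul_eq_mul, NNReal.smul_def]; simp
  rw [this]
  exact Submodule.smul_mem _ _ (Cone_ef _)

lemma fej_EP (n : ℕ) (l : ℝ) (S : Set ℝ) (hS : ∀ m : ℤ, (m:ℝ)*l ∈ S) : (fun t => ((fej n l t : ℝ):ℂ)) ∈ EP S := by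
  rw [fej_eq]
  refine Submodule.sum_mem _ fun j _ => Submodule.sum_mem _ fun k _ => Submodule.smul_mem _ _ (EP_ef ?_)
  have := hS ((j:ℤ) - k)
  push_cast at this; exact this

lemma fej_bd (n : ℕ) (l t : ℝ) : fej n l t * ‖1 - ef l t‖^2 ≤ 4/n := by
  have h1 : (∑ k ∈ Finset.range n, ef (k*l) t) * (ef l t - 1) = ef (n*l) t - 1 := by
    have hp : ∀ k : ℕ, ef (k*l) t = (ef l t)^k := by
      intro k
      rw [ef, ef, ← Complex.exp_nat_mul]; congr 1; push_cast; ring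
    simp only [hp]
    exact geom_sum_mul _ _
  have h2 : ‖ef (n*l) t - 1‖ ≤ 2 := (norm_sub_le _ _).trans (by rw [ef_norm]; norm_num)
  rw [fej, norm_sub_rev, div_mul_eq_mul_div, ← mul_pow, ← norm_mul, h1]
  have h3 : ‖ef (n*l) t - 1‖^2 ≤ 4 := by nlinarith [norm_nonneg (ef (n*l) t - 1)]
  exact div_le_div_of_nonneg_right h3 (Nat.cast_nonneg n)

noncomputable def W0 {ι : Type} (J : Finset ι) (l : ι → ℝ) (n : ℕ) (t : ℝ) : ℝ := ∏ i ∈ J, fej n (l i) t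

lemma W0_cone {ι : Type} (J : Finset ι) (l : ι → ℝ) (n : ℕ) (hn : 1 ≤ n) : (fun t => ((W0 J l n t : ℝ):ℂ)) - 1 ∈ Cone := by
  classical
  induction J using Finset.induction_on with
  | empty => simp only [W0, Finset.prod_empty]; convert Submodule.zero_mem Cone using 1; ext t; simp
  | insert i J hi ih =>
    have e : (fun t => ((W0 (insert i J) l n t : ℝ):ℂ)) - 1 = ((fun t => ((fej n (l i) t : ℝ):ℂ)) - 1) * ((fun t => ((W0 J l n t : ℝ):ℂ)) - 1)
        + ((fun t => ((fej n (l i) t : ℝ):ℂ)) - 1) + ((fun t => ((W0 J l n t : ℝ):ℂ)) - 1) := by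
      ext t
      simp only [W0, Finset.prod_insert hi, Pi.sub_apply, Pi.add_apply, Pi.mul_apply, Pi.one_apply]
      push_cast; ring
    rw [e]
    have := fej_cone n hn (l i)
    exact Submodule.add_mem _ (Submodule.add_mem _ (Cone_mul this ih) this) ih

lemma W0_EP {ι : Type} (J : Finset ι) (l : ι → ℝ) (n : ℕ) (S : AddSubgroup ℝ) (hS : ∀ i ∈ J, l i ∈ S) :
    (fun t => ((W0 J l n t : ℝ):ℂ)) ∈ EP (S : Set ℝ) := by
  classical
  induction J using Finset.induction_on with
  | empty =>
    have : (fun t => ((W0 (∅ : Finset ι) l n t : ℝ):ℂ)) = ef 0 := by rw [ef_z]; ext t; simp [W0]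
    rw [this]; exact EP_ef S.zero_mem
  | insert i J hi ih =>
    have e : (fun t => ((W0 (insert i J) l n t : ℝ):ℂ)) = (fun t => ((fej n (l i) t : ℝ):ℂ)) * (fun t => ((W0 J l n t : ℝ):ℂ)) := by
      ext t
      simp only [W0, Finset.prod_insert hi, Pi.mul_apply]
      push_cast; ring
    rw [e]
    refine EP_mul (fun a ha b hb => S.add_mem ha hb) (fej_EP n (l i) (S : Set ℝ) fun m => ?_) (ih fun j hj => hS j (Finset.mem_insert_of_mem hj))
    have := S.zsmul_mem (hS i (Finset.mem_insert_self _ _)) m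
    rwa [zsmul_eq_mul] at this

lemma W0_nonneg {ι : Type} (J : Finset ι) (l : ι → ℝ) (n : ℕ) (t : ℝ) : 0 ≤ W0 J l n t :=
  Finset.prod_nonneg fun _ _ => fej_nonneg _ _ _

lemma sq_EP (l : ℝ) (S : Set ℝ) (h0 : 0 ∈ S) (h1 : l ∈ S) (h2 : -l ∈ S) : (fun t => ((‖1 - ef l t‖^2 : ℝ):ℂ)) ∈ EP S := by
  have : (fun t => ((‖1 - ef l t‖^2 : ℝ):ℂ)) = (2:ℂ) • ef 0 - ef l - ef (-l) := by
    ext t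
    push_cast
    rw [← Complex.mul_conj']
    simp only [map_sub, map_one, ef_conj, Pi.sub_apply, Pi.smul_apply, smul_eq_mul, ef_zero]
    have : ef l t * ef (-l) t = 1 := by rw [← ef_add, add_neg_cancel, ef_zero]
    linear_combination this
  rw [this]
  exact Submodule.sub_mem _ (Submodule.sub_mem _ (Submodule.smul_mem _ _ (EP_ef h0)) (EP_ef h1)) (EP_ef h2)

lemma W0_spec {ι : Type} (J : Finset ι) (l : ι → ℝ) (n : ℕ) (hn : 1 ≤ n) : ∃ A : ℝ, 1 ≤ A ∧ MeanTo (fun t => ((W0 J l n t : ℝ):ℂ)) A ∧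
    ∀ i ∈ J, ∀ m : ℝ, MeanTo (fun t => ((W0 J l n t * ‖1 - ef (l i) t‖^2 : ℝ):ℂ)) m → m ≤ 4/n*A := by
  classical
  obtain ⟨m, hm⟩ := Cone_mean (W0_cone J l n hn)
  have hA := hm.add MeanTo_one
  rw [sub_add_cancel] at hA
  refine ⟨m+1, by have := m.2; simp, by push_cast; exact hA, ?_⟩
  intro i hi m' hm'
  set V : ℝ → ℝ := W0 (J.erase i) l n with hV
  have hWV : ∀ t, W0 J l n t = fej n (l i) t * V t := fun t => by
    simp only [W0, hV]; exact (Finset.mul_prod_erase _ _ hi).symm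
  obtain ⟨v, hv⟩ := Cone_mean (W0_cone (J.erase i) l n hn)
  have hv1 := hv.add MeanTo_one
  rw [sub_add_cancel] at hv1
  have hle : (v:ℝ) + 1 ≤ m + 1 := by
    have h1 : ((fun t => ((fej n (l i) t : ℝ):ℂ)) - 1) * (fun t => ((V t : ℝ):ℂ)) ∈ Cone := by
      refine Cone_mul (fej_cone n hn _) ?_
      have := Submodule.add_mem _ (W0_cone (J.erase i) l n hn) Cone_one
      rwa [sub_add_cancel] at this
    obtain ⟨r, hr⟩ := Cone_mean h1
    have h2 := hr.add hv1
    have e : ((fun t => ((fej n (l i) t : ℝ):ℂ)) - 1) * (fun t => ((V t : ℝ):ℂ)) + (fun t => ((W0 (J.erase i) l n t : ℝ):ℂ)) = (fun t => ((W0 J l n t : ℝ):ℂ)) := by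
      ext t
      simp only [hWV, Pi.add_apply, Pi.mul_apply, Pi.sub_apply, Pi.one_apply, hV]
      push_cast; ring
    rw [e] at h2
    have h3 := h2.unique hA
    have h4 : (r:ℝ) + (v + 1) = m + 1 := by exact_mod_cast h3
    have := r.2
    have : (0:ℝ) ≤ r := r.2
    linarith
  have hk := hv1.smul ((4/n : ℝ):ℂ)
  have h5 : m' ≤ 4/n * (v+1) := by
    refine MeanTo_mono (u := fun t => W0 J l n t * ‖1 - ef (l i) t‖^2) (v := fun t => 4/n * V t) hm' ?_ ?_
    · convert hk using 1
      · ext t; simp [hV]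
      · push_cast; rfl
    · intro t
      rw [hWV]
      have h0 := W0_nonneg (J.erase i) l n t
      have := mul_le_mul_of_nonneg_right (fej_bd n (l i) t) h0
      calc _ = fej n (l i) t * ‖1 - ef (l i) t‖^2 * V t := by ring
        _ ≤ _ := this
  exact h5.trans (mul_le_mul_of_nonneg_left hle (by positivity))

lemma EP_bdd {S : Set ℝ} {u : ℝ → ℂ} (hu : u ∈ EP S) : ∃ M : ℝ, ∀ t, ‖u t‖ ≤ M := by
  induction hu using Submodule.span_induction with
  | mem x h =>
    obtain ⟨l, _, rfl⟩ := h
    exact ⟨1, fun t => (ef_norm l t).le⟩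
  | zero => exact ⟨0, fun t => by simp⟩
  | add x y _ _ h1 h2 =>
    obtain ⟨a, ha⟩ := h1
    obtain ⟨b, hb⟩ := h2
    exact ⟨a+b, fun t => (norm_add_le _ _).trans (add_le_add (ha t) (hb t))⟩
  | smul c x _ h =>
    obtain ⟨a, ha⟩ := h
    exact ⟨‖c‖*a, fun t => by
      rw [Pi.smul_apply, smul_eq_mul, norm_mul]
      exact mul_le_mul_of_nonneg_left (ha t) (norm_nonneg _)⟩

lemma MeanTo_real {u : ℝ → ℝ} {m : ℂ} (h : MeanTo (fun t => (u t : ℂ)) m) : MeanTo (fun t => (u t : ℂ)) ((m.re : ℝ) : ℂ) := by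
  refine ⟨h.1, ?_⟩
  have h1 := (Complex.continuous_ofReal.tendsto _).comp ((Complex.continuous_re.tendsto _).comp h.2)
  refine h1.congr fun T => ?_
  simp only [Function.comp]
  rw [intervalIntegral.integral_ofReal, ← Complex.ofReal_div, Complex.ofReal_re]

def Zs (π : ℝ →+ ℝ) : Set ℝ := {x | π x = 0}
def Ns (π : ℝ →+ ℝ) : Set ℝ := {x | π x ≠ 0}

lemma Z_mul {π : ℝ →+ ℝ} {u v : ℝ → ℂ} (hu : u ∈ EP (Zs π)) (hv : v ∈ EP (Zs π)) : u * v ∈ EP (Zs π) :=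
  EP_mul (fun a ha b hb => by simp only [Zs, Set.mem_setOf_eq] at *; rw [map_add, ha, hb, add_zero]) hu hv

lemma ZN_mul {π : ℝ →+ ℝ} {u v : ℝ → ℂ} (hu : u ∈ EP (Zs π)) (hv : v ∈ EP (Ns π)) : u * v ∈ EP (Ns π) :=
  EP_mul (fun a ha b hb => by simp only [Zs, Ns, Set.mem_setOf_eq] at *; rw [map_add, ha, zero_add]; exact hb) hu hv

lemma Z_one {π : ℝ →+ ℝ} : (1 : ℝ → ℂ) ∈ EP (Zs π) := ef_z ▸ EP_ef (by simp [Zs])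

lemma Z_prod {π : ℝ →+ ℝ} (F : Finset ℕ) (R : ℕ → ℝ → ℂ) (h : ∀ p ∈ F, R p ∈ EP (Zs π)) : ∏ p ∈ F, R p ∈ EP (Zs π) := by
  classical
  induction F using Finset.induction_on with
  | empty => simpa using Z_one
  | insert a F ha ih =>
    rw [Finset.prod_insert ha]
    exact Z_mul (h a (by simp)) (ih fun p hp => h p (by simp [hp]))

lemma N_mean {π : ℝ →+ ℝ} {u : ℝ → ℂ} (hu : u ∈ EP (Ns π)) : MeanTo u 0 :=
  EP_mean_zero (by simp [Ns]) hu

lemma mean_prod (F : Finset ℕ) (π : ℕ → ℝ →+ ℝ) (R : ℕ → ℝ → ℂ)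
    (h1 : ∀ p ∈ F, ∀ q ∈ F, q ≠ p → R q ∈ EP (Zs (π p))) (h2 : ∀ p ∈ F, R p - 1 ∈ EP (Ns (π p)))
    (u : ℝ → ℂ) (hu : ∀ p ∈ F, u ∈ EP (Zs (π p))) (m : ℂ) (hm : MeanTo u m) : MeanTo (u * ∏ p ∈ F, R p) m := by
  classical
  induction F using Finset.induction_on with
  | empty => simpa using hm
  | insert a F ha ih =>
    rw [Finset.prod_insert ha]
    have i1 := ih (fun p hp q hq => h1 p (by simp [hp]) q (by simp [hq])) (fun p hp => h2 p (by simp [hp])) (fun p hp => hu p (by simp [hp]))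
    have i2 : (u * ∏ p ∈ F, R p) * (R a - 1) ∈ EP (Ns (π a)) := by
      refine ZN_mul (Z_mul (hu a (by simp)) (Z_prod _ _ fun p hp => h1 a (by simp) p (by simp [hp]) ?_)) (h2 a (by simp))
      rintro rfl; exact ha hp
    have := i1.add (N_mean i2)
    rw [add_zero] at this
    convert this using 1
    ring

open Classical in
noncomputable def Vf (d L : ℝ) : ℝ → ℂ :=
  (ef L + ef (-L)) + if d = 1 ∨ d = -1 then 0 else (ef (d*L) + ef (-(d*L)))

noncomputable def Rf (d c L : ℝ) : ℝ → ℂ := ef 0 + (c:ℂ) • Vf d L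

open Classical in
noncomputable def Rr (d c L t : ℝ) : ℝ := 1 + c * (2 * Real.cos (L*t) + if d = 1 ∨ d = -1 then 0 else 2 * Real.cos (d*L*t))

lemma ef_cos (L t : ℝ) : ef L t + ef (-L) t = ((2 * Real.cos (L*t) : ℝ) : ℂ) := by
  rw [ef, ef]
  push_cast
  rw [Complex.two_cos]
  congr 2 <;> ring_nf

lemma Rf_real (d c L t : ℝ) : Rf d c L t = ((Rr d c L t : ℝ):ℂ) := by
  simp only [Rf, Vf, Rr, Pi.add_apply, Pi.smul_apply, ef_zero, smul_eq_mul]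
  split_ifs with h
  · simp only [Pi.zero_apply]
    rw [ef_cos]; push_cast; ring
  · simp only [Pi.add_apply]
    rw [ef_cos, ef_cos]; push_cast; ring

lemma Rr_nonneg (d c L t : ℝ) (hc : |c| ≤ 1/4) : 0 ≤ Rr d c L t := by
  have : |c * (2 * Real.cos (L*t) + if d = 1 ∨ d = -1 then 0 else 2 * Real.cos (d*L*t))| ≤ 1/4 * 4 := by
    rw [abs_mul]
    refine mul_le_mul hc ?_ (abs_nonneg _) (by norm_num)
    have h1 := Real.abs_cos_le_one (L*t)
    have h2 := Real.abs_cos_le_one (d*L*t)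
    rw [abs_le] at *
    split_ifs <;> constructor <;> linarith [h1.1, h1.2, h2.1, h2.2]
  rw [abs_le] at this
  have := this.1
  unfold Rr
  linarith

lemma V_Z {π : ℝ →+ ℝ} (d L : ℝ) (h1 : π L = 0) (h2 : π (d*L) = 0) : Vf d L ∈ EP (Zs π) := by
  unfold Vf
  refine Submodule.add_mem _ (Submodule.add_mem _ (EP_ef (by simp [Zs, h1])) (EP_ef (by simp [Zs, h1]))) ?_
  split_ifs
  · exact Submodule.zero_mem _
  · exact (Submodule.add_mem _ (EP_ef (by simp [Zs, h2])) (EP_ef (by simp [Zs, h2])))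

lemma R_Z {π : ℝ →+ ℝ} (d c L : ℝ) (h1 : π L = 0) (h2 : π (d*L) = 0) : Rf d c L ∈ EP (Zs π) :=
  Submodule.add_mem _ (EP_ef (by simp [Zs])) (Submodule.smul_mem _ _ (V_Z d L h1 h2))

lemma V_N {π : ℝ →+ ℝ} (d L : ℝ) (hd : d ≠ 0) (h1 : π L = 1) (h2 : π (d*L) = d) : Vf d L ∈ EP (Ns π) := by
  unfold Vf
  refine Submodule.add_mem _ (Submodule.add_mem _ (EP_ef (by simp [Ns, h1])) (EP_ef (by simp [Ns, h1]))) ?_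
  split_ifs
  · exact Submodule.zero_mem _
  · exact (Submodule.add_mem _ (EP_ef (by simp [Ns, h2, hd])) (EP_ef (by simp [Ns, h2, hd])))

lemma R_sub {π : ℝ →+ ℝ} (d c L : ℝ) (hd : d ≠ 0) (h1 : π L = 1) (h2 : π (d*L) = d) : Rf d c L - 1 ∈ EP (Ns π) := by
  have : Rf d c L - 1 = (c:ℂ) • Vf d L := by rw [Rf, ef_z]; ring
  rw [this]
  exact Submodule.smul_mem _ _ (V_N d L hd h1 h2)

lemma V_mul {π : ℝ →+ ℝ} (d L e : ℝ) (hd : d ≠ 0) (h1 : π L = 1) (h2 : π (d*L) = d) (he : e = 1 ∨ e = d) :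
    Vf d L * ef (-(e*L)) - 1 ∈ EP (Ns π) := by
  have key : ∀ x y : ℝ, π x ≠ 0 → (ef x + ef (-x)) * ef (-x) - 1 ∈ EP (Ns π) := by
    intro x _ hx
    have : (ef x + ef (-x)) * ef (-x) - 1 = ef (-x + -x) := by
      rw [add_mul, ef_mul, ef_mul, add_neg_cancel, ef_z]; ring
    rw [this]
    refine EP_ef ?_
    simp only [Ns, Set.mem_setOf_eq, map_add, map_neg]
    intro h; apply hx; linarith
  have key' : ∀ x : ℝ, (ef x + ef (-x)) * ef x - 1 = ef (x + x) := by
    intro x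
    rw [add_mul, ef_mul, ef_mul, neg_add_cancel, ef_z]; ring
  have k2 : ∀ x y : ℝ, π x + π y ≠ 0 → π x - π y ≠ 0 → (ef x + ef (-x)) * ef (-y) ∈ EP (Ns π) := by
    intro x y h h'
    rw [add_mul, ef_mul, ef_mul]
    refine Submodule.add_mem _ (EP_ef ?_) (EP_ef ?_)
    · simp only [Ns, Set.mem_setOf_eq, map_add, map_neg]
      intro k; apply h'; linarith
    · simp only [Ns, Set.mem_setOf_eq, map_add, map_neg]
      intro k; apply h; linarith
  unfold Vf
  split_ifs with hh
  · rw [add_zero]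
    rcases he with rfl | rfl
    · rw [one_mul]; exact key L 0 (by rw [h1]; norm_num)
    · rcases hh with rfl | rfl
      · rw [one_mul]; exact key L 0 (by rw [h1]; norm_num)
      · rw [neg_one_mul, neg_neg, key']
        refine EP_ef ?_
        simp only [Ns, Set.mem_setOf_eq, map_add, h1]; norm_num
  · push Not at hh
    rcases he with rfl | rfl
    · rw [one_mul, add_mul, add_sub_right_comm]
      refine Submodule.add_mem _ (key L 0 (by rw [h1]; norm_num)) (k2 _ _ ?_ ?_)
      · rw [h1, h2]; intro h; apply hh.2; linarith
      · rw [h1, h2]; intro h; apply hh.1; linarith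
    · rw [add_mul, add_sub_assoc]
      refine Submodule.add_mem _ (k2 _ _ ?_ ?_) (key (e*L) 0 (by rw [h2]; exact hd))
      · rw [h1, h2]; intro h; apply hh.2; linarith
      · rw [h1, h2]; intro h; apply hh.1; linarith

lemma Rf_mulN {π : ℝ →+ ℝ} (d c L e : ℝ) (hd : d ≠ 0) (h1 : π L = 1) (h2 : π (d*L) = d) (he : e = 1 ∨ e = d) :
    Rf d c L * (ef (-(e*L)) - (c:ℂ) • ef 0) ∈ EP (Ns π) := by
  have : Rf d c L * (ef (-(e*L)) - (c:ℂ) • ef 0) = ef (-(e*L)) + (c:ℂ) • (Vf d L * ef (-(e*L)) - 1) - ((c:ℂ)*c) • Vf d L := by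
    rw [Rf, ef_z]
    ext t
    simp only [Pi.mul_apply, Pi.add_apply, Pi.sub_apply, Pi.smul_apply, smul_eq_mul, Pi.one_apply]
    ring
  rw [this]
  refine Submodule.sub_mem _ (Submodule.add_mem _ (EP_ef ?_) (Submodule.smul_mem _ _ (V_mul d L e hd h1 h2 he))) (Submodule.smul_mem _ _ (V_N d L hd h1 h2))
  simp only [Ns, Set.mem_setOf_eq, map_neg]
  rcases he with rfl | rfl
  · rw [one_mul, h1]; norm_num
  · rw [h2]; simpa using hd

lemma pi_log (π : ℝ →+ ℝ) (p : ℕ) (e x : ℝ) (h : ∀ q : ℕ, q.Prime → π (e * Real.log q) = if q = p then x else 0) (n : ℕ) (hn : n ≠ 0) :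
    π (e * Real.log n) = (n.factorization p : ℝ) * x := by
  classical
  induction n using Nat.recOnMul with
  | zero => exact absurd rfl hn
  | one => simp
  | prime q hq =>
    rw [h q hq, hq.factorization]
    by_cases hqp : q = p
    · simp [hqp]
    · simp [hqp]
  | mul a b ha hb =>
    have ha0 : a ≠ 0 := by rintro rfl; simp at hn
    have hb0 : b ≠ 0 := by rintro rfl; simp at hn
    rw [Nat.cast_mul, Real.log_mul (by exact_mod_cast ha0) (by exact_mod_cast hb0), mul_add, map_add, ha ha0, hb hb0, Nat.factorization_mul ha0 hb0]
    simp only [Finsupp.add_apply]; push_cast; ring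

theorem weight (d : ℝ) (hd : d ≠ 0) : ∃ Q0 : Finset ℕ, (∀ p ∈ Q0, p.Prime) ∧ ∀ Q F : Finset ℕ, Q0 ⊆ Q → (∀ p ∈ Q, p.Prime) →
    (∀ p ∈ F, p.Prime ∧ p ∉ Q) → ∀ c : ℕ → ℝ, (∀ p, |c p| ≤ 1/4) → ∀ N : ℕ, 1 ≤ N → ∃ (W : ℝ → ℝ) (A M : ℝ), 1 ≤ A ∧ Continuous W ∧
      (∀ t, 0 ≤ W t) ∧ (∀ t, W t ≤ M) ∧ MeanTo (fun t => (W t : ℂ)) (A:ℝ) ∧ ∀ e, e = 1 ∨ e = d →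
      ((∀ p ∈ Q, ∃ m : ℝ, m ≤ 4/N*A ∧ MeanTo (fun t => ((W t * ‖1 - ef (e * Real.log p) t‖^2 : ℝ):ℂ)) m) ∧
       (∀ p ∈ F, ∀ q ∈ F, p ≠ q → MeanTo (fun t => (W t : ℂ) * ((ef (-(e * Real.log p)) t - c p) * (starRingEnd ℂ) (ef (-(e * Real.log q)) t - c q))) 0) ∧
       (∀ n m : ℕ, n ≠ 0 → m ≠ 0 → n ≠ m → (∀ p ∈ Q ∪ F, ¬ p ∣ n) → (∀ p ∈ Q ∪ F, ¬ p ∣ m) →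
          MeanTo (fun t => (W t : ℂ) * (ef (-(e * Real.log n)) t * (starRingEnd ℂ) (ef (-(e * Real.log m)) t))) 0)) := by
  classical
  obtain ⟨Q0, hQ0⟩ := exists_coord d
  refine ⟨Q0.filter Nat.Prime, fun p hp => (Finset.mem_filter.1 hp).2, ?_⟩
  intro Q F hQQ hQ hF c hc N hN
  have hco : ∀ p : ℕ, ∃ π : ℝ →+ ℝ, p.Prime → p ∉ Q → ∀ q : ℕ, q.Prime → π (Real.log q) = (if q = p then 1 else 0) ∧ π (d * Real.log q) = (if q = p then d else 0) := by
    intro p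
    by_cases h : p.Prime ∧ p ∉ Q
    · obtain ⟨π, hπ⟩ := hQ0 p h.1 (fun h' => h.2 (hQQ (Finset.mem_filter.2 ⟨h', h.1⟩)))
      exact ⟨π, fun _ _ => hπ⟩
    · exact ⟨0, fun h1 h2 => absurd ⟨h1, h2⟩ h⟩
  choose π hπ using hco
  set l : ℕ × Bool → ℝ := fun x => if x.2 then d * Real.log x.1 else Real.log x.1 with hl
  set J : Finset (ℕ × Bool) := Q ×ˢ (Finset.univ : Finset Bool) with hJ
  obtain ⟨A, hA1, hAm, hAb⟩ := W0_spec J l N hN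
  set R : ℕ → ℝ → ℂ := fun p => Rf d (c p) (Real.log p) with hR
  set U : ℝ → ℂ := fun t => ((W0 J l N t : ℝ) : ℂ) with hU
  -- memberships
  have hUZ : ∀ p : ℕ, p.Prime → p ∉ Q → U ∈ EP (Zs (π p)) := by
    intro p hp hpQ
    have : U ∈ EP (((π p).ker : AddSubgroup ℝ) : Set ℝ) := by
      refine W0_EP J l N _ ?_
      rintro ⟨q, b⟩ hq
      have hq1 : q ∈ Q := (Finset.mem_product.1 hq).1
      have hqp : q ≠ p := by rintro rfl; exact hpQ hq1
      have h := hπ p hp hpQ q (hQ q hq1)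
      rw [AddMonoidHom.mem_ker]
      cases b
      · simp [hl, h.1, hqp]
      · simp [hl, h.2, hqp]
    exact EP_mono (fun x hx => by simpa [Zs] using hx) this
  have hRZ : ∀ p : ℕ, p.Prime → p ∉ Q → ∀ q : ℕ, q.Prime → q ≠ p → R q ∈ EP (Zs (π p)) := by
    intro p hp hpQ q hq hqp
    have h := hπ p hp hpQ q hq
    exact R_Z _ _ _ (by rw [h.1, if_neg hqp]) (by rw [h.2, if_neg hqp])
  have hself : ∀ p : ℕ, p.Prime → p ∉ Q → π p (Real.log p) = 1 ∧ π p (d * Real.log p) = d := by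
    intro p hp hpQ
    have h := hπ p hp hpQ p hp
    simpa using h
  have hR1 : ∀ p ∈ F, ∀ q ∈ F, q ≠ p → R q ∈ EP (Zs (π p)) := fun p hp q hq h => hRZ p (hF p hp).1 (hF p hp).2 q (hF q hq).1 h
  have hR2 : ∀ p ∈ F, R p - 1 ∈ EP (Ns (π p)) := fun p hp => by
    have := hself p (hF p hp).1 (hF p hp).2
    exact R_sub _ _ _ hd this.1 this.2
  set W : ℝ → ℝ := fun t => W0 J l N t * ∏ p ∈ F, Rr d (c p) (Real.log p) t with hW
  have hWc : (fun t => (W t : ℂ)) = U * ∏ p ∈ F, R p := by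
    ext t
    simp only [hW, hU, hR, Pi.mul_apply, Finset.prod_apply, Rf_real]
    push_cast; rfl
  have hmean : MeanTo (fun t => (W t : ℂ)) (A:ℝ) := by
    rw [hWc]
    exact mean_prod F π R hR1 hR2 U (fun p hp => hUZ p (hF p hp).1 (hF p hp).2) _ hAm
  have hWEP : ∃ S : Set ℝ, (fun t => (W t : ℂ)) ∈ EP S := by
    refine ⟨Set.univ, ?_⟩
    rw [hWc]
    have h1 : ∀ G : Finset ℕ, ∏ p ∈ G, R p ∈ EP Set.univ := by
      intro G
      induction G using Finset.induction_on with
      | empty => rw [Finset.prod_empty, ← ef_z]; exact EP_ef trivial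
      | insert a G ha ih =>
        rw [Finset.prod_insert ha]
        refine EP_mul (S := Set.univ) (S' := Set.univ) (S'' := Set.univ) (fun _ _ _ _ => trivial) ?_ ih
        refine Submodule.add_mem _ (EP_ef trivial) (Submodule.smul_mem _ _ ?_)
        unfold Vf
        refine Submodule.add_mem _ (Submodule.add_mem _ (EP_ef trivial) (EP_ef trivial)) ?_
        split_ifs
        · exact Submodule.zero_mem _
        · exact (Submodule.add_mem _ (EP_ef trivial) (EP_ef trivial))
    exact EP_mul (S := Set.univ) (S' := Set.univ) (S'' := Set.univ) (fun _ _ _ _ => trivial) (W0_EP J l N ⊤ (fun _ _ => trivial)) (h1 F)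
  obtain ⟨S, hS⟩ := hWEP
  obtain ⟨M, hM⟩ := EP_bdd hS
  have hW0 : ∀ t, 0 ≤ W t := fun t => mul_nonneg (W0_nonneg _ _ _ _) (Finset.prod_nonneg fun p _ => Rr_nonneg _ _ _ _ (hc p))
  refine ⟨W, A, M, hA1, ?_, hW0, ?_, hmean, ?_⟩
  · have := Complex.continuous_re.comp hmean.1
    exact this
  · intro t
    have := hM t
    rw [Complex.norm_real, Real.norm_eq_abs] at this
    exact (le_abs_self _).trans this
  intro e he
  refine ⟨?_, ?_, ?_⟩
  · intro p hp
    set L := e * Real.log p with hL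
    have hpJ : ∃ i ∈ J, l i = L := by
      rcases he with h | h
      · exact ⟨(p, false), by simp [hJ, hp], by simp [hl, hL, h]⟩
      · exact ⟨(p, true), by simp [hJ, hp], by simp [hl, hL, h]⟩
    obtain ⟨i, hiJ, hi⟩ := hpJ
    set u : ℝ → ℂ := fun t => ((W0 J l N t * ‖1 - ef L t‖^2 : ℝ):ℂ) with hu
    have hu2 : u = U * (fun t => ((‖1 - ef L t‖^2 : ℝ):ℂ)) := by ext t; simp [hu, hU]
    have huZ : ∀ q ∈ F, u ∈ EP (Zs (π q)) := by
      intro q hq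
      have hqp : p ≠ q := by rintro rfl; exact (hF p hq).2 hp
      have h := hπ q (hF q hq).1 (hF q hq).2 p (hQ p hp)
      have hL0 : π q L = 0 := by
        rw [hL]
        rcases he with h' | h'
        · rw [h', one_mul, h.1, if_neg hqp]
        · rw [h', h.2, if_neg hqp]
      rw [hu2]
      exact Z_mul (hUZ q (hF q hq).1 (hF q hq).2) (sq_EP L _ (by simp [Zs]) hL0 (by simp [Zs, hL0]))
    have hex : ∃ m, MeanTo u m := by
      refine EP_mean (S := Set.univ) ?_
      rw [hu2]
      exact EP_mul (S := Set.univ) (S' := Set.univ) (S'' := Set.univ) (fun _ _ _ _ => trivial) (W0_EP J l N ⊤ (fun _ _ => trivial)) (sq_EP L _ trivial trivial trivial)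
    obtain ⟨m, hm⟩ := hex
    have hm' := MeanTo_real hm
    refine ⟨m.re, hAb i hiJ m.re (by rw [hi]; exact hm'), ?_⟩
    have := mean_prod F π R hR1 hR2 u huZ _ hm'
    convert this using 1
    ext t
    simp only [hW, hu, hR, Pi.mul_apply, Finset.prod_apply, Rf_real]
    push_cast; ring
  · intro p hp q hq hpq
    have h := hπ p (hF p hp).1 (hF p hp).2
    have hs := hself p (hF p hp).1 (hF p hp).2
    have hL0 : π p (e * Real.log q) = 0 := by
      rcases he with h' | h'
      · rw [h', one_mul, (h q (hF q hq).1).1, if_neg (Ne.symm hpq)]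
      · rw [h', (h q (hF q hq).1).2, if_neg (Ne.symm hpq)]
    have e1 : (fun t => (W t : ℂ) * ((ef (-(e * Real.log p)) t - c p) * (starRingEnd ℂ) (ef (-(e * Real.log q)) t - c q))) =
        (U * (∏ r ∈ F.erase p, R r) * (ef (e * Real.log q) - (c q : ℂ) • ef 0)) * (R p * (ef (-(e * Real.log p)) - (c p:ℂ) • ef 0)) := by
      ext t
      have : (W t : ℂ) = (U * ∏ p ∈ F, R p) t := congrFun hWc t
      rw [this, ← Finset.mul_prod_erase F R hp]
      simp only [Pi.mul_apply, Pi.sub_apply, Pi.smul_apply, smul_eq_mul, ef_zero, map_sub, ef_conj, neg_neg, Complex.conj_ofReal]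
      ring
    rw [e1]
    refine N_mean (π := π p) (ZN_mul (Z_mul (Z_mul (hUZ p (hF p hp).1 (hF p hp).2) (Z_prod _ _ fun r hr => ?_)) ?_) ?_)
    · exact hR1 p hp r (Finset.mem_of_mem_erase hr) (Finset.ne_of_mem_erase hr)
    · exact Submodule.sub_mem _ (EP_ef hL0) (Submodule.smul_mem _ _ (EP_ef (by simp [Zs])))
    · exact Rf_mulN d (c p) _ e hd hs.1 hs.2 he
  · intro n m hn hm hnm hnP hmP
    have hex : ∃ p : ℕ, n.factorization p ≠ m.factorization p := by
      by_contra hh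
      push Not at hh
      exact hnm (Nat.eq_of_factorization_eq hn hm hh)
    obtain ⟨p, hpne⟩ := hex
    have hpp : p.Prime := by
      by_contra hh
      apply hpne
      rw [Nat.factorization_eq_zero_of_not_prime _ hh, Nat.factorization_eq_zero_of_not_prime _ hh]
    have hpP : p ∉ Q ∪ F := by
      intro hh
      apply hpne
      rw [Nat.factorization_eq_zero_of_not_dvd (hnP p hh), Nat.factorization_eq_zero_of_not_dvd (hmP p hh)]
    have hpQ : p ∉ Q := fun h => hpP (Finset.mem_union_left _ h)
    have hpF : p ∉ F := fun h => hpP (Finset.mem_union_right _ h)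
    have h := hπ p hpp hpQ
    have hx : ∃ x : ℝ, x ≠ 0 ∧ ∀ q : ℕ, q.Prime → π p (e * Real.log q) = if q = p then x else 0 := by
      rcases he with h' | h'
      · exact ⟨1, one_ne_zero, fun q hq => by rw [h', one_mul, (h q hq).1]⟩
      · exact ⟨d, hd, fun q hq => by rw [h', (h q hq).2]⟩
    obtain ⟨x, hx0, hx⟩ := hx
    have e1 : (fun t => (W t : ℂ) * (ef (-(e * Real.log n)) t * (starRingEnd ℂ) (ef (-(e * Real.log m)) t))) =
        (U * (∏ r ∈ F, R r)) * ef (-(e * Real.log n) + e * Real.log m) := by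
      ext t
      have : (W t : ℂ) = (U * ∏ p ∈ F, R p) t := congrFun hWc t
      rw [this]
      simp only [Pi.mul_apply, ef_conj, neg_neg, ef_add]
    rw [e1]
    refine N_mean (π := π p) (ZN_mul (Z_mul (hUZ p hpp hpQ) (Z_prod _ _ fun r hr => ?_)) (EP_ef ?_))
    · refine hRZ p hpp hpQ r (hF r hr).1 ?_
      rintro rfl; exact hpF hr
    · simp only [Ns, Set.mem_setOf_eq, map_add, map_neg, pi_log (π p) p e x hx n hn, pi_log (π p) p e x hx m hm]
      intro hh
      have : ((n.factorization p : ℝ) - m.factorization p) * x = 0 := by linarith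
      rcases mul_eq_zero.1 this with h3 | h3
      · exact hpne (by exact_mod_cast sub_eq_zero.1 h3)
      · exact hx0 h3

def MB (u : ℝ → ℝ) (b : ℝ) : Prop :=
  Continuous u ∧ ∀ η : ℝ, 0 < η → ∃ T1 : ℝ, 0 < T1 ∧ ∀ T, T1 ≤ T → ∫ t in (0:ℝ)..T, u t ≤ (b + η) * T

lemma MB.add {u v : ℝ → ℝ} {b c : ℝ} (h : MB u b) (k : MB v c) : MB (fun t => u t + v t) (b + c) := by
  refine ⟨h.1.add k.1, fun η hη => ?_⟩
  obtain ⟨T1, hT1, h1⟩ := h.2 (η/2) (by linarith)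
  obtain ⟨T2, hT2, h2⟩ := k.2 (η/2) (by linarith)
  refine ⟨max T1 T2, lt_max_of_lt_left hT1, fun T hT => ?_⟩
  rw [intervalIntegral.integral_add (h.1.intervalIntegrable _ _) (k.1.intervalIntegrable _ _)]
  have a1 := h1 T ((le_max_left _ _).trans hT)
  have a2 := h2 T ((le_max_right _ _).trans hT)
  calc _ ≤ _ := add_le_add a1 a2
    _ = _ := by ring

lemma MB.mono {u v : ℝ → ℝ} {b c : ℝ} (h : MB v b) (hu : Continuous u) (huv : ∀ t, u t ≤ v t) (hbc : b ≤ c) : MB u c := by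
  refine ⟨hu, fun η hη => ?_⟩
  obtain ⟨T1, hT1, h1⟩ := h.2 η hη
  refine ⟨T1, hT1, fun T hT => ?_⟩
  have hT0 : 0 ≤ T := hT1.le.trans hT
  have := intervalIntegral.integral_mono_on (μ := volume) hT0 (hu.intervalIntegrable _ _) (h.1.intervalIntegrable _ _) (fun t _ => huv t)
  refine this.trans ((h1 T hT).trans ?_)
  exact mul_le_mul_of_nonneg_right (by linarith) hT0

lemma MB.smul {u : ℝ → ℝ} {b : ℝ} (h : MB u b) (c : ℝ) (hc : 0 ≤ c) : MB (fun t => c * u t) (c * b) := by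
  refine ⟨h.1.const_mul c, fun η hη => ?_⟩
  obtain ⟨T1, hT1, h1⟩ := h.2 (η/(c+1)) (by positivity)
  refine ⟨T1, hT1, fun T hT => ?_⟩
  have hT0 : 0 ≤ T := hT1.le.trans hT
  rw [intervalIntegral.integral_const_mul]
  refine (mul_le_mul_of_nonneg_left (h1 T hT) hc).trans ?_
  rw [← mul_assoc]
  refine mul_le_mul_of_nonneg_right ?_ hT0
  rw [mul_add]
  have : c * (η/(c+1)) ≤ η := by
    rw [mul_div_assoc', div_le_iff₀ (by positivity)]; nlinarith
  linarith

lemma MB_zero : MB (fun _ => 0) 0 := ⟨continuous_const, fun η hη => ⟨1, one_pos, fun T hT => by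
  simp; positivity⟩⟩

lemma MB.sum {ι : Type} (s : Finset ι) {u : ι → ℝ → ℝ} {b : ι → ℝ} (h : ∀ i ∈ s, MB (u i) (b i)) :
    MB (fun t => ∑ i ∈ s, u i t) (∑ i ∈ s, b i) := by
  classical
  induction s using Finset.induction_on with
  | empty => simpa using MB_zero
  | insert a s ha ih =>
    simp only [Finset.sum_insert ha]
    exact (h a (by simp)).add (ih fun i hi => h i (by simp [hi]))

lemma MB_re {u : ℝ → ℂ} {m : ℂ} (h : MeanTo u m) : MB (fun t => (u t).re) m.re := by
  refine ⟨Complex.continuous_re.comp h.1, fun η hη => ?_⟩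
  have h1 := (Complex.continuous_re.tendsto _).comp h.2
  have h2 := h1.eventually (gt_mem_nhds (lt_add_of_pos_right m.re hη))
  obtain ⟨T1, hT1⟩ := eventually_atTop.1 h2
  refine ⟨max T1 1, lt_max_of_lt_right one_pos, fun T hT => ?_⟩
  have hT0 : 0 < T := lt_of_lt_of_le (lt_max_of_lt_right one_pos) hT
  have := hT1 T ((le_max_left _ _).trans hT)
  simp only [Function.comp] at this
  rw [Complex.div_ofReal_re, div_lt_iff₀ hT0] at this
  refine le_trans (le_of_eq ?_) this.le
  have := Complex.reCLM.intervalIntegral_comp_comm (μ := volume) (h.1.intervalIntegrable 0 T)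
  simpa using this

lemma MB_real {u : ℝ → ℝ} {m : ℝ} (h : MeanTo (fun t => (u t : ℂ)) m) : MB u m := by
  simpa using MB_re h

lemma quad {ι : Type} (s : Finset ι) (D : Set ℂ) (hD : IsCompact D) (φ : ι → ℂ → ℂ) (hφ : ∀ i ∈ s, ContinuousOn (φ i) D)
    (g : ι → ℝ → ℂ) (hg : ∀ i, Continuous (g i)) (hg4 : ∀ i ∈ s, ∀ t, ‖g i t‖^2 ≤ 4) (W : ℝ → ℝ) (hW0 : ∀ t, 0 ≤ W t) (A : ℝ)
    (hWm : MeanTo (fun t => (W t : ℂ)) (A:ℝ))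
    (hoff : ∀ i ∈ s, ∀ j ∈ s, i ≠ j → MeanTo (fun t => (W t : ℂ) * (g i t * (starRingEnd ℂ) (g j t))) 0) :
    MB (fun t => W t * ∫ z in D, ‖∑ i ∈ s, φ i z * g i t‖^2) (4 * A * ∑ i ∈ s, ∫ z in D, ‖φ i z‖^2) := by
  classical
  set a : ι → ι → ℂ := fun i j => ∫ z in D, φ i z * (starRingEnd ℂ) (φ j z) with ha
  have hint : ∀ i ∈ s, ∀ j ∈ s, IntegrableOn (fun z => φ i z * (starRingEnd ℂ) (φ j z)) D := by
    intro i hi j hj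
    exact ((hφ i hi).mul (Complex.continuous_conj.comp_continuousOn (hφ j hj))).integrableOn_compact hD
  have haii : ∀ i, a i i = ((∫ z in D, ‖φ i z‖^2 : ℝ) : ℂ) := by
    intro i
    simp only [ha]
    rw [← integral_complex_ofReal]
    congr 1; ext z
    rw [Complex.mul_conj']; push_cast; rfl
  have key : ∀ t, ((∫ z in D, ‖∑ i ∈ s, φ i z * g i t‖^2 : ℝ) : ℂ) = ∑ i ∈ s, ∑ j ∈ s, a i j * (g i t * (starRingEnd ℂ) (g j t)) := by
    intro t
    rw [← integral_complex_ofReal]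
    have e : ∀ z, (((‖∑ i ∈ s, φ i z * g i t‖^2 : ℝ)) : ℂ) = ∑ i ∈ s, ∑ j ∈ s, (φ i z * (starRingEnd ℂ) (φ j z)) * (g i t * (starRingEnd ℂ) (g j t)) := by
      intro z
      push_cast
      rw [← Complex.mul_conj', map_sum, Finset.sum_mul_sum]
      refine Finset.sum_congr rfl fun i _ => Finset.sum_congr rfl fun j _ => ?_
      rw [map_mul]; ring
    simp only [e]
    rw [integral_finsetSum _ (fun i hi => integrable_finsetSum _ fun j hj => (hint i hi j hj).mul_const _)]
    refine Finset.sum_congr rfl fun i hi => ?_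
    rw [integral_finsetSum _ (fun j hj => (hint i hi j hj).mul_const _)]
    refine Finset.sum_congr rfl fun j hj => ?_
    rw [integral_mul_const]
  have hcont : Continuous (fun t => W t * ∫ z in D, ‖∑ i ∈ s, φ i z * g i t‖^2) := by
    have hWc : Continuous W := Complex.continuous_re.comp hWm.1
    refine hWc.mul ?_
    have : Continuous (fun t => (((∫ z in D, ‖∑ i ∈ s, φ i z * g i t‖^2 : ℝ) : ℂ)).re) := by
      simp only [key]
      refine Complex.continuous_re.comp ?_
      refine continuous_finsetSum _ fun i _ => continuous_finsetSum _ fun j _ => ?_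
      exact continuous_const.mul ((hg i).mul (Complex.continuous_conj.comp (hg j)))
    simpa using this
  set O : ℝ → ℂ := ∑ i ∈ s, ∑ j ∈ s.erase i, (a i j) • (fun t => (W t : ℂ) * (g i t * (starRingEnd ℂ) (g j t))) with hO
  have hsum : ∀ {κ : Type} (S : Finset κ) (f : κ → ℝ → ℂ), (∀ i ∈ S, MeanTo (f i) 0) → MeanTo (∑ i ∈ S, f i) 0 := by
    intro κ S f h
    induction S using Finset.induction_on with
    | empty => simpa using MeanTo_zero
    | insert x S hx ih =>
      rw [Finset.sum_insert hx]
      have := (h x (by simp)).add (ih fun i hi => h i (by simp [hi]))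
      simpa using this
  have hO0 : MeanTo O 0 := by
    refine hsum _ _ fun i hi => hsum _ _ fun j hj => ?_
    have := (hoff i hi j (Finset.mem_of_mem_erase hj) (Finset.ne_of_mem_erase hj).symm).smul (a i j)
    simpa using this
  have m1 := (MB_real hWm).smul (4 * ∑ i ∈ s, ∫ z in D, ‖φ i z‖^2) (by
    refine mul_nonneg (by norm_num) (Finset.sum_nonneg fun i _ => integral_nonneg fun z => by positivity))
  have m2 := m1.add (MB_re hO0)
  refine m2.mono hcont (fun t => ?_) (by simp; apply le_of_eq; ring)
  have e1 : ((W t * ∫ z in D, ‖∑ i ∈ s, φ i z * g i t‖^2 : ℝ) : ℂ) = ((∑ i ∈ s, W t * ((∫ z in D, ‖φ i z‖^2) * ‖g i t‖^2) : ℝ) : ℂ) + O t := by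
    rw [Complex.ofReal_mul, key]
    simp only [hO, Finset.sum_apply, Pi.smul_apply, smul_eq_mul]
    push_cast
    rw [Finset.mul_sum, ← Finset.sum_add_distrib]
    refine Finset.sum_congr rfl fun i hi => ?_
    rw [← Finset.add_sum_erase s _ hi, mul_add, Finset.mul_sum, haii]
    rw [Complex.mul_conj']
    congr 1
    refine Finset.sum_congr rfl fun j hj => ?_
    ring
  have e2 := congrArg Complex.re e1
  rw [Complex.add_re, Complex.ofReal_re, Complex.ofReal_re] at e2
  rw [e2]
  refine add_le_add ?_ le_rfl
  rw [mul_assoc, Finset.sum_mul, Finset.mul_sum]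
  refine Finset.sum_le_sum fun i hi => ?_
  have hn : 0 ≤ ∫ z in D, ‖φ i z‖^2 := integral_nonneg fun z => by positivity
  have := mul_le_mul_of_nonneg_left (hg4 i hi t) (mul_nonneg (hW0 t) hn)
  calc _ = (W t * ∫ z in D, ‖φ i z‖^2) * ‖g i t‖^2 := by ring
    _ ≤ _ := this
    _ = _ := by ring

lemma markov (W E : ℝ → ℝ) (A M b ε0 : ℝ) (hA : 1 ≤ A) (hW0 : ∀ t, 0 ≤ W t) (hWM : ∀ t, W t ≤ M)
    (hWm : MeanTo (fun t => (W t : ℂ)) (A:ℝ)) (hEc : Continuous E) (hE0 : ∀ t, 0 ≤ E t) (hε : 0 < ε0)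
    (hMB : MB (fun t => W t * E t) b) (hb : b < ε0 * A / 2) :
    ∃ δ > 0, ∃ T1 > 0, ∀ T, T1 ≤ T → δ * T ≤ (volume ({t | E t ≤ ε0} ∩ Set.Icc 0 T)).toReal := by
  have hWc : Continuous W := Complex.continuous_re.comp hWm.1
  obtain ⟨T1, hT1, h1⟩ := hMB.2 (ε0 * A / 2 - b) (by linarith)
  have h2 := (MeanTo_re hWm).eventually (lt_mem_nhds (show 3/4 * A < A by linarith))
  obtain ⟨T2, hT2⟩ := eventually_atTop.1 h2
  have hM : 0 < M + 1 := by have := (hW0 0).trans (hWM 0); linarith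
  refine ⟨A/4/(M+1), by positivity, max T1 T2, lt_max_of_lt_left hT1, fun T hT => ?_⟩
  have hT0 : 0 < T := lt_of_lt_of_le (lt_max_of_lt_left hT1) hT
  have a1 := h1 T ((le_max_left _ _).trans hT)
  have a2 := hT2 T ((le_max_right _ _).trans hT)
  rw [lt_div_iff₀ hT0] at a2
  set S := {t | E t ≤ ε0} with hS
  have hSm : MeasurableSet S := (isClosed_le hEc continuous_const).measurableSet
  have hfin : volume (S ∩ Set.Ioc 0 T) < ⊤ := lt_of_le_of_lt (measure_mono Set.inter_subset_right) (by simp)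
  have hle : ∀ t, W t ≤ S.indicator (fun _ => M + 1) t + (1/ε0) * (W t * E t) := by
    intro t
    by_cases ht : t ∈ S
    · rw [Set.indicator_of_mem ht]
      have : 0 ≤ (1/ε0) * (W t * E t) := by have := hW0 t; have := hE0 t; positivity
      linarith [hWM t]
    · rw [Set.indicator_of_notMem ht, zero_add]
      have : ε0 < E t := not_le.1 ht
      rw [one_div, inv_mul_eq_div, le_div_iff₀ hε]
      exact mul_le_mul_of_nonneg_left this.le (hW0 t)
  have hi1 : IntervalIntegrable (S.indicator (fun _ => M + 1)) volume 0 T := by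
    rw [intervalIntegrable_iff_integrableOn_Ioc_of_le hT0.le, IntegrableOn]
    exact (integrable_const _).indicator hSm
  have a3 := intervalIntegral.integral_mono_on (μ := volume) hT0.le (hWc.intervalIntegrable _ _)
    (hi1.add ((hMB.1.const_mul (1/ε0)).intervalIntegrable _ _)) (fun t _ => hle t)
  rw [intervalIntegral.integral_add hi1 ((hMB.1.const_mul (1/ε0)).intervalIntegrable _ _), intervalIntegral.integral_const_mul] at a3
  have a4 : ∫ t in (0:ℝ)..T, S.indicator (fun _ => M + 1) t = (volume (S ∩ Set.Ioc 0 T)).toReal * (M+1) := by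
    rw [intervalIntegral.integral_of_le hT0.le, integral_indicator hSm, setIntegral_const, Measure.real, Measure.restrict_apply hSm]
    simp
  have a5 : (volume (S ∩ Set.Ioc 0 T)).toReal ≤ (volume (S ∩ Set.Icc 0 T)).toReal := by
    refine ENNReal.toReal_mono (lt_of_le_of_lt (measure_mono Set.inter_subset_right) (by simp)).ne ?_
    exact measure_mono (Set.inter_subset_inter_right _ Set.Ioc_subset_Icc_self)
  have a6 : (1/ε0) * ∫ t in (0:ℝ)..T, W t * E t ≤ A/2 * T := by
    rw [one_div, inv_mul_eq_div, div_le_iff₀ hε]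
    refine a1.trans (le_of_eq ?_); ring
  rw [a4] at a3
  rw [div_mul_eq_mul_div, div_le_iff₀ hM]
  have a7 := mul_le_mul_of_nonneg_right a5 hM.le
  linarith

noncomputable def clampZ (a b : ℝ) (z : ℂ) : ℂ := ((max a (min b z.re) : ℝ) : ℂ) + (z.im : ℂ) * I

lemma clampZ_cont (a b : ℝ) : Continuous (clampZ a b) := by
  unfold clampZ
  refine (Complex.continuous_ofReal.comp (continuous_const.max (continuous_const.min Complex.continuous_re))).add ?_
  exact (Complex.continuous_ofReal.comp Complex.continuous_im).mul continuous_const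

lemma clampZ_eq (a b : ℝ) (z : ℂ) (h1 : a ≤ z.re) (h2 : z.re ≤ b) : clampZ a b z = z := by
  unfold clampZ
  rw [min_eq_right h2, max_eq_right h1, Complex.re_add_im]

lemma exists_ext (a b : ℝ) (ha : 0 < a) (hab : a ≤ b) (hb : b < 1) (H : ℂ → ℂ) (hH : ContinuousOn H {s : ℂ | 0 < s.re ∧ s.re < 1}) :
    ∃ H' : ℂ → ℂ, Continuous H' ∧ ∀ z : ℂ, a ≤ z.re → z.re ≤ b → H' z = H z := by
  refine ⟨fun z => H (clampZ a b z), ?_, fun z h1 h2 => by simp only [clampZ_eq a b z h1 h2]⟩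
  refine hH.comp_continuous (clampZ_cont a b) fun z => ?_
  have : (clampZ a b z).re = max a (min b z.re) := by simp [clampZ]
  simp only [Set.mem_setOf_eq, this]
  refine ⟨lt_max_of_lt_left ha, max_lt (by linarith) ((min_le_left _ _).trans_lt hb)⟩

lemma param_eq (a b T0 : ℝ) (H H' : ℂ → ℂ) (h : ∀ z : ℂ, a ≤ z.re → z.re ≤ b → H' z = H z) (t : ℝ) :
    ∫ z in Rect a b T0, ‖H (z + t * I)‖^2 = ∫ z in Rect a b T0, ‖H' (z + t * I)‖^2 := by
  refine setIntegral_congr_fun (Rect_compact a b T0).measurableSet fun z hz => ?_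
  rw [h _ (by simpa using hz.1) (by simpa using hz.2.1)]

lemma param_cont (a b T0 : ℝ) (ha : 0 < a) (hab : a ≤ b) (hb : b < 1) (H : ℂ → ℂ) (hH : ContinuousOn H {s : ℂ | 0 < s.re ∧ s.re < 1}) :
    Continuous (fun t : ℝ => ∫ z in Rect a b T0, ‖H (z + t * I)‖^2) := by
  obtain ⟨H', hc, he⟩ := exists_ext a b ha hab hb H hH
  simp only [param_eq a b T0 H H' he]
  refine continuous_parametric_integral_of_continuous ?_ (Rect_compact a b T0)
  simp only [Function.uncurry_def]
  fun_prop

lemma param_fub (a b T0 : ℝ) (ha : 0 < a) (hab : a ≤ b) (hb : b < 1) (H : ℂ → ℂ) (hH : ContinuousOn H {s : ℂ | 0 < s.re ∧ s.re < 1})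
    (T B : ℝ) (hT : 0 ≤ T) (hB : ∀ z ∈ Rect a b T0, ∫ t in (-T)..T, ‖H (z + t * I)‖^2 ≤ B) :
    ∫ t in (-T)..T, (∫ z in Rect a b T0, ‖H (z + t * I)‖^2) ≤ (volume (Rect a b T0)).toReal * B := by
  obtain ⟨H', hc, he⟩ := exists_ext a b ha hab hb H hH
  simp only [param_eq a b T0 H H' he]
  have hle : -T ≤ T := by linarith
  rw [intervalIntegral.integral_of_le hle, ← integral_Icc_eq_integral_Ioc]
  have hcont : Continuous (Function.uncurry (fun (t : ℝ) (z : ℂ) => ‖H' (z + t * I)‖^2)) := by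
    simp only [Function.uncurry_def]
    fun_prop
  rw [integral_integral_swap]
  · have hB' : ∀ z ∈ Rect a b T0, ∫ t in Set.Icc (-T) T, ‖H' (z + t * I)‖^2 ≤ B := by
      intro z hz
      refine le_trans (le_of_eq ?_) (hB z hz)
      rw [intervalIntegral.integral_of_le hle, ← integral_Icc_eq_integral_Ioc]
      congr 1; ext t
      rw [he _ (by simpa using hz.1) (by simpa using hz.2.1)]
    have hci : Continuous (fun z : ℂ => ∫ t in Set.Icc (-T) T, ‖H' (z + t * I)‖^2) := by
      refine continuous_parametric_integral_of_continuous ?_ isCompact_Icc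
      simp only [Function.uncurry_def]
      fun_prop
    refine (setIntegral_mono_on (hci.continuousOn.integrableOn_compact (Rect_compact a b T0))
      (integrableOn_const (Rect_compact a b T0).measure_lt_top.ne) (Rect_compact a b T0).measurableSet hB').trans ?_
    rw [setIntegral_const]; simp [Measure.real]
  · rw [Measure.prod_restrict]
    exact hcont.continuousOn.integrableOn_compact (isCompact_Icc.prod (Rect_compact a b T0))

lemma MS_MB {a b T0 : ℝ} (ha : 0 < a) (hab : a ≤ b) (hb : b < 1) {F : ℕ → ℂ → ℂ} (hF : MS a b T0 F) (η : ℝ) (hη : 0 < η) :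
    ∃ Y0 : ℕ, ∀ Y : ℕ, Y0 ≤ Y → ∀ e : ℝ, e ≠ 0 → MB (fun t => ∫ z in Rect a b T0, ‖F Y (z + (e * t : ℝ) * I)‖^2) η := by
  set V := (volume (Rect a b T0)).toReal with hV
  have hV0 : 0 ≤ V := ENNReal.toReal_nonneg
  obtain ⟨Y0, hY0⟩ := hF.2 (η/(V+1)) (by positivity)
  refine ⟨Y0, fun Y hY e he => ?_⟩
  obtain ⟨T1, hT1, h1⟩ := hY0 Y hY
  have hc := param_cont a b T0 ha hab hb (F Y) (hF.1 Y)
  set ψ : ℝ → ℝ := fun t : ℝ => ∫ z in Rect a b T0, ‖F Y (z + t * I)‖^2 with hψ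
  have hψ0 : ∀ t, 0 ≤ ψ t := fun t => integral_nonneg fun z => by positivity
  have hae : 0 < |e| := abs_pos.2 he
  refine ⟨hc.comp (continuous_const.mul continuous_id), fun η' hη' => ⟨T1/|e|, by positivity, fun T hT => ?_⟩⟩
  have hT' : T1 ≤ |e| * T := by rwa [div_le_iff₀ hae, mul_comm] at hT
  have hT0 : 0 < T := lt_of_lt_of_le (by positivity) hT
  have k1 := param_fub a b T0 ha hab hb (F Y) (hF.1 Y) (|e| * T) (η/(V+1)*(|e| * T)) (by positivity) (fun z hz => h1 _ hT' z hz.1 hz.2.1 hz.2.2)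
  have k2 : ∫ t in (0:ℝ)..T, ψ (e * t) ≤ |e|⁻¹ * ∫ t in (-(|e| * T))..(|e| * T), ψ t := by
    have hint : IntervalIntegrable ψ volume (-(|e| * T)) (|e| * T) := hc.intervalIntegrable _ _
    have hp : 0 ≤ |e| * T := by positivity
    rw [intervalIntegral.integral_comp_mul_left ψ he, mul_zero, smul_eq_mul]
    rcases lt_or_gt_of_ne he with h | h
    · rw [abs_of_neg h] at *
      rw [intervalIntegral.integral_symm, mul_neg, ← neg_mul, ← inv_neg]
      refine mul_le_mul_of_nonneg_left ?_ (by positivity)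
      exact intervalIntegral.integral_mono_interval (by linarith) (by linarith) (by linarith) (Eventually.of_forall hψ0) hint
    · rw [abs_of_pos h] at *
      refine mul_le_mul_of_nonneg_left ?_ (by positivity)
      exact intervalIntegral.integral_mono_interval (by linarith) (by linarith) (by linarith) (Eventually.of_forall hψ0) hint
  refine k2.trans ((mul_le_mul_of_nonneg_left k1 (by positivity)).trans ?_)
  have : |e|⁻¹ * (V * (η/(V+1)*(|e| * T))) = (V * η/(V+1)) * T := by field_simp
  rw [this]
  refine mul_le_mul_of_nonneg_right ?_ hT0.le
  have : V * η/(V+1) ≤ η := by rw [div_le_iff₀ (by positivity)]; nlinarith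
  linarith

lemma int_npow (a b T0 : ℝ) (n : ℕ) (hn : n ≠ 0) :
    ∫ z in Rect a b T0, ‖(n:ℂ)^(-z)‖^2 ≤ (volume (Rect a b T0)).toReal * (n:ℝ)^(-(2*a)) := by
  have h : ∀ z ∈ Rect a b T0, ‖(n:ℂ)^(-z)‖^2 ≤ (n:ℝ)^(-(2*a)) := by
    intro z hz
    rw [Complex.norm_natCast_cpow_of_pos (Nat.pos_of_ne_zero hn), ← Real.rpow_natCast, ← Real.rpow_mul (Nat.cast_nonneg _)]
    refine Real.rpow_le_rpow_of_exponent_le (by exact_mod_cast Nat.one_le_iff_ne_zero.2 hn) ?_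
    have := hz.1
    simp only [Complex.neg_re]; push_cast; linarith
  have hc : Continuous (fun z : ℂ => ‖(n:ℂ)^(-z)‖^2) := (const_cpow_cont n hn).norm.pow 2
  refine (setIntegral_mono_on (hc.continuousOn.integrableOn_compact (Rect_compact a b T0))
      (integrableOn_const (Rect_compact a b T0).measure_lt_top.ne) (Rect_compact a b T0).measurableSet h).trans ?_
  rw [setIntegral_const]; simp [Measure.real]

noncomputable def G1 (P : Finset ℕ) (s : ℂ) : ℂ := riemannZeta s * ∏ p ∈ P, (1 - (p:ℂ)^(-s)) - 1

lemma G1_cont (P : Finset ℕ) (hP : ∀ p ∈ P, p.Prime) : ContinuousOn (G1 P) {s : ℂ | 0 < s.re ∧ s.re < 1} := by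
  unfold G1
  refine (zeta_contOn.mul ?_).sub continuousOn_const
  exact continuousOn_finsetProd _ fun p hp => continuousOn_const.sub (const_cpow_cont p (hP p hp).ne_zero).continuousOn

lemma G2_MB (a b T0 : ℝ) (F : Finset ℕ) (hF : ∀ p ∈ F, p.Prime) (c : ℕ → ℝ) (hc : ∀ p, |c p| ≤ 1/4)
    (W : ℝ → ℝ) (hW0 : ∀ t, 0 ≤ W t) (A : ℝ) (hA : 0 ≤ A) (hWm : MeanTo (fun t => (W t : ℂ)) (A:ℝ)) (e : ℝ)
    (hoff : ∀ p ∈ F, ∀ q ∈ F, p ≠ q → MeanTo (fun t => (W t : ℂ) * ((ef (-(e * Real.log p)) t - c p) * (starRingEnd ℂ) (ef (-(e * Real.log q)) t - c q))) 0)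
    (N0 : ℕ) (θ : ℝ) (hFN : ∀ p ∈ F, N0 < p) (hθ : ∀ s : Finset ℕ, (∀ n ∈ s, N0 < n) → ∑ n ∈ s, (n:ℝ)^(-(2*a)) ≤ θ) :
    MB (fun t => W t * ∫ z in Rect a b T0, ‖∑ p ∈ F, (p:ℂ)^(-z) * (ef (-(e * Real.log p)) t - c p)‖^2) (4 * A * ((volume (Rect a b T0)).toReal * θ)) := by
  have h := quad F (Rect a b T0) (Rect_compact a b T0) (fun p z => (p:ℂ)^(-z)) (fun p hp => (const_cpow_cont p (hF p hp).ne_zero).continuousOn)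
    (fun p t => ef (-(e * Real.log p)) t - c p) (fun p => (ef_cont _).sub continuous_const) (fun p _ t => ?_) W hW0 A hWm hoff
  · refine h.mono h.1 (fun t => le_rfl) (mul_le_mul_of_nonneg_left ?_ (by positivity))
    refine (Finset.sum_le_sum fun p hp => int_npow a b T0 p (hF p hp).ne_zero).trans ?_
    rw [← Finset.mul_sum]
    exact mul_le_mul_of_nonneg_left (hθ F hFN) ENNReal.toReal_nonneg
  · have h1 : ‖ef (-(e * Real.log p)) t - c p‖ ≤ 2 := by
      refine (norm_sub_le _ _).trans ?_
      rw [ef_norm, Complex.norm_real, Real.norm_eq_abs]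
      linarith [hc p]
    calc _ ≤ (2:ℝ)^2 := pow_le_pow_left₀ (norm_nonneg _) h1 2
      _ = 4 := by norm_num

lemma G1_MB (a b T0 : ℝ) (ha : 1/2 < a) (hab : a ≤ b) (hb : b < 1) (P : Finset ℕ) (hP : ∀ p ∈ P, p.Prime)
    (W : ℝ → ℝ) (hW0 : ∀ t, 0 ≤ W t) (A M : ℝ) (hA : 0 ≤ A) (hWM : ∀ t, W t ≤ M) (hWm : MeanTo (fun t => (W t : ℂ)) (A:ℝ)) (e : ℝ) (he : e ≠ 0)
    (hoff : ∀ n m : ℕ, n ≠ 0 → m ≠ 0 → n ≠ m → (∀ p ∈ P, ¬ p ∣ n) → (∀ p ∈ P, ¬ p ∣ m) →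
          MeanTo (fun t => (W t : ℂ) * (ef (-(e * Real.log n)) t * (starRingEnd ℂ) (ef (-(e * Real.log m)) t))) 0)
    (N0 : ℕ) (θ : ℝ) (hPN : ∀ p : ℕ, p.Prime → p ≤ N0 → p ∈ P) (hθ : ∀ s : Finset ℕ, (∀ n ∈ s, N0 < n) → ∑ n ∈ s, (n:ℝ)^(-(2*a)) ≤ θ)
    (η : ℝ) (hη : 0 < η) :
    MB (fun t => W t * ∫ z in Rect a b T0, ‖G1 P (z + (e * t : ℝ) * I)‖^2) (8 * A * ((volume (Rect a b T0)).toReal * θ) + η) := by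
  classical
  have ha0 : 0 < a := by linarith
  have hM : 0 ≤ M := (hW0 0).trans (hWM 0)
  obtain ⟨Y0, hY0⟩ := MS_MB ha0 hab hb (MS_prod (T0 := T0) ha hb P hP) (η/(2*M+1)) (by positivity)
  set Y := max Y0 1 with hY
  have m1 := hY0 Y (le_max_left _ _) e he
  set s : Finset ℕ := (Finset.Ioc 1 Y).filter (fun n => ∀ p ∈ P, ¬ p ∣ n) with hs
  have hs0 : ∀ n ∈ s, n ≠ 0 := by
    intro n hn
    have := (Finset.mem_Ioc.1 (Finset.mem_filter.1 hn).1).1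
    omega
  have hsN : ∀ n ∈ s, N0 < n := by
    intro n hn
    have h1 := (Finset.mem_Ioc.1 (Finset.mem_filter.1 hn).1).1
    have h2 := (Finset.mem_filter.1 hn).2
    by_contra hh
    push Not at hh
    have hp := Nat.minFac_prime (n := n) (by omega)
    exact h2 _ (hPN _ hp ((Nat.minFac_le (by omega)).trans hh)) (Nat.minFac_dvd n)
  have m2 := quad s (Rect a b T0) (Rect_compact a b T0) (fun n z => (n:ℂ)^(-z)) (fun n hn => (const_cpow_cont n (hs0 n hn)).continuousOn)
    (fun n t => ef (-(e * Real.log n)) t) (fun n => ef_cont _) (fun n _ t => by rw [ef_norm]; norm_num) W hW0 A hWm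
    (fun n hn m hm hnm => hoff n m (hs0 n hn) (hs0 m hm) hnm (Finset.mem_filter.1 hn).2 (Finset.mem_filter.1 hm).2)
  have m3 := (m1.smul (2*M) (by positivity)).add (m2.smul 2 (by norm_num))
  have hWc : Continuous W := Complex.continuous_re.comp hWm.1
  have hc1 := (param_cont a b T0 ha0 hab hb (G1 P) (G1_cont P hP)).comp (continuous_const.mul continuous_id : Continuous (fun t : ℝ => e * t))
  refine m3.mono (hWc.mul hc1) (fun t => ?_) ?_
  · set FY : ℂ → ℂ := fun s => riemannZeta s * ∏ p ∈ P, (1 - (p:ℂ)^(-s)) - ∑ n ∈ Finset.Ioc 0 Y, cop P n * (n:ℂ)^(-s) with hFY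
    have hdec : ∀ z : ℂ, G1 P (z + (e * t : ℝ) * I) = FY (z + (e*t:ℝ) * I) + ∑ n ∈ s, (n:ℂ)^(-z) * ef (-(e * Real.log n)) t := by
      intro z
      have e1 : ∑ n ∈ Finset.Ioc 0 Y, cop P n * (n:ℂ)^(-(z + (e*t:ℝ) * I)) = 1 + ∑ n ∈ s, (n:ℂ)^(-z) * ef (-(e * Real.log n)) t := by
        rw [← Finset.sum_Ioc_consecutive _ (Nat.zero_le 1) (le_max_right Y0 1)]
        congr 1
        · simp only [Nat.Ioc_succ_singleton, Finset.sum_singleton, zero_add, Nat.cast_one, one_cpow, mul_one]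
          unfold cop
          rw [if_pos]
          intro p hp h
          exact (hP p hp).one_lt.ne' (Nat.dvd_one.1 h)
        · rw [hs, Finset.sum_filter]
          refine Finset.sum_congr rfl fun n hn => ?_
          have hn0 : n ≠ 0 := by have := (Finset.mem_Ioc.1 hn).1; omega
          unfold cop
          split_ifs
          · rw [cpow_shift n hn0, ef_scale, one_mul]; congr 2; ring
          · simp
      simp only [G1, hFY]
      rw [e1]; ring
    have hFc : ContinuousOn FY {s : ℂ | 0 < s.re ∧ s.re < 1} := (MS_prod (T0 := T0) ha hb P hP).1 Y
    have hsh : ContinuousOn (fun z : ℂ => FY (z + (e*t:ℝ) * I)) (Rect a b T0) := by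
      refine hFc.comp (by fun_prop) fun z hz => ?_
      have h1 := hz.1
      have h2 := hz.2.1
      simp only [Set.mem_setOf_eq, Complex.add_re, Complex.mul_re, Complex.ofReal_re, Complex.ofReal_im, Complex.I_re, Complex.I_im]
      constructor <;> linarith
    have hGsh : ContinuousOn (fun z : ℂ => ∑ n ∈ s, (n:ℂ)^(-z) * ef (-(e * Real.log n)) t) (Rect a b T0) :=
      continuousOn_finsetSum _ fun n hn => (const_cpow_cont n (hs0 n hn)).continuousOn.mul continuousOn_const
    have hi1 : IntegrableOn (fun z : ℂ => ‖FY (z + (e*t:ℝ) * I)‖^2) (Rect a b T0) := (hsh.norm.pow 2).integrableOn_compact (μ := volume) (Rect_compact a b T0)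
    have hi2 : IntegrableOn (fun z : ℂ => ‖∑ n ∈ s, (n:ℂ)^(-z) * ef (-(e * Real.log n)) t‖^2) (Rect a b T0) := (hGsh.norm.pow 2).integrableOn_compact (μ := volume) (Rect_compact a b T0)
    have hle : ∫ z in Rect a b T0, ‖G1 P (z + (e * t : ℝ) * I)‖^2 ≤ 2 * (∫ z in Rect a b T0, ‖FY (z + (e*t:ℝ) * I)‖^2) +
        2 * ∫ z in Rect a b T0, ‖∑ n ∈ s, (n:ℂ)^(-z) * ef (-(e * Real.log n)) t‖^2 := by
      rw [← integral_const_mul, ← integral_const_mul, ← integral_add (hi1.const_mul 2) (hi2.const_mul 2)]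
      refine setIntegral_mono_on ?_ ((hi1.const_mul 2).add (hi2.const_mul 2)) (Rect_compact a b T0).measurableSet fun z _ => ?_
      · simp only [hdec]
        exact ((hsh.add hGsh).norm.pow 2).integrableOn_compact (Rect_compact a b T0)
      · rw [hdec]
        set x := FY (z + (e*t:ℝ) * I)
        set y := ∑ n ∈ s, (n:ℂ)^(-z) * ef (-(e * Real.log n)) t
        have h1 := pow_le_pow_left₀ (norm_nonneg _) (norm_add_le x y) 2
        have h2 := sq_nonneg (‖x‖ - ‖y‖)
        nlinarith
    have hI0 : 0 ≤ ∫ z in Rect a b T0, ‖FY (z + (e*t:ℝ) * I)‖^2 := integral_nonneg fun z => by positivity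
    have h3 := mul_le_mul_of_nonneg_left hle (hW0 t)
    have h4 := mul_le_mul_of_nonneg_right (hWM t) hI0
    refine h3.trans ?_
    rw [mul_add]
    refine add_le_add ?_ (le_of_eq (by ring))
    calc _ = 2 * (W t * ∫ z in Rect a b T0, ‖FY (z + (e*t:ℝ) * I)‖^2) := by ring
      _ ≤ 2 * (M * ∫ z in Rect a b T0, ‖FY (z + (e*t:ℝ) * I)‖^2) := by linarith
      _ = _ := by ring
  · have h1 : ∑ n ∈ s, ∫ z in Rect a b T0, ‖(n:ℂ)^(-z)‖^2 ≤ (volume (Rect a b T0)).toReal * θ := by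
      refine (Finset.sum_le_sum fun n hn => int_npow a b T0 n (hs0 n hn)).trans ?_
      rw [← Finset.mul_sum]
      exact mul_le_mul_of_nonneg_left (hθ s hsN) ENNReal.toReal_nonneg
    have h2 : 2 * M * (η/(2*M+1)) ≤ η := by
      rw [mul_div_assoc', div_le_iff₀ (by positivity)]; nlinarith
    have h3 := mul_le_mul_of_nonneg_left h1 (show 0 ≤ 8 * A by positivity)
    linarith

lemma one_sub_slit {w : ℂ} (h : ‖w‖ ≤ 71/100) : 1 - w ∈ Complex.slitPlane := by
  have : ‖-w‖ < 1 := by rw [norm_neg]; linarith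
  have := Complex.mem_slitPlane_of_norm_lt_one this
  rwa [← sub_eq_add_neg] at this

lemma log_lip {w w' : ℂ} (h : ‖w‖ ≤ 71/100) (h' : ‖w'‖ ≤ 71/100) : ‖Complex.log (1 - w) - Complex.log (1 - w')‖ ≤ 4 * ‖w - w'‖ := by
  have hd : ∀ x ∈ Metric.closedBall (0:ℂ) (71/100), HasDerivWithinAt (fun w => Complex.log (1 - w)) (-1 / (1 - x)) (Metric.closedBall (0:ℂ) (71/100)) x := by
    intro x hx
    have hx' : ‖x‖ ≤ 71/100 := by simpa using hx
    have := ((hasDerivAt_const x (1:ℂ)).sub (hasDerivAt_id x)).clog (one_sub_slit hx')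
    simpa using this.hasDerivWithinAt
  refine (convex_closedBall (0:ℂ) (71/100)).norm_image_sub_le_of_norm_hasDerivWithin_le hd ?_ (by simpa using h') (by simpa using h)
  intro x hx
  have hx' : ‖x‖ ≤ 71/100 := by simpa using hx
  rw [norm_div, norm_neg, norm_one]
  have h1 : 29/100 ≤ ‖1 - x‖ := by
    have := norm_sub_norm_le (1:ℂ) x
    rw [norm_one] at this; linarith
  rw [div_le_iff₀ (by linarith)]; linarith

lemma log_quad {w : ℂ} (h : ‖w‖ ≤ 71/100) : ‖-Complex.log (1 - w) - w‖ ≤ 2 * ‖w‖^2 := by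
  have h1 : ‖-w‖ < 1 := by rw [norm_neg]; linarith
  have := Complex.norm_log_one_add_sub_self_le h1
  rw [norm_neg, ← sub_eq_add_neg] at this
  have e : -Complex.log (1 - w) - w = -(Complex.log (1-w) - -w) := by ring
  rw [e, norm_neg]
  refine this.trans ?_
  have h2 : (1 - ‖w‖)⁻¹ ≤ 4 := by
    rw [inv_le_comm₀ (by linarith) (by norm_num)]; linarith
  have := mul_le_mul_of_nonneg_left h2 (sq_nonneg ‖w‖)
  linarith

lemma prime_small (p : ℕ) (hp : p.Prime) (s : ℂ) (hs : 1/2 ≤ s.re) : ‖(p:ℂ)^(-s)‖ ≤ 71/100 := by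
  rw [Complex.norm_natCast_cpow_of_pos hp.pos]
  have hp1 : (1:ℝ) ≤ p := by exact_mod_cast hp.one_lt.le
  have hp2 : (2:ℝ) ≤ p := by exact_mod_cast hp.two_le
  have h1 : ((p:ℝ)^((-s).re))^2 ≤ (p:ℝ)^(-1:ℝ) := by
    rw [← Real.rpow_natCast, ← Real.rpow_mul (Nat.cast_nonneg _)]
    refine Real.rpow_le_rpow_of_exponent_le hp1 ?_
    simp only [Complex.neg_re]; push_cast; linarith
  rw [Real.rpow_neg_one] at h1
  have h2 : (p:ℝ)⁻¹ ≤ 2⁻¹ := inv_anti₀ (by norm_num) hp2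
  have h0 : 0 ≤ (p:ℝ)^((-s).re) := Real.rpow_nonneg (Nat.cast_nonneg _) _
  nlinarith

lemma det_bound (a : ℝ) (ha : 1/2 < a) (s : ℂ) (hs : a ≤ s.re) (Q F : Finset ℕ) (hQ : ∀ p ∈ Q, p.Prime) (hF : ∀ p ∈ F, p.Prime ∧ p ∉ Q)
    (h : ℕ → ℂ) (hh : ∀ p, ‖h p‖ = 1) (c : ℕ → ℝ) (η1 κ q θ : ℝ)
    (h1 : ‖∑ p ∈ Q, -Complex.log (1 - (p:ℂ)^(-s)) + ∑ p ∈ F, (c p:ℂ)*(p:ℂ)^(-s)‖ ≤ η1)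
    (h2 : ‖∑ p ∈ F, (p:ℂ)^(-s) * (h p - c p)‖ ≤ κ) (h3 : ∑ p ∈ Q, ‖1 - h p‖ ≤ q) (h4 : ∑ p ∈ F, (p:ℝ)^(-(2*a)) ≤ θ) :
    ‖∑ p ∈ Q ∪ F, -Complex.log (1 - (p:ℂ)^(-s) * h p)‖ ≤ 4 * q + η1 + κ + 2 * θ := by
  have hdis : Disjoint Q F := Finset.disjoint_left.2 fun p hp hpF => (hF p hpF).2 hp
  rw [Finset.sum_union hdis]
  have hsmall : ∀ p : ℕ, p.Prime → ‖(p:ℂ)^(-s) * h p‖ ≤ 71/100 := by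
    intro p hp
    rw [norm_mul, hh, mul_one]; exact prime_small p hp s (by linarith)
  have e : ∑ p ∈ Q, -Complex.log (1 - (p:ℂ)^(-s) * h p) + ∑ p ∈ F, -Complex.log (1 - (p:ℂ)^(-s) * h p) =
      ∑ p ∈ Q, (Complex.log (1 - (p:ℂ)^(-s)) - Complex.log (1 - (p:ℂ)^(-s) * h p)) +
      (∑ p ∈ Q, -Complex.log (1 - (p:ℂ)^(-s)) + ∑ p ∈ F, (c p:ℂ)*(p:ℂ)^(-s)) + (∑ p ∈ F, (p:ℂ)^(-s) * (h p - c p)) +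
      ∑ p ∈ F, (-Complex.log (1 - (p:ℂ)^(-s) * h p) - (p:ℂ)^(-s) * h p) := by
    have e1 : ∑ p ∈ Q, -Complex.log (1 - (p:ℂ)^(-s) * h p) = ∑ p ∈ Q, (Complex.log (1 - (p:ℂ)^(-s)) - Complex.log (1 - (p:ℂ)^(-s) * h p)) + ∑ p ∈ Q, -Complex.log (1 - (p:ℂ)^(-s)) := by
      rw [← Finset.sum_add_distrib]; exact Finset.sum_congr rfl fun p _ => by ring
    have e2 : ∑ p ∈ F, -Complex.log (1 - (p:ℂ)^(-s) * h p) = ∑ p ∈ F, (c p:ℂ)*(p:ℂ)^(-s) + (∑ p ∈ F, (p:ℂ)^(-s) * (h p - c p)) +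
      ∑ p ∈ F, (-Complex.log (1 - (p:ℂ)^(-s) * h p) - (p:ℂ)^(-s) * h p) := by
      rw [← Finset.sum_add_distrib, ← Finset.sum_add_distrib]; exact Finset.sum_congr rfl fun p _ => by ring
    rw [e1, e2]; ring
  rw [e]
  have b1 : ‖∑ p ∈ Q, (Complex.log (1 - (p:ℂ)^(-s)) - Complex.log (1 - (p:ℂ)^(-s) * h p))‖ ≤ 4 * q := by
    refine (norm_sum_le _ _).trans ((Finset.sum_le_sum fun p hp => ?_).trans ((Finset.mul_sum Q (fun p => ‖1 - h p‖) 4).symm.le.trans (mul_le_mul_of_nonneg_left h3 (by norm_num))))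
    have hp' := prime_small p (hQ p hp) s (by linarith)
    refine (log_lip hp' (hsmall p (hQ p hp))).trans ?_
    have : (p:ℂ)^(-s) - (p:ℂ)^(-s) * h p = (p:ℂ)^(-s) * (1 - h p) := by ring
    rw [this, norm_mul]
    have := mul_le_mul_of_nonneg_right hp' (norm_nonneg (1 - h p))
    have := norm_nonneg (1 - h p)
    linarith
  have b2 : ‖∑ p ∈ F, (-Complex.log (1 - (p:ℂ)^(-s) * h p) - (p:ℂ)^(-s) * h p)‖ ≤ 2 * θ := by
    refine (norm_sum_le _ _).trans ((Finset.sum_le_sum fun p hp => ?_).trans ((Finset.mul_sum F (fun p : ℕ => (p:ℝ)^(-(2*a))) 2).symm.le.trans (mul_le_mul_of_nonneg_left h4 (by norm_num))))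
    refine (log_quad (hsmall p (hF p hp).1)).trans (mul_le_mul_of_nonneg_left ?_ (by norm_num))
    rw [norm_mul, hh, mul_one, Complex.norm_natCast_cpow_of_pos (hF p hp).1.pos, ← Real.rpow_natCast, ← Real.rpow_mul (Nat.cast_nonneg _)]
    refine Real.rpow_le_rpow_of_exponent_le (by exact_mod_cast (hF p hp).1.one_lt.le) ?_
    simp only [Complex.neg_re]; push_cast; linarith
  refine (norm_add_le _ _).trans (add_le_add ((norm_add_le _ _).trans (add_le_add ((norm_add_le _ _).trans (add_le_add b1 h1)) h2)) b2)

lemma zeta_eq (P : Finset ℕ) (hP : ∀ p ∈ P, p.Prime) (s : ℂ) (hs : 1/2 ≤ s.re) :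
    riemannZeta s = (1 + G1 P s) * cexp (∑ p ∈ P, -Complex.log (1 - (p:ℂ)^(-s))) := by
  have hne : ∀ p ∈ P, 1 - (p:ℂ)^(-s) ≠ 0 := fun p hp => Complex.slitPlane_ne_zero (one_sub_slit (prime_small p (hP p hp) s hs))
  rw [Complex.exp_sum, Finset.prod_congr rfl fun p hp => by rw [Complex.exp_neg, Complex.exp_log (hne p hp)], Finset.prod_inv_distrib, G1]
  have : ∏ p ∈ P, (1 - (p:ℂ)^(-s)) ≠ 0 := Finset.prod_ne_zero_iff.2 hne
  field_simp
  ring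

lemma log_small (ε : ℝ) (hε : 0 < ε) : ∃ δ > 0, ∀ g l : ℂ, ‖g‖ ≤ δ → ‖l‖ ≤ δ → ‖Complex.log ((1 + g) * cexp l)‖ < ε := by
  have hc : ContinuousAt (fun x : ℂ × ℂ => Complex.log ((1 + x.1) * cexp x.2)) (0, 0) := by
    refine ContinuousAt.clog (by fun_prop) (by simp)
  have := Metric.continuousAt_iff.1 hc ε hε
  obtain ⟨δ, hδ, h⟩ := this
  refine ⟨δ/2, by positivity, fun g l hg hl => ?_⟩
  have := h (x := (g, l)) (by rw [Prod.dist_eq]; simp only [dist_zero_right]; exact max_lt (by linarith) (by linarith))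
  simpa using this

lemma rpow_tail (a : ℝ) (ha : 1/2 < a) (θ : ℝ) (hθ : 0 < θ) : ∃ N0 : ℕ, ∀ s : Finset ℕ, (∀ n ∈ s, N0 < n) → ∑ n ∈ s, (n:ℝ)^(-(2*a)) ≤ θ := by
  have hs : Summable (fun n : ℕ => (n:ℝ)^(-(2*a))) := Real.summable_nat_rpow.2 (by linarith)
  obtain ⟨S, hS⟩ := summable_iff_vanishing_norm.1 hs θ hθ
  refine ⟨S.sup id, fun s h => ?_⟩
  have := hS s (Finset.disjoint_left.2 fun n hn hnS => by
    have h1 := h n hn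
    have h2 : n ≤ S.sup id := Finset.le_sup (f := id) hnS
    omega)
  exact (le_abs_self _).trans (by rw [← Real.norm_eq_abs]; exact this.le)

noncomputable def I1 (a b T0 : ℝ) (P : Finset ℕ) (e t : ℝ) : ℝ := ∫ z in Rect a b T0, ‖G1 P (z + (e * t : ℝ) * I)‖^2
noncomputable def I2 (a b T0 : ℝ) (F : Finset ℕ) (c : ℕ → ℝ) (e t : ℝ) : ℝ :=
  ∫ z in Rect a b T0, ‖∑ p ∈ F, (p:ℂ)^(-z) * (ef (-(e * Real.log p)) t - c p)‖^2
noncomputable def I3 (Q : Finset ℕ) (e t : ℝ) : ℝ := (Q.card + 1) * ∑ p ∈ Q, ‖1 - ef (e * Real.log p) t‖^2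

lemma I1_nonneg (a b T0 : ℝ) (P : Finset ℕ) (e t : ℝ) : 0 ≤ I1 a b T0 P e t := integral_nonneg fun z => by positivity
lemma I2_nonneg (a b T0 : ℝ) (F : Finset ℕ) (c : ℕ → ℝ) (e t : ℝ) : 0 ≤ I2 a b T0 F c e t := integral_nonneg fun z => by positivity
lemma I3_nonneg (Q : Finset ℕ) (e t : ℝ) : 0 ≤ I3 Q e t := by unfold I3; positivity

lemma I1_cont (a b T0 : ℝ) (ha : 0 < a) (hab : a ≤ b) (hb : b < 1) (P : Finset ℕ) (hP : ∀ p ∈ P, p.Prime) (e : ℝ) : Continuous (I1 a b T0 P e) :=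
  (param_cont a b T0 ha hab hb (G1 P) (G1_cont P hP)).comp (continuous_const.mul continuous_id : Continuous (fun t : ℝ => e * t))

lemma I2_cont (a b T0 : ℝ) (F : Finset ℕ) (hF : ∀ p ∈ F, p.Prime) (c : ℕ → ℝ) (e : ℝ) : Continuous (I2 a b T0 F c e) := by
  unfold I2
  refine continuous_parametric_integral_of_continuous ?_ (Rect_compact a b T0)
  simp only [Function.uncurry_def]
  refine (continuous_finsetSum _ fun p hp => ?_).norm.pow 2
  exact ((const_cpow_cont p (hF p hp).ne_zero).comp continuous_snd).mul (((ef_cont _).comp continuous_fst).sub continuous_const)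

lemma I3_cont (Q : Finset ℕ) (e : ℝ) : Continuous (I3 Q e) := by
  unfold I3
  exact continuous_const.mul (continuous_finsetSum _ fun p _ => (continuous_const.sub (ef_cont _)).norm.pow 2)

/-- deterministic part -/
lemma det_all (a b T0 r C δ ε ε0 θ : ℝ) (ha : 1/2 < a - 2*r) (hr : 0 < r) (hb : b + 2*r < 1) 
    (hC : ∀ (a b T : ℝ) (G : ℂ → ℂ), DifferentiableOn ℂ G {z | a-2*r<z.re ∧ z.re<b+2*r} → ∀ s∈Rect a b T, ‖G s‖^2 ≤ C * ∫ z in Rect (a-r) (b+r) (T+r), ‖G z‖^2)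
    (hC0 : 0 < C) (hδ : 0 < δ) (hlog : ∀ g l : ℂ, ‖g‖ ≤ δ → ‖l‖ ≤ δ → ‖Complex.log ((1 + g) * cexp l)‖ < ε)
    (hε1 : C * ε0 ≤ (δ/8)^2) (hε2 : ε0 ≤ (δ/32)^2) (hθ : θ ≤ δ/16)
    (Q F : Finset ℕ) (hQ : ∀ p ∈ Q, p.Prime) (hF : ∀ p ∈ F, p.Prime ∧ p ∉ Q) (c : ℕ → ℝ)
    (happ : ∀ s ∈ Rect a b T0, ‖∑ p ∈ Q, -Complex.log (1-(p:ℂ)^(-s)) + ∑ p ∈ F, (c p:ℂ)*(p:ℂ)^(-s)‖ < δ/8)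
    (hFθ : ∑ p ∈ F, (p:ℝ)^(-(2*(a-r))) ≤ θ) (e t : ℝ)
    (h1 : I1 (a-r) (b+r) (T0+r) (Q ∪ F) e t ≤ ε0) (h2 : I2 (a-r) (b+r) (T0+r) F c e t ≤ ε0) (h3 : I3 Q e t ≤ ε0)
    (s : ℂ) (hs : s ∈ Rect a b T0) : ‖Complex.log (riemannZeta (s + (e * t : ℝ) * I))‖ < ε := by
  have hP : ∀ p ∈ Q ∪ F, p.Prime := fun p hp => (Finset.mem_union.1 hp).elim (hQ p) (fun h => (hF p h).1)
  have hsre : ((s + (e * t : ℝ) * I)).re = s.re := by simp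
  have hsa := hs.1
  have hsb := hs.2.1
  rw [zeta_eq (Q ∪ F) hP _ (by rw [hsre]; linarith)]
  have hsq : ∀ x : ℝ, 0 ≤ x → x^2 ≤ (δ/8)^2 → x ≤ δ/8 := fun x hx h => (pow_le_pow_iff_left₀ hx (by positivity) two_ne_zero).1 h
  have hcd : ∀ p : ℕ, p ≠ 0 → Differentiable ℂ (fun z : ℂ => (p:ℂ)^(-z)) := by
    intro p hp z
    exact (differentiableAt_id.neg).const_cpow (Or.inl (by exact_mod_cast hp))
  have g1 : ‖G1 (Q ∪ F) (s + (e * t : ℝ) * I)‖ ≤ δ/8 := by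
    refine hsq _ (norm_nonneg _) ?_
    have := hC a b T0 (fun z => G1 (Q ∪ F) (z + (e * t : ℝ) * I)) ?_ s hs
    · exact this.trans ((mul_le_mul_of_nonneg_left h1 hC0.le).trans hε1)
    · intro z hz
      refine DifferentiableAt.differentiableWithinAt ?_
      unfold G1
      have hlin : DifferentiableAt ℂ (fun z : ℂ => z + (e * t : ℝ) * I) z := by fun_prop
      refine DifferentiableAt.sub (DifferentiableAt.mul ?_ ?_) (differentiableAt_const _)
      · refine DifferentiableAt.comp z (differentiableAt_riemannZeta ?_) hlin
        intro h
        have := congrArg Complex.re h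
        simp at this
        linarith [hz.2]
      · refine DifferentiableAt.fun_finsetProd fun p hp => ?_
        refine (differentiableAt_const _).sub ?_
        exact DifferentiableAt.comp (g := fun z : ℂ => (p:ℂ)^(-z)) z (hcd p (hP p hp).ne_zero _) hlin
  have g2 : ‖∑ p ∈ F, (p:ℂ)^(-s) * (ef (-(e * Real.log p)) t - c p)‖ ≤ δ/8 := by
    refine hsq _ (norm_nonneg _) ?_
    have := hC a b T0 (fun z => ∑ p ∈ F, (p:ℂ)^(-z) * (ef (-(e * Real.log p)) t - c p)) ?_ s hs
    · exact this.trans ((mul_le_mul_of_nonneg_left h2 hC0.le).trans hε1)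
    · refine Differentiable.differentiableOn ?_
      refine Differentiable.fun_sum fun p hp => ?_
      exact (hcd p (hF p hp).1.ne_zero).mul_const _
  have g3 : ∑ p ∈ Q, ‖1 - ef (-(e * Real.log p)) t‖ ≤ δ/32 := by
    have hn : ∀ p : ℕ, ‖1 - ef (-(e * Real.log p)) t‖ = ‖1 - ef (e * Real.log p) t‖ := by
      intro p
      rw [← ef_conj, ← Complex.norm_conj (1 - ef (e * Real.log p) t), map_sub, map_one]
    simp only [hn]
    have hcs := sq_sum_le_card_mul_sum_sq (s := Q) (f := fun p : ℕ => ‖1 - ef (e * Real.log p) t‖)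
    have h4 : (∑ p ∈ Q, ‖1 - ef (e * Real.log p) t‖)^2 ≤ (δ/32)^2 := by
      refine hcs.trans (le_trans ?_ (h3.trans hε2))
      unfold I3
      refine mul_le_mul_of_nonneg_right (by linarith) (Finset.sum_nonneg fun p _ => by positivity)
    exact (pow_le_pow_iff_left₀ (Finset.sum_nonneg fun p _ => norm_nonneg _) (by positivity) two_ne_zero).1 h4
  refine hlog _ _ (g1.trans (by linarith)) ?_
  have hdet := det_bound (a-r) (by linarith) s (by linarith) Q F hQ hF (fun p => ef (-(e * Real.log p)) t) (fun p => ef_norm _ _) c (δ/8) (δ/8) (δ/32) θ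
    (happ s hs).le g2 g3 hFθ
  have heq : ∑ p ∈ Q ∪ F, -Complex.log (1 - (p:ℂ)^(-(s + (e * t : ℝ) * I))) = ∑ p ∈ Q ∪ F, -Complex.log (1 - (p:ℂ)^(-s) * ef (-(e * Real.log p)) t) := by
    refine Finset.sum_congr rfl fun p hp => ?_
    rw [cpow_shift p (hP p hp).ne_zero, ef_scale, mul_neg]
  rw [heq]
  refine hdet.trans ?_
  linarith

theorem main_dens (d : ℝ) (hd : d ≠ 0) (a b T0 : ℝ) (ha : 1/2 < a) (hab : a ≤ b) (hb : b < 1) (hT0 : 0 ≤ T0) (ε : ℝ) (hε : 0 < ε) :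
    ∃ S : Set ℝ, (∀ t ∈ S, ∀ e : ℝ, e = 1 ∨ e = d → ∀ s ∈ Rect a b T0, ‖Complex.log (riemannZeta (s + (e * t : ℝ) * I))‖ < ε) ∧
      ∃ δ > 0, ∃ T1 > 0, ∀ T, T1 ≤ T → δ * T ≤ (volume (S ∩ Set.Icc 0 T)).toReal := by
  classical
  obtain ⟨r, hr, hra, hrb⟩ : ∃ r : ℝ, 0 < r ∧ 1/2 < a - 2*r ∧ b + 2*r < 1 := by
    refine ⟨min (a - 1/2) (1 - b) / 4, ?_, ?_, ?_⟩
    · have : 0 < min (a - 1/2) (1 - b) := lt_min (by linarith) (by linarith)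
      positivity
    · have := min_le_left (a - 1/2) (1 - b); linarith
    · have := min_le_right (a - 1/2) (1 - b); linarith
  obtain ⟨C, hC0, hC⟩ := sup_L2 hr
  obtain ⟨δ, hδ, hlog⟩ := log_small ε hε
  obtain ⟨ε0, hε0, hε1, hε2⟩ : ∃ ε0 : ℝ, 0 < ε0 ∧ C * ε0 ≤ (δ/8)^2 ∧ ε0 ≤ (δ/32)^2 := by
    refine ⟨min ((δ/8)^2/C) ((δ/32)^2), by positivity, ?_, min_le_right _ _⟩
    have := mul_le_mul_of_nonneg_left (min_le_left ((δ/8)^2/C) ((δ/32)^2)) hC0.le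
    refine this.trans (le_of_eq ?_); field_simp
  set a' := a - r with ha'
  set b' := b + r with hb'
  set T' := T0 + r with hT'
  set V := (volume (Rect a' b' T')).toReal with hV
  have hV0 : 0 ≤ V := ENNReal.toReal_nonneg
  obtain ⟨θ, hθ0, hθ1, hθ2⟩ : ∃ θ : ℝ, 0 < θ ∧ θ ≤ δ/16 ∧ 24 * (V * θ) ≤ ε0/8 := by
    refine ⟨min (δ/16) (ε0/8/(24*(V+1))), by positivity, min_le_left _ _, ?_⟩
    have h1 := min_le_right (δ/16) (ε0/8/(24*(V+1)))
    have h2 : 24 * (V * min (δ/16) (ε0/8/(24*(V+1)))) ≤ 24 * ((V+1) * (ε0/8/(24*(V+1)))) := by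
      have h0 : 0 ≤ min (δ/16) (ε0/8/(24*(V+1))) := by positivity
      have := mul_le_mul (show V ≤ V + 1 by linarith) h1 h0 (by linarith)
      linarith
    refine h2.trans (le_of_eq ?_)
    field_simp
  obtain ⟨N0, hN0⟩ := rpow_tail a' (by linarith) θ hθ0
  obtain ⟨Q0, hQ0p, hw⟩ := weight d hd
  set Q : Finset ℕ := Q0 ∪ (Finset.range (N0+1)).filter Nat.Prime with hQdef
  have hQ : ∀ p ∈ Q, p.Prime := by
    intro p hp
    rcases Finset.mem_union.1 hp with h | h
    · exact hQ0p p h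
    · exact (Finset.mem_filter.1 h).2
  have hQN : ∀ p : ℕ, p.Prime → p ≤ N0 → p ∈ Q := fun p hp h =>
    Finset.mem_union_right _ (Finset.mem_filter.2 ⟨Finset.mem_range.2 (by omega), hp⟩)
  obtain ⟨F, c, hF, hc, happ⟩ := approx_real a b T0 (by linarith) hab hb hT0 Q hQ (δ/8) (by positivity)
  have hFN : ∀ p ∈ F, N0 < p := by
    intro p hp
    by_contra hh
    exact (hF p hp).2 (hQN p (hF p hp).1 (not_lt.1 hh))
  have hP : ∀ p ∈ Q ∪ F, p.Prime := fun p hp => (Finset.mem_union.1 hp).elim (hQ p) (fun h => (hF p h).1)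
  set K : ℝ := (Q.card + 1) * Q.card with hK
  have hK0 : 0 ≤ K := by positivity
  obtain ⟨N, hN1, hN⟩ : ∃ N : ℕ, 1 ≤ N ∧ 2 * (K * (4 / N)) ≤ ε0/8 := by
    obtain ⟨n, hn⟩ := exists_nat_gt (64 * K / ε0)
    refine ⟨n + 1, by omega, ?_⟩
    rw [div_lt_iff₀ hε0] at hn
    have hn1 : (0:ℝ) < ((n+1 : ℕ) : ℝ) := by positivity
    rw [mul_div_assoc', mul_div_assoc', div_le_iff₀ hn1]
    push_cast
    nlinarith
  obtain ⟨W, A, M, hA, hWc, hW0, hWM, hWm, hwe⟩ := hw Q F Finset.subset_union_left hQ hF c hc N hN1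
  have hA0 : 0 ≤ A := by linarith
  set Ee : ℝ → ℝ → ℝ := fun e t => I1 a' b' T' (Q ∪ F) e t + I2 a' b' T' F c e t + I3 Q e t with hEe
  have hEe0 : ∀ e t, 0 ≤ Ee e t := fun e t => add_nonneg (add_nonneg (I1_nonneg _ _ _ _ _ _) (I2_nonneg _ _ _ _ _ _ _)) (I3_nonneg _ _ _)
  have hEc : ∀ e, Continuous (Ee e) := fun e =>
    ((I1_cont a' b' T' (by linarith) (by linarith) (by linarith) (Q ∪ F) hP e).add (I2_cont a' b' T' F (fun p hp => (hF p hp).1) c e)).add (I3_cont Q e)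
  have hMBe : ∀ e, e = 1 ∨ e = d → MB (fun t => W t * Ee e t) (12 * A * (V * θ) + ε0/32 + K * (4/N*A)) := by
    intro e he
    have he0 : e ≠ 0 := by rcases he with h | h <;> rw [h]; exacts [one_ne_zero, hd]
    obtain ⟨w1, w2, w3⟩ := hwe e he
    have m1 := G1_MB a' b' T' (by linarith) (by linarith) (by linarith) (Q ∪ F) hP W hW0 A M hA0 hWM hWm e he0 w3 N0 θ
      (fun p hp h => Finset.mem_union_left _ (hQN p hp h)) hN0 (ε0/32) (by positivity)
    have m2 := G2_MB a' b' T' F (fun p hp => (hF p hp).1) c hc W hW0 A hA0 hWm e w2 N0 θ hFN hN0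
    have m3 : MB (fun t => (Q.card + 1 : ℝ) * ∑ p ∈ Q, W t * ‖1 - ef (e * Real.log p) t‖^2) ((Q.card + 1) * ∑ p ∈ Q, 4/N*A) := by
      refine MB.smul (MB.sum Q fun p hp => ?_) _ (by positivity)
      obtain ⟨m, hm, hmm⟩ := w1 p hp
      have := MB_real hmm
      exact this.mono this.1 (fun t => le_rfl) hm
    refine ((m1.add m2).add m3).mono (hWc.mul (hEc e)) (fun t => le_of_eq ?_) (le_of_eq ?_)
    · simp only [hEe, I1, I2, I3]
      rw [← Finset.mul_sum]; ring
    · rw [Finset.sum_const, nsmul_eq_mul]; simp only [hK, hV]; ring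
  have hMB : MB (fun t => W t * (Ee 1 t + Ee d t)) (2 * (12 * A * (V * θ) + ε0/32 + K * (4/N*A))) := by
    refine ((hMBe 1 (Or.inl rfl)).add (hMBe d (Or.inr rfl))).mono (hWc.mul ((hEc 1).add (hEc d))) (fun t => le_of_eq ?_) (le_of_eq ?_)
    · ring
    · ring
  have hb0 : 2 * (12 * A * (V * θ) + ε0/32 + K * (4/N*A)) < ε0 * A / 2 := by
    have k1 := mul_le_mul_of_nonneg_right hθ2 hA0
    have k2 := mul_le_mul_of_nonneg_right hN hA0
    have k3 : ε0 ≤ ε0 * A := le_mul_of_one_le_right hε0.le hA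
    have e1 : 2 * (12 * A * (V * θ) + ε0/32 + K * (4/N*A)) = 24 * (V * θ) * A + ε0/16 + 2 * (K * (4/N)) * A := by ring
    rw [e1]
    linarith
  obtain ⟨δ', hδ', T1, hT1, hfin⟩ := markov W (fun t => Ee 1 t + Ee d t) A M _ ε0 hA hW0 hWM hWm ((hEc 1).add (hEc d))
    (fun t => add_nonneg (hEe0 1 t) (hEe0 d t)) hε0 hMB hb0
  refine ⟨{t | Ee 1 t + Ee d t ≤ ε0}, ?_, δ', hδ', T1, hT1, hfin⟩
  intro t ht e he s hs
  have hte : Ee e t ≤ ε0 := by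
    have h1 := hEe0 1 t
    have h2 := hEe0 d t
    have h3 : Ee 1 t + Ee d t ≤ ε0 := ht
    rcases he with h | h <;> rw [h] <;> linarith
  simp only [hEe] at hte
  have p1 := I1_nonneg a' b' T' (Q ∪ F) e t
  have p2 := I2_nonneg a' b' T' F c e t
  have p3 := I3_nonneg Q e t
  exact det_all a b T0 r C δ ε ε0 θ hra hr hrb hC hC0 hδ hlog hε1 hε2 hθ1 Q F hQ hF c happ (hN0 F hFN) e t (by linarith) (by linarith) (by linarith) s hs

theorem self_approx_log_zeta (d : ℝ) (hd : d ≠ 0)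
    (K : Set ℂ) (hK : IsCompact K) (hKD : K ⊆ strip) (hKc : IsConnected Kᶜ)
    (ε : ℝ) (hε : 0 < ε) :
    0 < lowerDens {τ : ℝ |
      supNorm K (fun s => Complex.log (riemannZeta (s + τ * Complex.I))
        - Complex.log (riemannZeta (s + (d * τ : ℝ) * Complex.I))) < ENNReal.ofReal ε} := by
  obtain ⟨a, b, T0, ha, hab, hb, hT0, hsub⟩ : ∃ a b T0 : ℝ, 1/2 < a ∧ a ≤ b ∧ b < 1 ∧ 0 ≤ T0 ∧
      K ⊆ Rect a b T0 := by
    rcases K.eq_empty_or_nonempty with h | h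
    · exact ⟨3/4, 3/4, 0, by norm_num, le_rfl, by norm_num, le_rfl, by simp [h]⟩
    · obtain ⟨x, hx, hxm⟩ := hK.exists_isMinOn h Complex.continuous_re.continuousOn
      obtain ⟨y, hy, hym⟩ := hK.exists_isMaxOn h Complex.continuous_re.continuousOn
      obtain ⟨w, hw, hwm⟩ := hK.exists_isMaxOn h (Complex.continuous_im.abs).continuousOn
      exact ⟨x.re, y.re, |w.im|, (hKD hx).1, hxm hy, (hKD hy).2, abs_nonneg _,
        fun z hz => ⟨hxm hz, hym hz, hwm hz⟩⟩
  obtain ⟨S, hS, δ, hδ, T1, hT1, hden⟩ := main_dens d hd a b T0 ha hab hb hT0 (ε/4) (by positivity)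
  have hsubS : S ⊆ {τ : ℝ |
      supNorm K (fun s => Complex.log (riemannZeta (s + τ * Complex.I))
        - Complex.log (riemannZeta (s + (d * τ : ℝ) * Complex.I))) < ENNReal.ofReal ε} := by
    intro t ht
    have h1 : supNorm K (fun s => Complex.log (riemannZeta (s + t * Complex.I))
        - Complex.log (riemannZeta (s + (d * t : ℝ) * Complex.I))) ≤ ENNReal.ofReal (ε/2) := by
      refine iSup₂_le fun s hs => ?_
      have e1 := hS t ht 1 (Or.inl rfl) s (hsub hs)
      have e2 := hS t ht d (Or.inr rfl) s (hsub hs)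
      rw [one_mul] at e1
      have e3 := norm_sub_le (Complex.log (riemannZeta (s + t * Complex.I)))
        (Complex.log (riemannZeta (s + (d * t : ℝ) * Complex.I)))
      rw [← enorm_eq_nnnorm, ← ofReal_norm_eq_enorm]
      exact ENNReal.ofReal_le_ofReal (by linarith)
    exact lt_of_le_of_lt h1 ((ENNReal.ofReal_lt_ofReal_iff hε).2 (by linarith))
  have hfin : ∀ (A : Set ℝ) (T : ℝ), volume (A ∩ Set.Icc 0 T) ≠ ⊤ := fun A T =>
    ((measure_mono Set.inter_subset_right).trans_lt measure_Icc_lt_top).ne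
  refine lt_of_lt_of_le hδ (le_liminf_of_le ?_ ?_)
  · refine IsBoundedUnder.isCoboundedUnder_ge (isBoundedUnder_of_eventually_le (a := 1) ?_)
    filter_upwards [eventually_gt_atTop 0] with T hT
    rw [div_le_one hT]
    calc _ ≤ (volume (Set.Icc 0 T)).toReal :=
          ENNReal.toReal_mono measure_Icc_lt_top.ne (measure_mono Set.inter_subset_right)
      _ = T := by rw [Real.volume_Icc, ENNReal.toReal_ofReal (by linarith)]; ring
  · filter_upwards [eventually_ge_atTop T1] with T hT
    rw [le_div_iff₀ (hT1.trans_le hT)]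
    exact (hden T hT).trans (ENNReal.toReal_mono (hfin _ _)
      (measure_mono (Set.inter_subset_inter_left _ hsubS)))
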